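/- arXiv:2512.15402 — 8 statements merged into one kernel-verified Lean document; each statement's English description precedes it below -/
import Mathlib

section
/- For every compact set A ⊂ ℝⁿ and every compact set K ⊂ Conv(ℝⁿ,ℝ) there exist m ∈ ℕ and C > 0 such that for all Ψ ∈ P_dLV(ℝⁿ): sup{|Ψ(f)(φ)| : f ∈ K, φ ∈ C_c(ℝⁿ), supp φ ⊂ A, ‖φ‖_∞ ≤ 1} ≤ C · sup{|Ψ(f)(φ)| : φ ∈ C_c(ℝⁿ), supp φ ⊂ closed ball B̄_m(0), ‖φ‖_∞ ≤ 1, f ∈ Conv(ℝⁿ,ℝ) with sup_{|x| ≤ m+1} |f(x)| ≤ 1}. -/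
open scoped CompactlySupported NNReal

noncomputable section

abbrev Eucl (n : ℕ) := EuclideanSpace ℝ (Fin n)

def RadonMeasure (n : ℕ) : Submodule ℂ (C_c(Eucl n, ℂ) →ₗ[ℂ] ℂ) where
  carrier := {μ | ∀ A : Set (Eucl n), IsCompact A → ∃ C : ℝ, ∀ φ : C_c(Eucl n, ℂ),
      tsupport ⇑φ ⊆ A → (∀ x, ‖φ x‖ ≤ 1) → ‖μ φ‖ ≤ C}
  add_mem' := by
    intro μ ν hμ hν A hA
    obtain ⟨C₁, h₁⟩ := hμ A hA
    obtain ⟨C₂, h₂⟩ := hν A hA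
    refine ⟨C₁ + C₂, fun φ h h' => ?_⟩
    calc ‖(μ + ν) φ‖ = ‖μ φ + ν φ‖ := by simp
    _ ≤ ‖μ φ‖ + ‖ν φ‖ := norm_add_le _ _
    _ ≤ C₁ + C₂ := add_le_add (h₁ φ h h') (h₂ φ h h')
  zero_mem' := fun _ _ => ⟨0, fun φ _ _ => by simp⟩
  smul_mem' := by
    intro c μ hμ A hA
    obtain ⟨C, h⟩ := hμ A hA
    refine ⟨‖c‖ * C, fun φ hs hb => ?_⟩
    simp only [LinearMap.smul_apply, norm_smul]
    exact mul_le_mul_of_nonneg_left (h φ hs hb) (norm_nonneg c)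

abbrev ConvFn (n : ℕ) := {f : C(Eucl n, ℝ) // ConvexOn ℝ Set.univ ⇑f}

def IsLocalFunctional {n : ℕ} (Ψ : ConvFn n → RadonMeasure n) : Prop :=
  ∀ (f h : ConvFn n) (U : Set (Eucl n)), IsOpen U → (∀ x ∈ U, f.1 x = h.1 x) →
    ∀ φ : C_c(Eucl n, ℂ), tsupport ⇑φ ⊆ U → (Ψ f).1 φ = (Ψ h).1 φ

def IsContinuousFunctional {n : ℕ} (Ψ : ConvFn n → RadonMeasure n) : Prop :=
  ∀ φ : C_c(Eucl n, ℂ), Continuous fun f : ConvFn n => (Ψ f).1 φ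

lemma convexOn_affine {n : ℕ} (s : ℝ) (v : Eucl n) :
    ConvexOn ℝ Set.univ (fun x : Eucl n => s + inner ℝ v x) := by
  refine ⟨convex_univ, fun x _ y _ a b _ _ hab => le_of_eq ?_⟩
  simp only [smul_eq_mul, inner_add_right, real_inner_smul_right]
  linear_combination s * hab.symm

/-- Add the affine function `ℓ(x) = s + ⟨v, x⟩` to a convex function. -/
def addAffine {n : ℕ} (f : ConvFn n) (s : ℝ) (v : Eucl n) : ConvFn n :=
  ⟨⟨fun x => f.1 x + (s + inner ℝ v x),
    (map_continuous f.1).add (continuous_const.add (Continuous.inner continuous_const continuous_id))⟩,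
    f.2.add (convexOn_affine s v)⟩

/-- `Ψ` is polynomial of degree at most `d`: for every `f` and `φ`, the map
`(s, v) ↦ Ψ(f + s + ⟨v, ·⟩)(φ)` is (the restriction of) a polynomial of degree at most `d`
on `ℝ × ℝⁿ`. -/
def IsPolynomialDeg {n : ℕ} (d : ℕ) (Ψ : ConvFn n → RadonMeasure n) : Prop :=
  ∀ (f : ConvFn n) (φ : C_c(Eucl n, ℂ)), ∃ P : MvPolynomial (Fin (n + 1)) ℂ,
    P.totalDegree ≤ d ∧ ∀ (s : ℝ) (v : Eucl n),
      (Ψ (addAffine f s v)).1 φ = MvPolynomial.eval (Fin.cons (s : ℂ) fun i => (v i : ℂ)) P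

/-- `P_dLV(ℝⁿ)`: continuous local functionals, polynomial of degree at most `d`. -/
def MemPdLV {n : ℕ} (d : ℕ) (Ψ : ConvFn n → RadonMeasure n) : Prop :=
  IsLocalFunctional Ψ ∧ IsContinuousFunctional Ψ ∧ IsPolynomialDeg d Ψ

/-- Multiply a convex function by a nonnegative scalar `t ≥ 0`. -/
def smulConv {n : ℕ} (t : ℝ≥0) (f : ConvFn n) : ConvFn n :=
  ⟨(t : ℝ) • f.1, by exact f.2.smul t.2⟩

/-- `Ψ` is homogeneous of degree `k`: `Ψ(t f) = t^k Ψ(f)` for `t ≥ 0`. -/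
def IsHomogeneousDeg {n : ℕ} (k : ℕ) (Ψ : ConvFn n → RadonMeasure n) : Prop :=
  ∀ (f : ConvFn n) (t : ℝ≥0), Ψ (smulConv t f) = ((t : ℝ) : ℂ) ^ k • Ψ f

open MeasureTheory Topology Filter

lemma aux_grad {n : ℕ} {f : Eucl n → ℝ} (hf : ConvexOn ℝ Set.univ f) (hd : Differentiable ℝ f)
    (x y : Eucl n) : f x + inner ℝ (gradient f x) (y - x) ≤ f y := by
  have h1 : HasDerivAt (fun t : ℝ => f (x + t • (y - x))) (inner ℝ (gradient f x) (y - x)) 0 := by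
    have hg : HasFDerivAt f (InnerProductSpace.toDual ℝ (Eucl n) (gradient f x)) (x + (0:ℝ) • (y - x)) := by
      simpa using (hd x).hasGradientAt.hasFDerivAt
    have hl : HasDerivAt (fun t : ℝ => x + t • (y - x)) (y - x) 0 := by
      simpa using ((hasDerivAt_id (0:ℝ)).smul_const (y - x)).const_add x
    have := hg.comp_hasDerivAt (0:ℝ) hl
    rw [InnerProductSpace.toDual_apply_apply] at this
    exact this
  have hc : ConvexOn ℝ Set.univ (fun t : ℝ => f (x + t • (y - x))) := by
    refine ⟨convex_univ, fun s _ t _ a b ha hb hab => ?_⟩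
    have := hf.2 (Set.mem_univ (x + s • (y - x))) (Set.mem_univ (x + t • (y - x))) ha hb hab
    convert this using 2
    have : x = a • x + b • x := by rw [← add_smul, hab, one_smul]
    simp only [smul_add, smul_smul, smul_eq_mul, add_smul]
    nth_rewrite 1 [this]
    abel
  have := hc.le_slope_of_hasDerivAt (Set.mem_univ 0) (Set.mem_univ 1) zero_lt_one h1
  simp only [slope_def_field, one_smul, zero_smul, add_zero, sub_zero, div_one,
    add_sub_cancel] at this
  linarith

lemma aux_approx {n : ℕ} (f : ConvFn n) : ∃ F : ℕ → ConvFn n, Tendsto F atTop (𝓝 f) ∧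
    ∀ j, ∃ v : Eucl n → Eucl n, Continuous v ∧
      ∀ x y, (F j).1 x + inner ℝ (v x) (y - x) ≤ (F j).1 y := by
  let φ : ℕ → ContDiffBump (0 : Eucl n) := fun j =>
    ⟨1 / (2 * ((j:ℝ) + 1)), 1 / ((j:ℝ) + 1), by positivity, by
      apply one_div_lt_one_div_of_lt <;> [positivity; skip]
      have : (0:ℝ) ≤ j := by positivity
      linarith⟩
  let G : ℕ → Eucl n → ℝ := fun j =>
    convolution ((φ j).normed volume) (⇑f.1) (ContinuousLinearMap.lsmul ℝ ℝ) volume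
  have hfc : Continuous (⇑f.1) := map_continuous f.1
  have hsm : ∀ j, ContDiff ℝ 1 (G j) := fun j => by
    have := (φ j).hasCompactSupport_normed (μ := volume) |>.contDiff_convolution_left (n := 1)
      (ContinuousLinearMap.lsmul ℝ ℝ) (φ j).contDiff_normed (hfc.locallyIntegrable (μ := volume))
    exact_mod_cast this
  have hint : ∀ j x, Integrable (fun t => (φ j).normed volume t * f.1 (x - t)) := fun j x => by
    apply Continuous.integrable_of_hasCompactSupport
    · exact (φ j).continuous_normed.mul (hfc.comp (by fun_prop))
    · exact ((φ j).hasCompactSupport_normed (μ := volume)).mul_right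
  have hcv : ∀ j, ConvexOn ℝ Set.univ (G j) := fun j => by
    refine ⟨convex_univ, fun x _ y _ a b ha hb hab => ?_⟩
    simp only [G, convolution_def, ContinuousLinearMap.lsmul_apply, smul_eq_mul]
    rw [← integral_const_mul, ← integral_const_mul, ← integral_add ((hint j x).const_mul a) ((hint j y).const_mul b)]
    refine integral_mono (hint j _) (((hint j x).const_mul a).add ((hint j y).const_mul b)) fun t => ?_
    have h := f.2.2 (Set.mem_univ (x - t)) (Set.mem_univ (y - t)) ha hb hab
    have h0 := (φ j).nonneg_normed (μ := volume) t
    have e : a • x + b • y - t = a • (x - t) + b • (y - t) := by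
      have : t = a • t + b • t := by rw [← add_smul, hab, one_smul]
      nth_rewrite 1 [this]
      simp only [smul_sub]; abel
    simp only [e]
    have := mul_le_mul_of_nonneg_left h h0
    simp only [smul_eq_mul] at this
    linarith
  refine ⟨fun j => ⟨⟨G j, (hsm j).continuous⟩, hcv j⟩, ?_, fun j => ⟨gradient (G j), ?_, ?_⟩⟩
  · rw [tendsto_subtype_rng, ContinuousMap.tendsto_iff_forall_isCompact_tendstoUniformlyOn]
    intro K hK
    rw [Metric.tendstoUniformlyOn_iff]
    intro ε hε
    have hKc : IsCompact (Metric.cthickening 1 K) := hK.cthickening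
    have huc := hKc.uniformContinuousOn_of_continuous hfc.continuousOn
    rw [Metric.uniformContinuousOn_iff] at huc
    obtain ⟨δ, hδ, h⟩ := huc (ε / 2) (by positivity)
    have hev : ∀ᶠ j : ℕ in atTop, 1 / ((j:ℝ) + 1) < δ :=
      (tendsto_one_div_add_atTop_nhds_zero_nat).eventually_lt_const hδ
    filter_upwards [hev] with j hj x hx
    rw [dist_comm]
    have h1 : 1 / ((j:ℝ) + 1) ≤ 1 := by
      rw [div_le_one (by positivity)]
      have : (0:ℝ) ≤ j := by positivity
      linarith
    have := (φ j).dist_normed_convolution_le (μ := volume) (g := ⇑f.1) (x₀ := x) (ε := ε / 2)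
      hfc.aestronglyMeasurable (fun y hy => by
        have hy : dist y x < 1 / ((j:ℝ) + 1) := hy
        refine (h y ?_ x ?_ (hy.trans hj)).le
        · exact Metric.mem_cthickening_of_dist_le y x 1 K hx (hy.le.trans h1)
        · exact Metric.self_subset_cthickening K hx)
    exact this.trans_lt (by linarith)
  · have h : Continuous (fderiv ℝ (G j)) := (hsm j).continuous_fderiv (by simp)
    exact (InnerProductSpace.toDual ℝ (Eucl n)).symm.continuous.comp h
  · exact aux_grad (hcv j) ((hsm j).differentiable (by simp))

lemma aux_bound {n : ℕ} {f : Eucl n → ℝ} {x v : Eucl n} {M r : ℝ} (hr : 0 < r)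
    (hv : ∀ y, f x + inner ℝ v (y - x) ≤ f y) (hM : ∀ y, dist y x ≤ r → |f y| ≤ M) :
    ‖v‖ ≤ 2 * M / r := by
  rcases eq_or_ne v 0 with rfl | h0
  · have := (abs_nonneg _).trans (hM x (by simpa using hr.le))
    simp; positivity
  · have hn : 0 < ‖v‖ := norm_pos_iff.2 h0
    have h1 := hv (x + (r / ‖v‖) • v)
    have h2 := abs_le.1 (hM (x + (r / ‖v‖) • v) (by
      simp [norm_smul, abs_of_pos hr, hn.ne']))
    have h3 := abs_le.1 (hM x (by simpa using hr.le))
    rw [add_sub_cancel_left, real_inner_smul_right, real_inner_self_eq_norm_sq] at h1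
    have : r / ‖v‖ * ‖v‖ ^ 2 = ‖v‖ * r := by field_simp
    rw [le_div_iff₀ hr]
    linarith

lemma aux_ext {n : ℕ} (f : ConvFn n) (v : Eucl n → Eucl n) (U : Set (Eucl n)) (hU : U.Nonempty)
    (hv : ∀ x ∈ U, ∀ y, f.1 x + inner ℝ (v x) (y - x) ≤ f.1 y) (w : Eucl n) (ε : ℝ≥0)
    (hw : ∀ x ∈ U, ‖v x - w‖ ≤ ε) :
    ∃ g : ConvFn n, LipschitzWith ε g.1 ∧ ∀ x ∈ U, g.1 x = f.1 x - inner ℝ w x := by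
  let a : U → Eucl n → ℝ := fun y x => f.1 y + inner ℝ (v y) (x - y) - inner ℝ w x
  have hle : ∀ x (y : U), a y x ≤ f.1 x - inner ℝ w x := fun x y => by
    have := hv y y.2 x
    simp only [a]; linarith
  have hb : ∀ x, BddAbove (Set.range fun y => a y x) := fun x =>
    ⟨f.1 x - inner ℝ w x, by rintro _ ⟨y, rfl⟩; exact hle x y⟩
  have : Nonempty U := hU.to_subtype
  let g : Eucl n → ℝ := fun x => ⨆ y, a y x
  have hL : LipschitzWith ε g := by
    apply LipschitzWith.of_le_add_mul
    intro x y
    refine ciSup_le fun z => ?_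
    have h1 : a z y ≤ g y := le_ciSup (hb y) z
    have h2 : a z x = a z y + inner ℝ (v z - w) (x - y) := by
      simp only [a, inner_sub_left, inner_sub_right]; ring
    have h3 : inner ℝ (v z - w) (x - y) ≤ ε * dist x y := by
      rw [dist_eq_norm]
      exact (real_inner_le_norm _ _).trans (mul_le_mul_of_nonneg_right (hw z z.2) (norm_nonneg _))
    linarith
  refine ⟨⟨⟨g, hL.continuous⟩, convex_univ, fun x _ y _ s t hs ht hst => ?_⟩, hL, fun x hx => ?_⟩
  · refine ciSup_le fun z => ?_
    have h1 : a z x ≤ g x := le_ciSup (hb x) z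
    have h2 : a z y ≤ g y := le_ciSup (hb y) z
    have h3 : a z (s • x + t • y) = s * a z x + t * a z y := by
      simp only [a, inner_sub_right, inner_add_right, real_inner_smul_right]
      linear_combination (f.1 z - inner ℝ (v z) (z : Eucl n)) * (hst.symm)
    rw [h3]
    exact add_le_add (mul_le_mul_of_nonneg_left h1 hs) (mul_le_mul_of_nonneg_left h2 ht)
  · refine le_antisymm (ciSup_le fun z => hle x z) ?_
    have : a ⟨x, hx⟩ x ≤ g x := le_ciSup (hb x) ⟨x, hx⟩
    simpa [a] using this

lemma aux_compact {n : ℕ} (L : ℝ≥0) (R : ℝ) :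
    IsCompact {g : ConvFn n | LipschitzWith L g.1 ∧ |g.1 0| ≤ R} := by
  rw [Topology.IsEmbedding.subtypeVal.isCompact_iff]
  set S : Set C(Eucl n, ℝ) := Subtype.val '' {g : ConvFn n | LipschitzWith L g.1 ∧ |g.1 0| ≤ R} with hS
  have hmem : ∀ g : C(Eucl n, ℝ), g ∈ S ↔ ConvexOn ℝ Set.univ ⇑g ∧ LipschitzWith L g ∧ |g 0| ≤ R := by
    intro g
    constructor
    · rintro ⟨g, h, rfl⟩; exact ⟨g.2, h⟩
    · rintro ⟨h1, h2⟩; exact ⟨⟨g, h1⟩, h2, rfl⟩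
  refine ArzelaAscoli.isCompact_of_equicontinuous S ?_ ?_
  · have he : ContinuousMap.toFun '' S =
        {g : Eucl n → ℝ | ConvexOn ℝ Set.univ g ∧ LipschitzWith L g ∧ |g 0| ≤ R} := by
      ext g
      constructor
      · rintro ⟨g, h, rfl⟩; exact (hmem g).1 h
      · intro h; exact ⟨⟨g, h.2.1.continuous⟩, (hmem _).2 h, rfl⟩
    rw [he]
    refine IsCompact.of_isClosed_subset (isCompact_univ_pi
      (fun x : Eucl n => isCompact_Icc (a := -(R + L * ‖x‖)) (b := R + L * ‖x‖))) ?_ ?_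
    · have h1 : IsClosed {g : Eucl n → ℝ | ConvexOn ℝ Set.univ g} := by
        simp only [ConvexOn, convex_univ, true_and, Set.ofPred_forall]
        refine isClosed_iInter fun x => isClosed_iInter fun _ => isClosed_iInter fun y =>
          isClosed_iInter fun _ => isClosed_iInter fun a => isClosed_iInter fun b =>
          isClosed_iInter fun _ => isClosed_iInter fun _ => isClosed_iInter fun _ =>
          isClosed_le (by fun_prop) (by fun_prop)
      have h2 : IsClosed {g : Eucl n → ℝ | LipschitzWith L g} := by
        simp only [lipschitzWith_iff_dist_le_mul, Set.ofPred_forall]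
        exact isClosed_iInter fun x => isClosed_iInter fun y =>
          isClosed_le (by fun_prop) (by fun_prop)
      have h3 : IsClosed {g : Eucl n → ℝ | |g 0| ≤ R} := isClosed_le (by fun_prop) (by fun_prop)
      exact h1.inter (h2.inter h3)
    · rintro g ⟨_, h2, h3⟩ x _
      have := h2.dist_le_mul x 0
      rw [Real.dist_eq, dist_zero_right] at this
      rw [Set.mem_Icc, ← abs_le]
      have h4 := abs_sub_abs_le_abs_sub (g x) (g 0)
      linarith
  · refine LipschitzWith.uniformEquicontinuous _ L (fun g => ((hmem _).1 g.2).2.1) |>.equicontinuous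

def suppSub (n : ℕ) (B : Set (Eucl n)) : Submodule ℂ (BoundedContinuousFunction (Eucl n) ℂ) where
  carrier := {φ | ∀ x, x ∉ B → φ x = 0}
  add_mem' := by
    intro a b ha hb x hx
    simp [ha x hx, hb x hx]
  zero_mem' := fun _ _ => rfl
  smul_mem' := by
    intro c a ha x hx
    simp [ha x hx]

lemma suppSub_closed (n : ℕ) (B : Set (Eucl n)) :
    IsClosed (suppSub n B : Set (BoundedContinuousFunction (Eucl n) ℂ)) := by
  have : (suppSub n B : Set (BoundedContinuousFunction (Eucl n) ℂ)) =
      ⋂ x, ⋂ (_ : x ∉ B), {φ | φ x = 0} := by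
    ext φ
    simp only [Set.mem_iInter]
    rfl
  rw [this]
  exact isClosed_iInter fun x => isClosed_iInter fun _ =>
    isClosed_eq (continuous_eval_const x) continuous_const

def toCc {n : ℕ} {B : Set (Eucl n)} (hB : IsCompact B) : suppSub n B →ₗ[ℂ] C_c(Eucl n, ℂ) where
  toFun φ := ⟨⟨φ.1, φ.1.continuous⟩, HasCompactSupport.intro hB φ.2⟩
  map_add' _ _ := rfl
  map_smul' _ _ := rfl

lemma toCc_apply {n : ℕ} {B : Set (Eucl n)} (hB : IsCompact B) (φ : suppSub n B) (x : Eucl n) :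
    toCc hB φ x = φ.1 x := rfl

lemma toCc_tsupport {n : ℕ} {B : Set (Eucl n)} (hB : IsCompact B) (φ : suppSub n B) :
    tsupport (toCc hB φ) ⊆ B := by
  refine closure_minimal ?_ hB.isClosed
  intro x hx
  by_contra h
  exact hx (φ.2 x h)

lemma radon_bound {n : ℕ} (μ : RadonMeasure n) {B : Set (Eucl n)} (hB : IsCompact B) :
    ∃ C : ℝ, ∀ φ : suppSub n B, ‖(μ.1 ∘ₗ toCc hB) φ‖ ≤ C * ‖φ‖ := by
  obtain ⟨C, hC⟩ := μ.2 B hB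
  refine ⟨C, fun φ => ?_⟩
  rcases eq_or_ne φ 0 with rfl | h0
  · simp
  have hn : 0 < ‖φ‖ := norm_pos_iff.2 h0
  have hs : ‖((‖φ‖⁻¹ : ℝ) : ℂ)‖ = ‖φ‖⁻¹ := by
    rw [Complex.norm_real, norm_inv, norm_norm]
  have := hC (toCc hB (((‖φ‖⁻¹ : ℝ) : ℂ) • φ)) (toCc_tsupport hB _) (fun x => by
    rw [map_smul]
    change ‖((‖φ‖⁻¹ : ℝ) : ℂ) * φ.1 x‖ ≤ 1
    rw [norm_mul, hs, inv_mul_le_iff₀ hn, mul_one]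
    exact BoundedContinuousFunction.norm_coe_le_norm _ x)
  rw [map_smul, map_smul, norm_smul, hs, inv_mul_le_iff₀ hn, mul_comm] at this
  exact this

lemma aux_unif {n : ℕ} (Ψ : ConvFn n → RadonMeasure n) (hc : IsContinuousFunctional Ψ)
    (S : Set (ConvFn n)) (hS : IsCompact S) {B : Set (Eucl n)} (hB : IsCompact B) :
    ∃ C : ℝ, ∀ g ∈ S, ∀ φ : C_c(Eucl n, ℂ), tsupport ⇑φ ⊆ B → (∀ x, ‖φ x‖ ≤ 1) →
      ‖(Ψ g).1 φ‖ ≤ C := by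
  have : CompleteSpace (suppSub n B) := (suppSub_closed n B).completeSpace_coe
  choose c hcb using fun g : S => radon_bound (Ψ g.1) hB
  let T : S → suppSub n B →L[ℂ] ℂ := fun g => LinearMap.mkContinuous _ (c g) (hcb g)
  obtain ⟨C, hC⟩ := banach_steinhaus (g := T) (fun φ => by
    obtain ⟨C, hC⟩ := hS.exists_bound_of_continuousOn (hc (toCc hB φ)).continuousOn
    exact ⟨C, fun g => hC g.1 g.2⟩)
  refine ⟨C, fun g hg φ hφ h1 => ?_⟩
  let ψ : BoundedContinuousFunction (Eucl n) ℂ :=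
    BoundedContinuousFunction.ofNormedAddCommGroup φ (map_continuous φ) 1 h1
  let θ : suppSub n B := ⟨ψ, fun x hx => image_eq_zero_of_notMem_tsupport fun h => hx (hφ h)⟩
  have e : toCc hB θ = φ := by ext x; rfl
  have h2 : ‖θ‖ ≤ 1 := BoundedContinuousFunction.norm_ofNormedAddCommGroup_le _ zero_le_one h1
  have h3 := (T ⟨g, hg⟩).le_opNorm θ
  have h4 : T ⟨g, hg⟩ θ = (Ψ g).1 φ := by rw [← e]; rfl
  rw [h4] at h3
  have h5 := hC ⟨g, hg⟩
  calc _ ≤ _ := h3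
    _ ≤ C * 1 := mul_le_mul h5 h2 (norm_nonneg _) ((norm_nonneg _).trans h5)
    _ = C := mul_one C

lemma aux_poly (d : ℕ) (τ : ℝ) (hτ : 0 < τ) : ∃ C : ℝ, 0 ≤ C ∧ ∀ q : Polynomial ℂ,
    q.natDegree ≤ d → ∀ B : ℝ, (∀ t : ℝ, 0 ≤ t → t ≤ τ → ‖q.eval (t : ℂ)‖ ≤ B) →
      ‖q.eval 1‖ ≤ C * B := by
  let v : ℕ → ℂ := fun k => ((τ * k / (d + 1) : ℝ) : ℂ)
  let s := Finset.range (d + 1)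
  refine ⟨∑ k ∈ s, ‖(Lagrange.basis s v k).eval 1‖, Finset.sum_nonneg fun _ _ => norm_nonneg _,
    fun q hq B hB => ?_⟩
  have hv : Set.InjOn v s := by
    intro a _ b _ h
    have h : τ * a / (d + 1) = τ * b / (d + 1) := Complex.ofReal_injective h
    have hd : (d : ℝ) + 1 ≠ 0 := by positivity
    field_simp at h
    exact_mod_cast h
  have hdeg : q.degree < s.card := by
    refine (Polynomial.degree_le_natDegree).trans_lt ?_
    simp only [s, Finset.card_range]
    exact_mod_cast Nat.lt_succ_of_le hq
  rw [Lagrange.eq_interpolate hv hdeg, Lagrange.interpolate_apply, Polynomial.eval_finsetSum,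
    Finset.sum_mul]
  refine (norm_sum_le _ _).trans (Finset.sum_le_sum fun k hk => ?_)
  rw [Polynomial.eval_mul, Polynomial.eval_C, norm_mul, mul_comm]
  refine mul_le_mul_of_nonneg_left (hB _ (by positivity) ?_) (norm_nonneg _)
  rw [div_le_iff₀ (by positivity)]
  have : (k : ℝ) ≤ d + 1 := by
    have := (Finset.mem_range.1 hk).le
    exact_mod_cast this
  exact mul_le_mul_of_nonneg_left this hτ.le

lemma aux_poly2 (n d : ℕ) (τ : ℝ) (hτ : 0 < τ) : ∃ C : ℝ, 0 ≤ C ∧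
    ∀ Ψ : ConvFn n → RadonMeasure n, IsPolynomialDeg d Ψ → ∀ (h : ConvFn n) (s : ℝ) (w : Eucl n)
      (φ : C_c(Eucl n, ℂ)) (B : ℝ),
      (∀ t : ℝ, 0 ≤ t → t ≤ τ → ‖(Ψ (addAffine h (t * s) (t • w))).1 φ‖ ≤ B) →
      ‖(Ψ (addAffine h s w)).1 φ‖ ≤ C * B := by
  obtain ⟨C, hC0, hC⟩ := aux_poly d τ hτ
  refine ⟨C, hC0, fun Ψ hΨ h s w φ B hB => ?_⟩
  obtain ⟨P, hP, hPe⟩ := hΨ h φ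
  let z : Fin (n + 1) → ℂ := Fin.cons (s : ℂ) fun i => (w i : ℂ)
  let q : Polynomial ℂ := MvPolynomial.aeval (fun i => Polynomial.C (z i) * Polynomial.X) P
  have hq : q.natDegree ≤ d := by
    have := MvPolynomial.aeval_natDegree_le (m := d) (n := 1) P hP
      (fun i => Polynomial.C (z i) * Polynomial.X) (fun i => (Polynomial.natDegree_C_mul_le _ _).trans Polynomial.natDegree_X_le)
    simpa using this
  have he : ∀ t : ℝ, q.eval (t : ℂ) = (Ψ (addAffine h (t * s) (t • w))).1 φ := by
    intro t
    rw [hPe]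
    have : q.eval (t : ℂ) = MvPolynomial.eval (fun i => z i * t) P := by
      have e1 : q.eval (t : ℂ) = (Polynomial.aeval (t : ℂ)) q := by
        rw [Polynomial.coe_aeval_eq_eval]
      rw [e1]
      simp only [q]
      rw [← MvPolynomial.aeval_eq_eval, ← AlgHom.comp_apply, MvPolynomial.comp_aeval]
      simp
    rw [this]
    congr 2
    funext i
    refine Fin.cases ?_ (fun i => ?_) i
    · simp [z, mul_comm]
    · simp [z, mul_comm]
  have h1 := hC q hq B (fun t h0 h1 => by rw [he]; exact hB t h0 h1)
  have h2 := he 1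
  simp only [one_mul, one_smul, Complex.ofReal_one] at h2
  rwa [h2] at h1

lemma aux_dist {n : ℕ} {F : ℕ → ConvFn n} {f : ConvFn n} (h : Tendsto F atTop (𝓝 f)) (r : ℝ) :
    ∀ᶠ j in atTop, ∀ x : Eucl n, ‖x‖ ≤ r → |(F j).1 x| ≤ |f.1 x| + 1 := by
  rw [tendsto_subtype_rng, ContinuousMap.tendsto_iff_forall_isCompact_tendstoUniformlyOn] at h
  have h1 := h (Metric.closedBall 0 r) (isCompact_closedBall 0 r)
  rw [Metric.tendstoUniformlyOn_iff] at h1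
  filter_upwards [h1 1 one_pos] with j hj x hx
  have := hj x (by simpa using hx)
  rw [dist_comm, Real.dist_eq] at this
  have h4 := abs_sub_abs_le_abs_sub ((F j).1 x) (f.1 x)
  linarith

lemma aux_bdd {n : ℕ} (Ψ : ConvFn n → RadonMeasure n) (hl : IsLocalFunctional Ψ)
    (hc : IsContinuousFunctional Ψ) (m : ℕ) :
    BddAbove {r : ℝ | ∃ (g : ConvFn n) (φ' : C_c(Eucl n, ℂ)),
          tsupport ⇑φ' ⊆ Metric.closedBall (0 : Eucl n) m ∧ (∀ x, ‖φ' x‖ ≤ 1) ∧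
          (∀ x : Eucl n, ‖x‖ ≤ m + 1 → |g.1 x| ≤ 1) ∧ r = ‖(Ψ g).1 φ'‖} := by
  obtain ⟨C, hC⟩ := aux_unif Ψ hc _ (aux_compact (n := n) 8 2) (isCompact_closedBall (0 : Eucl n) m)
  refine ⟨C, ?_⟩
  rintro _ ⟨g, φ, hφ, hφ1, hg, rfl⟩
  obtain ⟨F, hF, hFs⟩ := aux_approx g
  have ht : Tendsto (fun j => ‖(Ψ (F j)).1 φ‖) atTop (𝓝 ‖(Ψ g).1 φ‖) :=
    (((hc φ).tendsto g).comp hF).norm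
  refine le_of_tendsto ht ?_
  filter_upwards [aux_dist hF (m + 1)] with j hj
  have hj2 : ∀ x : Eucl n, ‖x‖ ≤ m + 1 → |(F j).1 x| ≤ 2 := fun x hx => by
    linarith [hj x hx, hg x hx]
  obtain ⟨v, -, hv⟩ := hFs j
  have hm : (0:ℝ) ≤ m := by positivity
  obtain ⟨G, hG, hGU⟩ := aux_ext (F j) v (Metric.ball 0 (m + 1 / 2)) ⟨0, by simp; positivity⟩
    (fun x _ => hv x) 0 8 (fun x hx => by
      rw [sub_zero]
      have h := aux_bound (r := 1 / 2) (M := 2) (by norm_num) (hv x) (fun y hy => hj2 y (by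
        rw [mem_ball_zero_iff] at hx
        have := norm_le_norm_add_norm_sub x y
        rw [← dist_eq_norm, dist_comm] at this
        linarith))
      refine h.trans ?_
      norm_num)
  simp only [inner_zero_left, sub_zero] at hGU
  have hsub : tsupport φ ⊆ Metric.ball (0 : Eucl n) (m + 1 / 2) :=
    hφ.trans (Metric.closedBall_subset_ball (by linarith))
  rw [← hl G (F j) _ Metric.isOpen_ball hGU φ hsub]
  refine hC G ⟨hG, ?_⟩ φ hφ hφ1
  rw [hGU 0 (by simp; positivity)]
  exact hj2 0 (by simp; positivity)

lemma aux_K {n : ℕ} (K : Set (ConvFn n)) (hK : IsCompact K) (B : Set (Eucl n)) (hB : IsCompact B) :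
    ∃ M : ℝ, 0 ≤ M ∧ ∀ f ∈ K, ∀ x ∈ B, |f.1 x| ≤ M := by
  have hcont : Continuous fun p : ConvFn n × Eucl n => p.1.1 p.2 := by fun_prop
  obtain ⟨M, hM⟩ := (hK.prod hB).exists_bound_of_continuousOn hcont.continuousOn
  exact ⟨|M|, abs_nonneg _, fun f hf x hx => (hM (f, x) ⟨hf, hx⟩).trans (le_abs_self _)⟩

lemma aux_cover {n : ℕ} (L ε : ℝ) (hε : 0 < ε) : ∃ (N : ℕ) (w : Fin N → Eucl n),
    (∀ i, ‖w i‖ ≤ L) ∧ ∀ v : Eucl n, ‖v‖ ≤ L → ∃ i, ‖v - w i‖ < ε := by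
  obtain ⟨t, ht, htf, hc⟩ := finite_cover_balls_of_compact
    (isCompact_closedBall (0 : Eucl n) L) hε
  obtain ⟨N, w, hw, rfl⟩ := htf.fin_param
  refine ⟨N, w, fun i => by simpa using ht ⟨i, rfl⟩, fun v hv => ?_⟩
  have := hc (show v ∈ Metric.closedBall 0 L by simpa using hv)
  simp only [Set.mem_iUnion, Set.mem_range, exists_prop] at this
  obtain ⟨_, ⟨i, rfl⟩, h⟩ := this
  exact ⟨i, by rwa [← dist_eq_norm]⟩

lemma aux_smooth {n : ℕ} (N : ℕ) (Ψ : ConvFn n → RadonMeasure n) (hl : IsLocalFunctional Ψ)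
    (m : ℕ) (A : Set (Eucl n)) (hA : IsCompact A) (hAm : A ⊆ Metric.closedBall 0 m)
    (f : ConvFn n) (M L : ℝ) (hM : ∀ x : Eucl n, ‖x‖ ≤ m + 1 → |f.1 x| ≤ M)
    (hL : 2 * M ≤ L)
    (v : Eucl n → Eucl n) (hvc : Continuous v)
    (hv : ∀ x y, f.1 x + inner ℝ (v x) (y - x) ≤ f.1 y)
    (w : Fin N → Eucl n) (hwL : ∀ i, ‖w i‖ ≤ L) (ε : ℝ≥0) (hεm : (ε : ℝ) * (2 * m + 1) ≤ 1 / 2)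
    (hw : ∀ v : Eucl n, ‖v‖ ≤ L → ∃ i, ‖v - w i‖ < ε)
    (T : ℝ) (hT0 : 0 ≤ T)
    (hT : ∀ (h : ConvFn n) (s : ℝ) (w : Eucl n) (φ : C_c(Eucl n, ℂ)),
      (∀ x : Eucl n, ‖x‖ ≤ m + 1 → |h.1 x| ≤ 1 / 2) → |s| ≤ M + L * m → ‖w‖ ≤ L →
      tsupport φ ⊆ A → (∀ x, ‖φ x‖ ≤ 1) → ‖(Ψ (addAffine h s w)).1 φ‖ ≤ T)
    (φ : C_c(Eucl n, ℂ)) (hφ : tsupport φ ⊆ A) (hφ1 : ∀ x, ‖φ x‖ ≤ 1) :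
    ‖(Ψ f).1 φ‖ ≤ N * T := by
  let U : Fin N → Set (Eucl n) := fun i => {x | ‖v x - w i‖ < ε}
  have hU : ∀ i, IsOpen (U i) := fun i => isOpen_lt (by fun_prop) continuous_const
  have hcov : A ⊆ ⋃ i, U i := fun x hx => by
    have hxm : ‖x‖ ≤ m := by simpa using hAm hx
    have hb := aux_bound (r := 1) (M := M) one_pos (hv x) (fun y hy => hM y (by
        have := norm_le_norm_add_norm_sub x y
        rw [← dist_eq_norm, dist_comm] at this
        linarith))
    obtain ⟨i, hi⟩ := hw (v x) (by linarith)
    exact Set.mem_iUnion.2 ⟨i, hi⟩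
  obtain ⟨ρ, hρU, hρ1, hρI, hρc⟩ := exists_continuous_sum_one_of_isOpen_isCompact hU hA hcov
  let ψ : Fin N → C_c(Eucl n, ℂ) := fun i =>
    ⟨⟨fun x => (ρ i x : ℂ) * φ x, by fun_prop⟩, φ.hasCompactSupport.mul_left⟩
  have hψ : ∀ i x, ψ i x = (ρ i x : ℂ) * φ x := fun _ _ => rfl
  have hsum : φ = ∑ i, ψ i := by
    ext x
    rw [CompactlySupportedContinuousMap.sum_apply]
    simp only [hψ]
    rw [← Finset.sum_mul]
    by_cases hx : x ∈ A
    · have := hρ1 hx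
      simp only [Finset.sum_apply, Pi.one_apply] at this
      have h2 : ∑ i, ((ρ i x : ℝ) : ℂ) = 1 := by exact_mod_cast this
      rw [h2, one_mul]
    · rw [image_eq_zero_of_notMem_tsupport fun h => hx (hφ h), mul_zero]
  have hψA : ∀ i, tsupport (ψ i) ⊆ A := fun i =>
    (closure_mono (Function.support_mul_subset_right (fun x => (ρ i x : ℂ)) φ)).trans hφ
  have hψU : ∀ i, tsupport (ψ i) ⊆ U i := fun i => by
    refine (closure_mono ?_).trans (hρU i)
    intro x hx h
    apply hx
    rw [hψ, h]; simp
  have hψ1 : ∀ i x, ‖ψ i x‖ ≤ 1 := fun i x => by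
    rw [hψ, norm_mul, Complex.norm_real, Real.norm_of_nonneg (hρI i x).1]
    exact mul_le_one₀ (hρI i x).2 (norm_nonneg _) (hφ1 x)
  have key : ∀ i, ‖(Ψ f).1 (ψ i)‖ ≤ T := by
    intro i
    rcases (U i ∩ A).eq_empty_or_nonempty with he | ⟨z, hzU, hzA⟩
    · have : ψ i = 0 := by
        ext x
        by_contra hx
        have hx' := subset_tsupport _ (show x ∈ Function.support (ψ i) from hx)
        have : x ∈ U i ∩ A := ⟨hψU i hx', hψA i hx'⟩
        rw [he] at this
        exact this
      rw [this, map_zero, norm_zero]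
      exact hT0
    · obtain ⟨g, hgL, hgU⟩ := aux_ext f v (U i) ⟨z, hzU⟩ (fun x _ => hv x) (w i) ε
        (fun x hx => le_of_lt hx)
      have hzm : ‖z‖ ≤ m := by simpa using hAm hzA
      let s : ℝ := g.1 z
      let h : ConvFn n := addAffine g (-s) 0
      have hh : ∀ x, h.1 x = g.1 x - s := fun x => by
        change g.1 x + (-s + inner ℝ 0 x) = _
        rw [inner_zero_left]; ring
      have heq : ∀ x ∈ U i, f.1 x = (addAffine h s (w i)).1 x := fun x hx => by
        change _ = h.1 x + (s + inner ℝ (w i) x)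
        rw [hh, hgU x hx]; ring
      rw [hl f _ (U i) (hU i) heq (ψ i) (hψU i)]
      refine hT h s (w i) (ψ i) (fun x hx => ?_) ?_ (hwL i) (hψA i) (hψ1 i)
      · rw [hh]
        have h1 := hgL.dist_le_mul x z
        rw [Real.dist_eq] at h1
        have h2 : dist x z ≤ 2 * m + 1 := by
          rw [dist_eq_norm]
          have := norm_sub_le x z
          linarith
        exact h1.trans ((mul_le_mul_of_nonneg_left h2 ε.2).trans hεm)
      · change |g.1 z| ≤ _
        rw [hgU z hzU]
        have h1 := hM z (by linarith)
        have h2 : |inner ℝ (w i) z| ≤ L * m :=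
          (abs_real_inner_le_norm _ _).trans (mul_le_mul (hwL i) hzm (norm_nonneg _)
            ((norm_nonneg _).trans (hwL i)))
        exact (abs_sub _ _).trans (add_le_add h1 h2)
  calc ‖(Ψ f).1 φ‖ = ‖∑ i, (Ψ f).1 (ψ i)‖ := by rw [← map_sum, ← hsum]
    _ ≤ ∑ i, ‖(Ψ f).1 (ψ i)‖ := norm_sum_le _ _
    _ ≤ ∑ _i : Fin N, T := Finset.sum_le_sum fun i _ => key i
    _ = N * T := by simp

/-- For every compact `A ⊆ ℝⁿ` and every compact `K ⊆ Conv(ℝⁿ,ℝ)` there are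
`m ∈ ℕ` and `C > 0` such that for all `Ψ ∈ P_dLV(ℝⁿ)`, the seminorm `‖Ψ‖_{A;K}` is bounded by
`C` times the seminorm over test functions supported in `B̄_m(0)` and convex functions bounded
by `1` on `B̄_{m+1}(0)`. -/
theorem seminorm_domination {n d : ℕ} (A : Set (Eucl n)) (hA : IsCompact A)
    (K : Set (ConvFn n)) (hK : IsCompact K) :
    ∃ (m : ℕ) (C : ℝ), 0 < C ∧ ∀ Ψ : ConvFn n → RadonMeasure n, MemPdLV d Ψ →
      ∀ f ∈ K, ∀ φ : C_c(Eucl n, ℂ), tsupport ⇑φ ⊆ A → (∀ x, ‖φ x‖ ≤ 1) →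
        ‖(Ψ f).1 φ‖ ≤ C * sSup {r : ℝ | ∃ (g : ConvFn n) (φ' : C_c(Eucl n, ℂ)),
          tsupport ⇑φ' ⊆ Metric.closedBall (0 : Eucl n) m ∧ (∀ x, ‖φ' x‖ ≤ 1) ∧
          (∀ x : Eucl n, ‖x‖ ≤ m + 1 → |g.1 x| ≤ 1) ∧ r = ‖(Ψ g).1 φ'‖} := by
  obtain ⟨m, hAm⟩ : ∃ m : ℕ, A ⊆ Metric.closedBall 0 m := by
    obtain ⟨r, hr⟩ := hA.isBounded.subset_closedBall 0
    obtain ⟨m, hm⟩ := exists_nat_ge r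
    exact ⟨m, hr.trans (Metric.closedBall_subset_closedBall hm)⟩
  obtain ⟨M₀, hM₀, hMK⟩ := aux_K K hK _ (isCompact_closedBall (0 : Eucl n) (m + 1))
  obtain ⟨M, hMdef⟩ : ∃ M, M = M₀ + 1 := ⟨_, rfl⟩
  obtain ⟨L, hLdef⟩ : ∃ L, L = 2 * M := ⟨_, rfl⟩
  have hm0 : (0:ℝ) ≤ m := by positivity
  have hL0 : 0 < L := by linarith
  let ε : ℝ≥0 := ⟨1 / (2 * (2 * m + 1)), by positivity⟩
  have hε : (ε : ℝ) = 1 / (2 * (2 * m + 1)) := rfl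
  have hε0 : (0:ℝ) < ε := by rw [hε]; positivity
  obtain ⟨N, w, hwL, hw⟩ := aux_cover (n := n) L ε hε0
  obtain ⟨R, hR⟩ : ∃ R, R = M + L * m + L * (m + 1) := ⟨_, rfl⟩
  have hR0 : 0 < R := by
    rw [hR]
    have : 0 < M := by linarith
    positivity
  have hτ : 0 < 1 / (2 * R) := by positivity
  obtain ⟨C, hC0, hC⟩ := aux_poly2 n d (1 / (2 * R)) hτ
  refine ⟨m, N * C + 1, by positivity, fun Ψ ⟨hl, hc, hp⟩ f hf φ hφ hφ1 => ?_⟩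
  have hbdd := aux_bdd Ψ hl hc m
  set Q := {r : ℝ | ∃ (g : ConvFn n) (φ' : C_c(Eucl n, ℂ)),
          tsupport ⇑φ' ⊆ Metric.closedBall (0 : Eucl n) m ∧ (∀ x, ‖φ' x‖ ≤ 1) ∧
          (∀ x : Eucl n, ‖x‖ ≤ m + 1 → |g.1 x| ≤ 1) ∧ r = ‖(Ψ g).1 φ'‖} with hQ
  have hS0 : 0 ≤ sSup Q := by
    apply Real.sSup_nonneg
    rintro _ ⟨_, _, _, _, _, rfl⟩
    exact norm_nonneg _
  obtain ⟨F, hF, hFs⟩ := aux_approx f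
  have ht : Tendsto (fun j => ‖(Ψ (F j)).1 φ‖) atTop (𝓝 ‖(Ψ f).1 φ‖) :=
    (((hc φ).tendsto f).comp hF).norm
  refine le_of_tendsto ht ?_
  filter_upwards [aux_dist hF (m + 1)] with j hj
  obtain ⟨v, hvc, hv⟩ := hFs j
  have := aux_smooth N Ψ hl m A hA hAm (F j) M L
    (fun x hx => by
      have := hMK f hf x (by simpa using hx)
      linarith [hj x hx]) hLdef.ge v hvc hv w hwL ε
    (by rw [hε]; field_simp; rfl) hw (C * sSup Q) (by positivity)
    (fun h s w φ hh hs hw hφ hφ1 => by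
      refine hC Ψ hp h s w φ _ (fun t ht0 ht1 => ?_)
      refine le_csSup hbdd ⟨_, φ, hφ.trans hAm, hφ1, fun x hx => ?_, rfl⟩
      change |h.1 x + (t * s + inner ℝ (t • w) x)| ≤ 1
      rw [real_inner_smul_left, ← mul_add]
      have h1 : |inner ℝ w x| ≤ L * (m + 1) :=
        (abs_real_inner_le_norm _ _).trans (mul_le_mul hw hx (norm_nonneg _) hL0.le)
      have h2 : |s + inner ℝ w x| ≤ R := by
        rw [hR]
        exact (abs_add_le _ _).trans (add_le_add hs h1)
      have h3 : |t * (s + inner ℝ w x)| ≤ 1 / 2 := by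
        rw [abs_mul, abs_of_nonneg ht0]
        calc _ ≤ 1 / (2 * R) * R := mul_le_mul ht1 h2 (abs_nonneg _) hτ.le
          _ = 1 / 2 := by field_simp
      refine (abs_add_le _ _).trans ?_
      linarith [hh x hx]) φ hφ hφ1
  refine this.trans ?_
  rw [add_mul, one_mul, mul_assoc]
  linarith

end
end

section
/- Let A ⊂ ℝⁿ be compact and convex with nonempty interior, and for δ > 0 and Ψ ∈ P_dLV(ℝⁿ) set ‖Ψ‖_{A,δ} := sup{|Ψ(f)(φ)| : φ ∈ C_c(ℝⁿ), supp φ ⊂ A, ‖φ‖_∞ ≤ 1, f ∈ Conv(ℝⁿ,ℝ) with sup_{x ∈ A + δB̄₁(0)} |f(x)| ≤ 1}. Then ‖Ψ‖_{A,δ} < ∞ for every Ψ ∈ P_dLV(ℝⁿ), and for all 0 < s < t and every Ψ ∈ P_dLV(ℝⁿ) that is homogeneous of degree k (Ψ(τf) = τ^k Ψ(f) for τ ≥ 0): ‖Ψ‖_{A,t} ≤ ‖Ψ‖_{A,s} ≤ ((2/s)(2t + diam A) + 1)^k ‖Ψ‖_{A,t}. -/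
open scoped CompactlySupported NNReal

noncomputable section

open scoped Pointwise

/-- The quantity `‖Ψ‖_{A,δ} = sup{|Ψ(f)(φ)| : supp φ ⊆ A, ‖φ‖_∞ ≤ 1, sup_{A + δB̄₁(0)} |f| ≤ 1}`
(as a supremum in `ℝ`). -/
def seminormSet {n : ℕ} (A : Set (Eucl n)) (δ : ℝ) (Ψ : ConvFn n → RadonMeasure n) :
    Set ℝ :=
  {r : ℝ | ∃ (φ : C_c(Eucl n, ℂ)) (f : ConvFn n),
    tsupport ⇑φ ⊆ A ∧ (∀ x, ‖φ x‖ ≤ 1) ∧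
    (∀ x ∈ A + Metric.closedBall (0 : Eucl n) δ, |f.1 x| ≤ 1) ∧ r = ‖(Ψ f).1 φ‖}

/-- `‖Ψ‖_{A,δ}`. -/
def seminormAδ {n : ℕ} (A : Set (Eucl n)) (δ : ℝ) (Ψ : ConvFn n → RadonMeasure n) : ℝ :=
  sSup (seminormSet A δ Ψ)

lemma aux_lip {n : ℕ} (A : Set (Eucl n)) (s r : ℝ) (hr : 0 < r) (hs : 0 < s) (f : ConvFn n)
    (hf : ∀ x ∈ A + Metric.closedBall (0 : Eucl n) (s + r), |f.1 x| ≤ 1)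
    (x y : Eucl n) (hx : x ∈ A + Metric.closedBall (0 : Eucl n) s)
    (hy : y ∈ A + Metric.closedBall (0 : Eucl n) s) :
    f.1 y ≤ f.1 x + 2 / r * ‖y - x‖ := by
  rcases eq_or_ne y x with rfl | hne
  · simp
  have hpos : 0 < ‖y - x‖ := norm_pos_iff.2 (sub_ne_zero.2 hne)
  set D := ‖y - x‖ with hD
  set z : Eucl n := y + (r / D) • (y - x) with hz
  have hzm : z ∈ A + Metric.closedBall (0 : Eucl n) (s + r) := by
    obtain ⟨a, ha, b, hb, hab⟩ := Set.mem_add.1 hy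
    refine Set.mem_add.2 ⟨a, ha, b + (r / D) • (y - x), ?_, ?_⟩
    · rw [mem_closedBall_zero_iff] at hb ⊢
      refine (norm_add_le _ _).trans (add_le_add hb ?_)
      rw [norm_smul, Real.norm_of_nonneg (by positivity), ← hD]
      exact le_of_eq (div_mul_cancel₀ _ hpos.ne')
    · rw [hz, ← hab]; abel
  have hxm : x ∈ A + Metric.closedBall (0 : Eucl n) (s + r) := by
    obtain ⟨a, ha, b, hb, hab⟩ := Set.mem_add.1 hx
    exact Set.mem_add.2 ⟨a, ha, b, Metric.closedBall_subset_closedBall (by linarith) hb, hab⟩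
  have hfz := abs_le.1 (hf z hzm)
  have hfx := abs_le.1 (hf x hxm)
  have hc := f.2.2 (Set.mem_univ x) (Set.mem_univ z) (show 0 ≤ r / (D + r) by positivity)
    (show 0 ≤ D / (D + r) by positivity) (by field_simp; ring)
  have he : (r / (D + r)) • x + (D / (D + r)) • z = y := by
    rw [hz, smul_add, smul_smul]
    have h1 : D / (D + r) * (r / D) = r / (D + r) := by field_simp
    rw [h1, smul_sub]
    have h2 : (r / (D + r)) • x + ((D / (D + r)) • y + ((r / (D + r)) • y - (r / (D + r)) • x))
      = (D / (D + r) + r / (D + r)) • y := by rw [add_smul]; abel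
    rw [h2, ← add_div, div_self (by positivity), one_smul]
  rw [he] at hc
  simp only [smul_eq_mul] at hc
  have h3 : r / (D + r) * f.1 x + D / (D + r) * f.1 z
      = f.1 x + D / (D + r) * (f.1 z - f.1 x) := by field_simp; ring
  have h4 : D / (D + r) * (f.1 z - f.1 x) ≤ D / (D + r) * 2 :=
    mul_le_mul_of_nonneg_left (by linarith) (by positivity)
  have h5 : D / (D + r) ≤ D / r := by gcongr; linarith
  have h6 : 2 / r * D = D / r * 2 := by ring
  rw [h3] at hc
  linarith

lemma aux_ext_s7 {n : ℕ} (A : Set (Eucl n)) (hne : A.Nonempty) (hconv : Convex ℝ A) (δ : ℝ)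
    (hδ : 0 < δ) (f : ConvFn n)
    (hf : ∀ x ∈ A + Metric.closedBall (0 : Eucl n) δ, |f.1 x| ≤ 1) :
    ∃ g : ConvFn n, (∀ x ∈ A + Metric.ball (0 : Eucl n) (δ / 2), g.1 x = f.1 x) ∧
      (∀ x y, g.1 x ≤ g.1 y + 4 / δ * ‖x - y‖) ∧ (∀ x ∈ A, |g.1 x| ≤ 1) := by
  set K : Set (Eucl n) := A + Metric.closedBall (0 : Eucl n) (δ / 2) with hK
  have hKsub : ∀ x ∈ K, x ∈ A + Metric.closedBall (0 : Eucl n) δ := by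
    intro x hx
    exact Set.add_subset_add_left (Metric.closedBall_subset_closedBall (by linarith)) hx
  have hAK : A ⊆ K := fun a ha => Set.mem_add.2 ⟨a, ha, 0, by simp; positivity, by simp⟩
  have hKc : Convex ℝ K := hconv.add (convex_closedBall _ _)
  have : Nonempty K := let ⟨a, ha⟩ := hne; ⟨⟨a, hAK ha⟩⟩
  have hL : ∀ x ∈ K, ∀ y ∈ K, f.1 y ≤ f.1 x + 4 / δ * ‖y - x‖ := by
    intro x hx y hy
    have := aux_lip A (δ / 2) (δ / 2) (by positivity) (by positivity) f (by simpa using hf) x y hx hy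
    have h2 : 2 / (δ / 2) = 4 / δ := by field_simp; norm_num
    rwa [h2] at this
  have hL0 : 0 < 4 / δ := by positivity
  set L := 4 / δ
  let G : Eucl n → ℝ := fun x => ⨅ y : K, (f.1 y + L * ‖x - y‖)
  have hbdd : ∀ x : Eucl n, BddBelow (Set.range fun y : K => f.1 y + L * ‖x - y‖) := by
    intro x
    refine ⟨-1, ?_⟩
    rintro _ ⟨y, rfl⟩
    have := (abs_le.1 (hf y (hKsub y y.2))).1
    have h0 : 0 ≤ L * ‖x - y‖ := by positivity
    simp only
    linarith
  have hGle : ∀ x, ∀ y ∈ K, G x ≤ f.1 y + L * ‖x - y‖ := fun x y hy => ciInf_le (hbdd x) ⟨y, hy⟩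
  have hGlip : ∀ x y, G x ≤ G y + L * ‖x - y‖ := by
    intro x y
    rw [← sub_le_iff_le_add]
    refine le_ciInf fun u => ?_
    have h1 := hGle x u u.2
    have h2 : ‖x - u‖ ≤ ‖x - y‖ + ‖y - u‖ := norm_sub_le_norm_sub_add_norm_sub x y u
    nlinarith
  have hGeq : ∀ x ∈ K, G x = f.1 x := by
    intro x hx
    refine le_antisymm (by simpa using hGle x x hx) (le_ciInf fun u => hL u u.2 x hx)
  have hGconv : ConvexOn ℝ Set.univ G := by
    refine ⟨convex_univ, fun x _ y _ a b ha hb hab => ?_⟩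
    refine le_of_forall_pos_le_add fun ε hε => ?_
    obtain ⟨u, hu⟩ := exists_lt_of_ciInf_lt (show G x < G x + ε by linarith)
    obtain ⟨v, hv⟩ := exists_lt_of_ciInf_lt (show G y < G y + ε by linarith)
    have hm : a • (u : Eucl n) + b • (v : Eucl n) ∈ K := hKc u.2 v.2 ha hb hab
    have h1 := hGle (a • x + b • y) _ hm
    have h2 := f.2.2 (Set.mem_univ (u : Eucl n)) (Set.mem_univ (v : Eucl n)) ha hb hab
    have h3 : ‖(a • x + b • y) - (a • (u : Eucl n) + b • (v : Eucl n))‖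
        ≤ a * ‖x - u‖ + b * ‖y - v‖ := by
      have : (a • x + b • y) - (a • (u : Eucl n) + b • (v : Eucl n))
        = a • (x - u) + b • (y - v) := by simp only [smul_sub]; abel
      rw [this]
      refine (norm_add_le _ _).trans ?_
      rw [norm_smul, norm_smul, Real.norm_of_nonneg ha, Real.norm_of_nonneg hb]
    have h4 := mul_le_mul_of_nonneg_left h3 hL0.le
    have h5 := mul_le_mul_of_nonneg_left hu.le ha
    have h6 := mul_le_mul_of_nonneg_left hv.le hb
    have h7 : a * ε + b * ε = ε := by rw [← add_mul, hab, one_mul]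
    simp only [smul_eq_mul] at h2 ⊢
    nlinarith
  have hcont : Continuous G := by
    refine (LipschitzWith.of_le_add_mul (K := ⟨L, hL0.le⟩) (f := G) fun x y => ?_).continuous
    rw [dist_eq_norm]; exact hGlip x y
  refine ⟨⟨⟨G, hcont⟩, hGconv⟩, fun x hx => ?_, hGlip, fun x hx => ?_⟩
  · exact hGeq x (Set.add_subset_add_left Metric.ball_subset_closedBall hx)
  · change |G x| ≤ 1
    rw [hGeq x (hAK hx)]
    exact hf x (hKsub x (hAK hx))

lemma aux_eq {n : ℕ} (A : Set (Eucl n)) (δ : ℝ) (hδ : 0 < δ) (Ψ : ConvFn n → RadonMeasure n)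
    (hΨ : IsLocalFunctional Ψ) (f g : ConvFn n)
    (h : ∀ x ∈ A + Metric.ball (0 : Eucl n) δ, g.1 x = f.1 x) (φ : C_c(Eucl n, ℂ))
    (hφ : tsupport ⇑φ ⊆ A) : (Ψ f).1 φ = (Ψ g).1 φ :=
  hΨ f g _ (Metric.isOpen_ball.add_left) (fun x hx => (h x hx).symm) φ
    (hφ.trans fun a ha => Set.mem_add.2 ⟨a, ha, 0, by simpa using hδ, by simp⟩)

lemma aux_compact_s7 {n : ℕ} (a : Eucl n) (L : ℝ) (hL : 0 ≤ L) :
    IsCompact {g : ConvFn n | (∀ x y, g.1 x ≤ g.1 y + L * ‖x - y‖) ∧ |g.1 a| ≤ 1} := by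
  set S : Set C(Eucl n, ℝ) := {g | ConvexOn ℝ Set.univ ⇑g ∧
    (∀ x y, g x ≤ g y + L * ‖x - y‖) ∧ |g a| ≤ 1} with hS
  have hlip : ∀ g : Eucl n → ℝ, (∀ x y, g x ≤ g y + L * ‖x - y‖) →
      LipschitzWith ⟨L, hL⟩ g := fun g hg =>
    LipschitzWith.of_le_add_mul _ fun x y => by rw [dist_eq_norm]; exact hg x y
  have hSc : IsCompact S := by
    apply ArzelaAscoli.isCompact_of_equicontinuous
    · have him : (ContinuousMap.toFun '' S) = {g : Eucl n → ℝ | 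
          (∀ x y, ∀ c d : ℝ, 0 ≤ c → 0 ≤ d → c + d = 1 → g (c • x + d • y) ≤ c * g x + d * g y) ∧
          (∀ x y, g x ≤ g y + L * ‖x - y‖) ∧ |g a| ≤ 1} := by
        ext g
        constructor
        · rintro ⟨g, ⟨h1, h2, h3⟩, rfl⟩
          exact ⟨fun x y c d hc hd hcd => h1.2 (Set.mem_univ x) (Set.mem_univ y) hc hd hcd, h2, h3⟩
        · rintro ⟨h1, h2, h3⟩
          exact ⟨⟨g, (hlip g h2).continuous⟩, ⟨⟨convex_univ, fun x _ y _ c d hc hd hcd =>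
            h1 x y c d hc hd hcd⟩, h2, h3⟩, rfl⟩
      rw [him]
      refine IsCompact.of_isClosed_subset
        (isCompact_univ_pi (s := fun x : Eucl n => Set.Icc (-(1 + L * ‖x - a‖)) (1 + L * ‖x - a‖))
          fun x => isCompact_Icc) ?_ ?_
      · simp only [Set.ofPred_and, Set.ofPred_forall]
        refine IsClosed.inter ?_ (IsClosed.inter ?_ ?_)
        · refine isClosed_iInter fun x => isClosed_iInter fun y => isClosed_iInter fun c =>
            isClosed_iInter fun d => isClosed_iInter fun _ => isClosed_iInter fun _ =>
            isClosed_iInter fun _ => isClosed_le (by fun_prop) (by fun_prop)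
        · refine isClosed_iInter fun x => isClosed_iInter fun y =>
            isClosed_le (by fun_prop) (by fun_prop)
        · exact isClosed_le (by fun_prop) (by fun_prop)
      · rintro g ⟨-, h2, h3⟩ x -
        have h4 := h2 x a
        have h5 := h2 a x
        rw [norm_sub_rev] at h5
        have h6 := abs_le.1 h3
        exact ⟨by linarith, by linarith⟩
    · refine (LipschitzWith.uniformEquicontinuous _ ⟨L, hL⟩ fun g => ?_).equicontinuous
      exact hlip _ g.2.2.1
  have : {g : ConvFn n | (∀ x y, g.1 x ≤ g.1 y + L * ‖x - y‖) ∧ |g.1 a| ≤ 1}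
      = (Subtype.val : ConvFn n → C(Eucl n, ℝ)) ⁻¹' S := by
    ext g
    simp only [hS, Set.mem_ofPred_eq, Set.mem_preimage]
    exact ⟨fun h => ⟨g.2, h⟩, fun h => h.2⟩
  rw [this]
  refine Topology.IsInducing.subtypeVal.isCompact_preimage' hSc ?_
  rintro g hg
  exact ⟨⟨g, hg.1⟩, rfl⟩

/-- Bounded continuous functions vanishing outside `A`. -/
def auxX {n : ℕ} (A : Set (Eucl n)) : Submodule ℂ (BoundedContinuousFunction (Eucl n) ℂ) where
  carrier := {φ | ∀ x, x ∉ A → φ x = 0}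
  add_mem' := by
    intro f g hf hg x hx
    simp [hf x hx, hg x hx]
  zero_mem' := fun _ _ => rfl
  smul_mem' := by
    intro c f hf x hx
    simp [hf x hx]

lemma auxX_closed {n : ℕ} (A : Set (Eucl n)) :
    IsClosed (auxX A : Set (BoundedContinuousFunction (Eucl n) ℂ)) := by
  change IsClosed {φ : BoundedContinuousFunction (Eucl n) ℂ | ∀ x, x ∉ A → φ x = 0}
  simp only [Set.ofPred_forall]
  refine isClosed_iInter fun x => isClosed_iInter fun _ => isClosed_eq ?_ continuous_const
  fun_prop

lemma auxX_tsupp {n : ℕ} (A : Set (Eucl n)) (hA : IsCompact A) (φ : auxX A) :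
    tsupport ⇑φ.1 ⊆ A :=
  closure_minimal (fun x hx => by
    by_contra h
    exact hx (φ.2 x h)) hA.isClosed

def auxTo {n : ℕ} (A : Set (Eucl n)) (hA : IsCompact A) : auxX A →ₗ[ℂ] C_c(Eucl n, ℂ) where
  toFun φ := ⟨φ.1.toContinuousMap, hA.of_isClosed_subset (isClosed_tsupport _)
    (auxX_tsupp A hA φ)⟩
  map_add' _ _ := rfl
  map_smul' _ _ := rfl

lemma aux_bdd_s7 {n d : ℕ} (A : Set (Eucl n)) (hA : IsCompact A)
    (hconv : Convex ℝ A) (hne : A.Nonempty) (Ψ : ConvFn n → RadonMeasure n) (hΨ : MemPdLV d Ψ)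
    (δ : ℝ) (hδ : 0 < δ) : BddAbove (seminormSet A δ Ψ) := by
  obtain ⟨a, ha⟩ := hne
  set F := {g : ConvFn n | (∀ x y, g.1 x ≤ g.1 y + 4 / δ * ‖x - y‖) ∧ |g.1 a| ≤ 1} with hF
  have hFc : IsCompact F := aux_compact_s7 a _ (by positivity)
  have : CompleteSpace (auxX A) := (auxX_closed A).completeSpace_coe
  have hb : ∀ g : ConvFn n, ∃ C : ℝ, ∀ φ : auxX A,
      ‖((Ψ g).1 ∘ₗ auxTo A hA) φ‖ ≤ C * ‖φ‖ := by
    intro g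
    obtain ⟨C, hC⟩ := (Ψ g).2 A hA
    refine ⟨C / 1, LinearMap.bound_of_ball_bound' one_pos C _ fun φ hφ => ?_⟩
    refine hC _ (auxX_tsupp A hA φ) fun x => ?_
    rw [mem_closedBall_zero_iff] at hφ
    exact (φ.1.norm_coe_le_norm x).trans hφ
  let T : F → (auxX A →L[ℂ] ℂ) := fun g =>
    LinearMap.mkContinuousOfExistsBound ((Ψ g.1).1 ∘ₗ auxTo A hA) (hb g.1)
  obtain ⟨C, hC⟩ := banach_steinhaus (g := T) (fun φ => by
    obtain ⟨C, hC⟩ := hFc.exists_bound_of_continuousOn (hΨ.2.1 (auxTo A hA φ)).continuousOn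
    exact ⟨C, fun g => hC g.1 g.2⟩)
  refine ⟨C, ?_⟩
  rintro _ ⟨φ, f, hφ, hφ1, hf, rfl⟩
  obtain ⟨g, hg1, hg2, hg3⟩ := aux_ext_s7 A ⟨a, ha⟩ hconv δ hδ f hf
  rw [aux_eq A (δ / 2) (by positivity) Ψ hΨ.1 f g hg1 φ hφ]
  let φb : BoundedContinuousFunction (Eucl n) ℂ :=
    BoundedContinuousFunction.ofNormedAddCommGroup φ φ.continuous 1 hφ1
  let φX : auxX A := ⟨φb, fun x hx => image_eq_zero_of_notMem_tsupport fun h => hx (hφ h)⟩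
  have hn : ‖φX‖ ≤ 1 :=
    BoundedContinuousFunction.norm_ofNormedAddCommGroup_le _ zero_le_one hφ1
  have hT : (Ψ g).1 φ = T ⟨g, hg2, hg3 a ha⟩ φX := rfl
  rw [hT]
  exact ((T _).le_of_opNorm_le (hC _) φX).trans
    (mul_le_of_le_one_right ((norm_nonneg _).trans (hC ⟨g, hg2, hg3 a ha⟩)) hn)

/-- For compact convex `A ⊆ ℝⁿ` with nonempty interior: the seminorms
`‖Ψ‖_{A,δ}` are finite on `P_dLV(ℝⁿ)`, and for `0 < s < t` and `Ψ` homogeneous of degree `k`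
one has `‖Ψ‖_{A,t} ≤ ‖Ψ‖_{A,s} ≤ ((2/s)(2t + diam A) + 1)^k ‖Ψ‖_{A,t}`. -/
theorem seminorm_comparison {n d : ℕ} (A : Set (Eucl n)) (hA : IsCompact A)
    (hconv : Convex ℝ A) (hint : (interior A).Nonempty) :
    (∀ Ψ : ConvFn n → RadonMeasure n, MemPdLV d Ψ → ∀ δ : ℝ, 0 < δ →
      BddAbove (seminormSet A δ Ψ)) ∧
    (∀ (Ψ : ConvFn n → RadonMeasure n) (k : ℕ), MemPdLV d Ψ → IsHomogeneousDeg k Ψ →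
      ∀ s t : ℝ, 0 < s → s < t →
        seminormAδ A t Ψ ≤ seminormAδ A s Ψ ∧
        seminormAδ A s Ψ ≤ ((2 / s) * (2 * t + Metric.diam A) + 1) ^ k * seminormAδ A t Ψ) := by
  have hne : A.Nonempty := hint.mono interior_subset
  refine ⟨fun Ψ hΨ δ hδ => aux_bdd_s7 A hA hconv hne Ψ hΨ δ hδ, ?_⟩
  intro Ψ k hΨ hk s t hs hst
  have ht : 0 < t := hs.trans hst
  have hnon : ∀ δ, (seminormSet A δ Ψ).Nonempty := fun δ =>
    ⟨_, 0, ⟨0, convexOn_const 0 convex_univ⟩, by simp [tsupport], by simp, by simp, rfl⟩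
  refine ⟨csSup_le_csSup (aux_bdd_s7 A hA hconv hne Ψ hΨ s hs) (hnon t) ?_, ?_⟩
  · rintro _ ⟨φ, f, h1, h2, h3, rfl⟩
    exact ⟨φ, f, h1, h2, fun x hx => h3 x (Set.add_subset_add_left
      (Metric.closedBall_subset_closedBall hst.le) hx), rfl⟩
  refine csSup_le (hnon s) ?_
  rintro _ ⟨φ, f, h1, h2, h3, rfl⟩
  obtain ⟨g, hg1, hg2, hg3⟩ := aux_ext_s7 A hne hconv s hs f h3
  rw [aux_eq A (s / 2) (by positivity) Ψ hΨ.1 f g hg1 φ h1]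
  set C := (2 / s) * (2 * t + Metric.diam A) + 1 with hC
  have hC1 : 4 / s * t + 1 ≤ C := by
    have h : 0 ≤ 2 / s * Metric.diam A := mul_nonneg (by positivity) Metric.diam_nonneg
    have h' : C = 4 / s * t + 2 / s * Metric.diam A + 1 := by rw [hC]; ring
    linarith
  have hCpos : 0 < C := by
    have : 0 < 4 / s * t := by positivity
    linarith
  let c : ℝ≥0 := ⟨C, hCpos.le⟩
  have hgc : g = smulConv c (smulConv c⁻¹ g) := by
    apply Subtype.ext
    ext x
    change g.1 x = C * (C⁻¹ * g.1 x)
    field_simp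
  have hmem : ‖(Ψ (smulConv c⁻¹ g)).1 φ‖ ∈ seminormSet A t Ψ := by
    refine ⟨φ, _, h1, h2, fun x hx => ?_, rfl⟩
    change |C⁻¹ * g.1 x| ≤ 1
    rw [abs_mul, abs_of_pos (inv_pos.2 hCpos), inv_mul_le_iff₀ hCpos, mul_one]
    obtain ⟨a, ha, b, hb, rfl⟩ := Set.mem_add.1 hx
    rw [mem_closedBall_zero_iff] at hb
    have e1 := hg2 (a + b) a
    have e2 := hg2 a (a + b)
    have e3 := abs_le.1 (hg3 a ha)
    have e4 : 4 / s * ‖b‖ ≤ 4 / s * t := by gcongr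
    simp only [add_sub_cancel_left, sub_add_cancel_left, norm_neg] at e1 e2
    rw [abs_le]
    constructor <;> linarith
  have hle := le_csSup (aux_bdd_s7 A hA hconv hne Ψ hΨ t ht) hmem
  rw [hgc, hk]
  change ‖((C : ℝ) : ℂ) ^ k * (Ψ (smulConv c⁻¹ g)).1 φ‖ ≤ _
  rw [norm_mul, norm_pow, Complex.norm_real, Real.norm_of_nonneg hCpos.le]
  exact mul_le_mul_of_nonneg_left hle (by positivity)

end
end

section
/- Let (Ψ_α) be a net in C(X,M(Y)) that is Cauchy with respect to every seminorm ‖·‖_{A;K} (A ⊂ Y compact, K ⊂ X compact), i.e. for all such A, K and every ε > 0 there is an index α₀ with ‖Ψ_α − Ψ_β‖_{A;K} ≤ ε for all α, β ≥ α₀. Then there exists Ψ ∈ C(X,M(Y)) such that ‖Ψ_α − Ψ‖_{A;K} → 0 for all compact A ⊂ Y and all compact K ⊂ X. In other words, C(X,M(Y)) is complete with respect to the compact-to-bounded topology. -/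
open scoped CompactlySupported

noncomputable section

variable (Y : Type*) [TopologicalSpace Y]

/-- The space `M(Y)` of complex Radon measures on `Y`, identified with the topological dual
of `C_c(Y, ℂ)`: linear functionals bounded on the subspace `C_A(Y)` of functions supported
in any fixed compact set `A ⊆ Y`. -/
def RadonM : Submodule ℂ (C_c(Y, ℂ) →ₗ[ℂ] ℂ) where
  carrier := {μ | ∀ A : Set Y, IsCompact A → ∃ C : ℝ, ∀ φ : C_c(Y, ℂ),
      tsupport ⇑φ ⊆ A → (∀ x, ‖φ x‖ ≤ 1) → ‖μ φ‖ ≤ C}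
  add_mem' := by
    intro μ ν hμ hν A hA
    obtain ⟨C₁, h₁⟩ := hμ A hA
    obtain ⟨C₂, h₂⟩ := hν A hA
    refine ⟨C₁ + C₂, fun φ h h' => ?_⟩
    calc ‖(μ + ν) φ‖ = ‖μ φ + ν φ‖ := by simp
    _ ≤ ‖μ φ‖ + ‖ν φ‖ := norm_add_le _ _
    _ ≤ C₁ + C₂ := add_le_add (h₁ φ h h') (h₂ φ h h')
  zero_mem' := fun _ _ => ⟨0, fun φ _ _ => by simp⟩
  smul_mem' := by
    intro c μ hμ A hA
    obtain ⟨C, h⟩ := hμ A hA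
    refine ⟨‖c‖ * C, fun φ hs hb => ?_⟩
    simp only [LinearMap.smul_apply, norm_smul]
    exact mul_le_mul_of_nonneg_left (h φ hs hb) (norm_nonneg c)

variable {Y}
variable {X : Type*} [MetricSpace X]

/-- A map `Ψ : X → M(Y)` is weak*-continuous if `x ↦ Ψ(x)(φ)` is continuous for every
test function `φ ∈ C_c(Y, ℂ)`. -/
def WeakStarContinuous (Ψ : X → RadonM Y) : Prop :=
  ∀ φ : C_c(Y, ℂ), Continuous fun x => (Ψ x).1 φ

variable [LocallyCompactSpace Y] [SecondCountableTopology Y] [T2Space Y]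

/-- **completeness.** Every net in `C(X, M(Y))` that is Cauchy for the
seminorms `‖·‖_{A;K}` of the compact-to-bounded topology converges in these seminorms to a
weak*-continuous map `X → M(Y)`. -/
theorem complete_compact_to_bounded
    {ι : Type*} (l : Filter ι) [l.NeBot] (Ψnet : ι → X → RadonM Y)
    (hcont : ∀ α, WeakStarContinuous (Ψnet α))
    (hcauchy : ∀ (A : Set Y), IsCompact A → ∀ (K : Set X), IsCompact K →
      ∀ ε : ℝ, 0 < ε → ∃ S ∈ l, ∀ α ∈ S, ∀ β ∈ S, ∀ x ∈ K, ∀ φ : C_c(Y, ℂ),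
        tsupport ⇑φ ⊆ A → (∀ y, ‖φ y‖ ≤ 1) →
        ‖(Ψnet α x).1 φ - (Ψnet β x).1 φ‖ ≤ ε) :
    ∃ Ψ : X → RadonM Y, WeakStarContinuous Ψ ∧
      ∀ (A : Set Y), IsCompact A → ∀ (K : Set X), IsCompact K → ∀ ε : ℝ, 0 < ε →
        ∀ᶠ α in l, ∀ x ∈ K, ∀ φ : C_c(Y, ℂ),
          tsupport ⇑φ ⊆ A → (∀ y, ‖φ y‖ ≤ 1) →
          ‖(Ψnet α x).1 φ - (Ψ x).1 φ‖ ≤ ε := by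
  have key : ∀ (φ : C_c(Y, ℂ)) (K : Set X), IsCompact K → ∀ ε : ℝ, 0 < ε →
      ∃ S ∈ l, ∀ α ∈ S, ∀ β ∈ S, ∀ x ∈ K, ‖(Ψnet α x).1 φ - (Ψnet β x).1 φ‖ ≤ ε := by
    intro φ K hK ε hε
    obtain ⟨M, hM⟩ : ∃ M : ℝ, ∀ y, ‖φ y‖ ≤ M :=
      φ.hasCompactSupport.exists_bound_of_continuous φ.continuous
    obtain ⟨N, hN0, hN⟩ : ∃ N : ℝ, 0 < N ∧ ∀ y, ‖φ y‖ ≤ N :=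
      ⟨max M 1, by positivity, fun y => (hM y).trans (le_max_left _ _)⟩
    obtain ⟨S, hS, h⟩ := hcauchy (tsupport φ) φ.hasCompactSupport K hK (ε / N) (by positivity)
    refine ⟨S, hS, fun α hα β hβ x hx => ?_⟩
    have h1 := h α hα β hβ x hx (((N : ℂ)⁻¹) • φ) ?_ ?_
    · rw [map_smul, map_smul, ← smul_sub, norm_smul, norm_inv, Complex.norm_real,
        Real.norm_of_nonneg hN0.le, inv_mul_eq_div] at h1
      exact (div_le_div_iff_of_pos_right hN0).1 h1
    · refine closure_mono fun y hy => ?_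
      simp only [Function.mem_support, CompactlySupportedContinuousMap.coe_smul, Pi.smul_apply] at hy ⊢
      intro h0
      exact hy (by rw [h0, smul_zero])
    · intro y
      rw [CompactlySupportedContinuousMap.smul_apply, norm_smul, norm_inv, Complex.norm_real,
        Real.norm_of_nonneg hN0.le, inv_mul_eq_div, div_le_one hN0]
      exact hN y
  have hlim : ∀ x (φ : C_c(Y, ℂ)), ∃ z : ℂ,
      Filter.Tendsto (fun α => (Ψnet α x).1 φ) l (nhds z) := by
    intro x φ
    apply cauchy_map_iff_exists_tendsto.1
    rw [Metric.cauchy_iff]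
    refine ⟨inferInstance, fun ε hε => ?_⟩
    obtain ⟨S, hS, h⟩ := key φ {x} isCompact_singleton (ε / 2) (by positivity)
    refine ⟨_, Filter.image_mem_map hS, ?_⟩
    rintro _ ⟨α, hα, rfl⟩ _ ⟨β, hβ, rfl⟩
    rw [dist_eq_norm]
    have := h α hα β hβ x rfl
    linarith
  choose L hL using hlim
  let Λ : X → (C_c(Y, ℂ) →ₗ[ℂ] ℂ) := fun x =>
    { toFun := L x
      map_add' := fun φ ψ => tendsto_nhds_unique (hL x (φ + ψ)) (by
        simpa only [map_add] using (hL x φ).add (hL x ψ))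
      map_smul' := fun c φ => tendsto_nhds_unique (hL x (c • φ)) (by
        simpa only [map_smul, RingHom.id_apply] using (hL x φ).const_smul c) }
  have hΛ : ∀ x φ, Λ x φ = L x φ := fun _ _ => rfl
  have hmem : ∀ x, Λ x ∈ RadonM Y := by
    intro x A hA
    obtain ⟨S, hS, h⟩ := hcauchy A hA {x} isCompact_singleton 1 one_pos
    obtain ⟨α, hα⟩ := Filter.nonempty_of_mem hS
    obtain ⟨C, hC⟩ := (Ψnet α x).2 A hA
    refine ⟨1 + C, fun φ h1 h2 => ?_⟩
    rw [hΛ]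
    refine le_of_tendsto (hL x φ).norm ?_
    filter_upwards [hS] with β hβ
    have a := h β hβ α hα x rfl φ h1 h2
    have b := hC φ h1 h2
    have c := norm_sub_norm_le ((Ψnet β x).1 φ) ((Ψnet α x).1 φ)
    linarith
  refine ⟨fun x => ⟨Λ x, hmem x⟩, ?_, ?_⟩
  · intro φ
    change Continuous fun x => L x φ
    apply SeqContinuous.continuous
    intro u x hu
    have hK := hu.isCompact_insert_range
    have hunif : TendstoUniformlyOn (fun α x => (Ψnet α x).1 φ) (fun x => L x φ) l
        (insert x (Set.range u)) := by
      rw [Metric.tendstoUniformlyOn_iff]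
      intro ε hε
      obtain ⟨S, hS, h⟩ := key φ _ hK (ε / 2) (by positivity)
      filter_upwards [hS] with α hα y hy
      rw [dist_eq_norm, norm_sub_rev]
      refine lt_of_le_of_lt (b := ε / 2) ?_ (by linarith)
      refine le_of_tendsto ((tendsto_const_nhds (x := (Ψnet α y).1 φ)).sub (hL y φ)).norm ?_
      filter_upwards [hS] with β hβ
      exact h α hα β hβ y hy
    have hc := hunif.continuousOn
      (Filter.Frequently.of_forall fun α => (hcont α φ).continuousOn)
    refine (hc x (Set.mem_insert _ _)).tendsto.comp ?_
    rw [tendsto_nhdsWithin_iff]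
    exact ⟨hu, Filter.Eventually.of_forall fun n => Set.mem_insert_of_mem _ ⟨n, rfl⟩⟩
  · intro A hA K hK ε hε
    obtain ⟨S, hS, h⟩ := hcauchy A hA K hK ε hε
    filter_upwards [hS] with α hα x hx φ h1 h2
    change ‖(Ψnet α x).1 φ - L x φ‖ ≤ ε
    refine le_of_tendsto ((tendsto_const_nhds (x := (Ψnet α x).1 φ)).sub (hL x φ)).norm ?_
    filter_upwards [hS] with β hβ
    exact h α hα β hβ x hx φ h1 h2

end
end

section
/- Let G be a topological group acting continuously on Y, let U ⊂ G be relatively compact, and let B ⊂ C_c(Y); write U·B := {g·φ : g ∈ U, φ ∈ B} where (g·φ)(y) = φ(g⁻¹·y). (1) If there is a compact set A ⊂ Y with supp φ ⊂ A for all φ ∈ B and sup_{φ∈B} ‖φ‖_∞ < ∞, then there is a compact set A' ⊂ Y with supp ψ ⊂ A' for all ψ ∈ U·B and sup_{ψ∈U·B} ‖ψ‖_∞ < ∞. (2) If moreover B is relatively compact in the Banach space C_A(Y) with the supremum norm, then U·B is relatively compact in C_{A'}(Y). -/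
noncomputable section

theorem aux_net {Y : Type*} [TopologicalSpace Y] {G : Type*} [Group G] [TopologicalSpace G]
    [IsTopologicalGroup G] [MulAction G Y] [ContinuousSMul G Y]
    (K : Set G) (hK : IsCompact K) (φ : Y → ℂ) (hφ : Continuous φ) (A : Set Y) (hA : IsCompact A)
    (hs : tsupport φ ⊆ A) (ε : ℝ) (hε : 0 < ε) :
    ∃ t : Finset G, ∀ g ∈ K, ∃ h ∈ t, ∀ y, ‖φ (g⁻¹ • y) - φ (h⁻¹ • y)‖ ≤ ε := by
  set A' : Set Y := (fun p : G × Y => p.1 • p.2) '' (K ×ˢ A) with hA'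
  have hA'c : IsCompact A' := (hK.prod hA).image continuous_smul
  have hz : ∀ g ∈ K, ∀ y, y ∉ A' → φ (g⁻¹ • y) = 0 := by
    intro g hg y hy
    by_contra hne
    exact hy ⟨(g, g⁻¹ • y), ⟨hg, hs (subset_tsupport _ hne)⟩, by simp⟩
  haveI : CompactSpace A' := isCompact_iff_compactSpace.mp hA'c
  let f : C(G × A', ℂ) := ⟨fun p => φ (p.1⁻¹ • (p.2 : Y)), by fun_prop⟩
  have hc : Continuous (f.curry) := f.curry.continuous
  obtain ⟨t, htK, ht⟩ := hK.elim_nhds_subcover (fun g => f.curry ⁻¹' Metric.ball (f.curry g) ε)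
    (fun g _ => hc.continuousAt.preimage_mem_nhds (Metric.ball_mem_nhds _ hε))
  refine ⟨t, fun g hg => ?_⟩
  obtain ⟨h, hht, hgh⟩ := Set.mem_iUnion₂.mp (ht hg)
  refine ⟨h, hht, fun y => ?_⟩
  by_cases hy : y ∈ A'
  · have h1 := ContinuousMap.dist_apply_le_dist (f := f.curry g) (g := f.curry h) ⟨y, hy⟩
    have h2 : dist (f.curry g) (f.curry h) < ε := hgh
    rw [← dist_eq_norm]
    exact h1.trans h2.le
  · rw [hz g hg y hy, hz h (htK h hht) y hy]
    simpa using hε.le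

variable {Y : Type*} [TopologicalSpace Y] [LocallyCompactSpace Y]
  [SecondCountableTopology Y] [T2Space Y]
variable {G : Type*} [Group G] [TopologicalSpace G] [IsTopologicalGroup G]
  [MulAction G Y] [ContinuousSMul G Y]

/-- Let `U ⊆ G` be relatively compact and let `B` be a set of compactly
supported continuous functions on `Y`, uniformly supported in a compact set `A` and uniformly
bounded. Then `U·B = {y ↦ φ(g⁻¹·y) : g ∈ U, φ ∈ B}` is uniformly supported in a compact set
and uniformly bounded; moreover, if `B` is relatively compact in `C_A(Y)` (i.e. totally
bounded in the sup norm), then so is `U·B`. -/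
theorem smul_set_bounded_and_relatively_compact
    (U : Set G) (hU : IsCompact (closure U))
    (B : Set (Y → ℂ)) (hBcont : ∀ φ ∈ B, Continuous φ)
    (A : Set Y) (hA : IsCompact A) (hsupp : ∀ φ ∈ B, tsupport φ ⊆ A)
    (hbd : ∃ C : ℝ, ∀ φ ∈ B, ∀ y, ‖φ y‖ ≤ C) :
    (∃ A' : Set Y, IsCompact A' ∧
      (∀ ψ ∈ {ψ : Y → ℂ | ∃ g ∈ U, ∃ φ ∈ B, ψ = fun y => φ (g⁻¹ • y)}, tsupport ψ ⊆ A') ∧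
      ∃ C' : ℝ, ∀ ψ ∈ {ψ : Y → ℂ | ∃ g ∈ U, ∃ φ ∈ B, ψ = fun y => φ (g⁻¹ • y)},
        ∀ y, ‖ψ y‖ ≤ C') ∧
    ((∀ ε : ℝ, 0 < ε → ∃ F : Finset (Y → ℂ), ∀ φ ∈ B, ∃ ψ ∈ F, ∀ y, ‖φ y - ψ y‖ ≤ ε) →
      ∀ ε : ℝ, 0 < ε → ∃ F : Finset (Y → ℂ),
        ∀ ψ ∈ {ψ : Y → ℂ | ∃ g ∈ U, ∃ φ ∈ B, ψ = fun y => φ (g⁻¹ • y)},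
          ∃ χ ∈ F, ∀ y, ‖ψ y - χ y‖ ≤ ε) := by
  classical
  constructor
  · have hc : IsCompact ((fun p : G × Y => p.1 • p.2) '' (closure U ×ˢ A)) :=
      (hU.prod hA).image continuous_smul
    refine ⟨_, hc, ?_, ?_⟩
    · rintro ψ ⟨g, hg, φ, hφ, rfl⟩
      refine closure_minimal ?_ hc.isClosed
      intro y hy
      exact ⟨(g, g⁻¹ • y), ⟨subset_closure hg, hsupp φ hφ (subset_tsupport _ hy)⟩, by simp⟩
    · obtain ⟨C, hC⟩ := hbd
      refine ⟨C, ?_⟩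
      rintro ψ ⟨g, hg, φ, hφ, rfl⟩ y
      exact hC φ hφ _
  · intro hB ε hε
    obtain ⟨F, hF⟩ := hB (ε / 4) (by positivity)
    have key : ∀ χ : Y → ℂ, ∃ S : Finset (Y → ℂ), ∀ g ∈ U, ∀ φ ∈ B,
        (∀ y, ‖φ y - χ y‖ ≤ ε / 4) → ∃ ψ ∈ S, ∀ y, ‖φ (g⁻¹ • y) - ψ y‖ ≤ ε := by
      intro χ
      by_cases hχ : ∃ φ₀ ∈ B, ∀ y, ‖φ₀ y - χ y‖ ≤ ε / 4
      · obtain ⟨φ₀, hφ₀, h0⟩ := hχ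
        obtain ⟨t, ht⟩ := aux_net (closure U) hU φ₀ (hBcont _ hφ₀) A hA (hsupp _ hφ₀) (ε / 2)
          (by positivity)
        refine ⟨t.image (fun h y => φ₀ (h⁻¹ • y)), fun g hg φ hφ hφχ => ?_⟩
        obtain ⟨h, hht, hh⟩ := ht g (subset_closure hg)
        refine ⟨_, Finset.mem_image_of_mem _ hht, fun y => ?_⟩
        have h1 := hφχ (g⁻¹ • y)
        have h2 := h0 (g⁻¹ • y)
        have h3 := hh y
        rw [← dist_eq_norm] at h1 h2 h3 ⊢
        have h5 := dist_triangle_right (φ (g⁻¹ • y)) (φ₀ (g⁻¹ • y)) (χ (g⁻¹ • y))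
        have h6 := dist_triangle (φ (g⁻¹ • y)) (φ₀ (g⁻¹ • y)) (φ₀ (h⁻¹ • y))
        linarith
      · exact ⟨∅, fun g _ φ hφ h => (hχ ⟨φ, hφ, h⟩).elim⟩
    choose S hS using key
    refine ⟨F.biUnion S, ?_⟩
    rintro ψ ⟨g, hg, φ, hφ, rfl⟩
    obtain ⟨χ, hχ, hφχ⟩ := hF φ hφ
    obtain ⟨ψ, hψ, h⟩ := hS χ g hg φ hφ hφχ
    exact ⟨ψ, Finset.mem_biUnion.mpr ⟨χ, hχ, hψ⟩, h⟩

end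
end

section
/- Let G be a locally compact topological group acting continuously on X and on Y, and let Ψ ∈ C(X,M(Y)). Then the map G → C(X,M(Y)), g ↦ π(g)Ψ, is continuous when C(X,M(Y)) carries the compact-to-compact topology, i.e. the topology generated by the seminorms ‖Φ‖_{(C;K)} := sup{|Φ(x)(φ)| : x ∈ K, φ ∈ C} over all compact K ⊂ X and all subsets C ⊂ C_c(Y) that are contained and relatively compact in some C_A(Y) with A ⊂ Y compact. -/
open scoped CompactlySupported

noncomputable section

variable (Y : Type*) [TopologicalSpace Y]

variable {Y}
variable {X : Type*} [MetricSpace X]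

variable [T2Space Y]
variable {G : Type*} [Group G] [TopologicalSpace G] [IsTopologicalGroup G]
  [MulAction G Y] [ContinuousSMul G Y]

/-- The action of `G` on test functions: `(g·φ)(y) = φ(g⁻¹·y)`, as a linear map. -/
def smulCcL (g : G) : C_c(Y, ℂ) →ₗ[ℂ] C_c(Y, ℂ) where
  toFun φ :=
    ⟨⟨fun y => φ (g⁻¹ • y), φ.continuous.comp (continuous_const_smul _)⟩,
      φ.hasCompactSupport'.comp_homeomorph (Homeomorph.smul g⁻¹)⟩
  map_add' φ ψ := by ext y; rfl
  map_smul' c φ := by ext y; rfl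

lemma comp_smulCcL_mem (μ : RadonM Y) (g : G) :
    (μ : C_c(Y, ℂ) →ₗ[ℂ] ℂ).comp (smulCcL g) ∈ RadonM Y := by
  show ∀ A : Set Y, IsCompact A → ∃ C : ℝ, ∀ φ : C_c(Y, ℂ),
      tsupport ⇑φ ⊆ A → (∀ x, ‖φ x‖ ≤ 1) → ‖((μ : C_c(Y, ℂ) →ₗ[ℂ] ℂ).comp (smulCcL g)) φ‖ ≤ C
  intro A hA
  obtain ⟨C, hC⟩ := μ.2 ((fun y => g • y) '' A) (hA.image (continuous_const_smul g))
  refine ⟨C, fun φ hsupp hb => ?_⟩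
  refine hC _ ?_ (fun y => hb (g⁻¹ • y))
  have h1 : Function.support (fun y => φ (g⁻¹ • y)) ⊆ (fun y => g • y) '' A := by
    intro y hy
    have h2 : g⁻¹ • y ∈ tsupport ⇑φ := subset_tsupport _ hy
    exact ⟨g⁻¹ • y, hsupp h2, by simp⟩
  exact closure_minimal h1 (hA.image (continuous_const_smul g)).isClosed

variable [MulAction G X] [ContinuousSMul G X]

/-- The representation `π` of `G` on maps `Ψ : X → M(Y)`:
`[π(g)Ψ](x)(φ) = Ψ(g⁻¹·x)(g⁻¹·φ)`, where `(g·φ)(y) = φ(g⁻¹·y)`. -/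
def piAct (g : G) (Ψ : X → RadonM Y) : X → RadonM Y := fun x =>
  ⟨((Ψ (g⁻¹ • x)) : C_c(Y, ℂ) →ₗ[ℂ] ℂ).comp (smulCcL g⁻¹), comp_smulCcL_mem _ _⟩


variable [LocallyCompactSpace Y] [SecondCountableTopology Y] [LocallyCompactSpace G]

/-- Relative compactness in the Banach space `C_A(Y)`: total boundedness in the sup norm. -/
def SupNormTotallyBounded (C : Set C_c(Y, ℂ)) : Prop :=
  ∀ ε : ℝ, 0 < ε → ∃ F : Finset C_c(Y, ℂ), ∀ φ ∈ C, ∃ ψ ∈ F, ∀ y, ‖φ y - ψ y‖ ≤ ε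

lemma aux_unif_s14 {H Z : Type*} [TopologicalSpace H] [TopologicalSpace Z] (f : H → Z → ℂ)
    (hf : Continuous fun p : H × Z => f p.1 p.2) (g₀ : H) (K : Set Z) (hK : IsCompact K)
    (ε : ℝ) (hε : 0 < ε) : ∀ᶠ g in nhds g₀, ∀ z ∈ K, ‖f g z - f g₀ z‖ ≤ ε := by
  refine hK.eventually_forall_of_forall_eventually fun z _ => ?_
  have hc : Continuous fun p : H × Z => ‖f p.1 p.2 - f g₀ p.2‖ := by
    have h2 : Continuous fun p : H × Z => f g₀ p.2 :=
      hf.comp (continuous_const.prodMk continuous_snd)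
    exact (hf.sub h2).norm
  have h3 := hc.tendsto (g₀, z)
  simp only [sub_self, norm_zero] at h3
  exact (h3.eventually_lt_const hε).mono fun _ h => h.le

def auxE {W : Type*} [TopologicalSpace W] (B : Set W) :
    Submodule ℂ (BoundedContinuousFunction W ℂ) where
  carrier := {f | ∀ y, y ∉ B → f y = 0}
  add_mem' := by
    intro f g hf hg y hy
    simp [hf y hy, hg y hy]
  zero_mem' := fun y _ => by simp
  smul_mem' := by
    intro c f hf y hy
    simp [hf y hy]

lemma auxE_closed {W : Type*} [TopologicalSpace W] (B : Set W) :
    IsClosed (auxE B : Set (BoundedContinuousFunction W ℂ)) := by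
  have : (auxE B : Set (BoundedContinuousFunction W ℂ)) =
      ⋂ y, ⋂ (_ : y ∉ B), {f | f y = 0} := by
    ext f
    simp only [Set.mem_iInter]
    rfl
  rw [this]
  refine isClosed_iInter fun y => isClosed_iInter fun _ => ?_
  exact isClosed_eq (BoundedContinuousFunction.lipschitz_eval_const y).continuous continuous_const

lemma aux_tsupp {W : Type*} [TopologicalSpace W] [T2Space W] {B : Set W} (hB : IsCompact B)
    {f : W → ℂ} (hf : ∀ y, y ∉ B → f y = 0) : tsupport f ⊆ B := by
  refine closure_minimal (fun y hy => ?_) hB.isClosed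
  by_contra h
  exact hy (hf y h)

def auxL {W : Type*} [TopologicalSpace W] [T2Space W] {B : Set W} (hB : IsCompact B) :
    auxE B →ₗ[ℂ] C_c(W, ℂ) where
  toFun f := ⟨⟨fun y => f.1 y, f.1.continuous⟩,
    hB.of_isClosed_subset (isClosed_tsupport _) (aux_tsupp hB f.2)⟩
  map_add' f g := by ext y; rfl
  map_smul' c f := by ext y; rfl

lemma aux_bdd_s14 {W Z : Type*} [TopologicalSpace W] [T2Space W] [MetricSpace Z]
    (Ψ : Z → RadonM W) (hΨ : WeakStarContinuous Ψ) (K : Set Z) (hK : IsCompact K)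
    (B : Set W) (hB : IsCompact B) :
    ∃ M : ℝ, 0 ≤ M ∧ ∀ x ∈ K, ∀ φ : C_c(W, ℂ), (∀ y, y ∉ B → φ y = 0) →
      ∀ δ : ℝ, 0 ≤ δ → (∀ y, ‖φ y‖ ≤ δ) → ‖(Ψ x).1 φ‖ ≤ M * δ := by
  have : CompleteSpace (auxE B) := (auxE_closed B).completeSpace_coe
  have hb : ∀ x : Z, ∃ C : ℝ, ∀ f : auxE B, ‖((Ψ x).1.comp (auxL hB)) f‖ ≤ C * ‖f‖ := by
    intro x
    obtain ⟨C, hC⟩ := (Ψ x).2 B hB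
    refine ⟨C, fun f => ?_⟩
    by_cases h0 : ‖f‖ = 0
    · have : f = 0 := norm_eq_zero.1 h0
      subst this
      simp
    have hpos : 0 < ‖f‖ := lt_of_le_of_ne (norm_nonneg _) (Ne.symm h0)
    obtain ⟨r, hr⟩ : ∃ r : ℝ, r = ‖f‖ := ⟨_, rfl⟩
    rw [← hr] at h0 hpos ⊢
    have hn : ‖((r⁻¹ : ℝ) : ℂ)‖ = r⁻¹ := by
      rw [Complex.norm_real, Real.norm_of_nonneg (inv_nonneg.2 hpos.le)]
    have h1 := hC (((r⁻¹ : ℝ) : ℂ) • auxL hB f)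
      (aux_tsupp hB (fun y hy => by
        change ((r⁻¹ : ℝ) : ℂ) * f.1 y = 0
        rw [f.2 y hy, mul_zero])) (by
      intro y
      change ‖((r⁻¹ : ℝ) : ℂ) * f.1 y‖ ≤ 1
      rw [norm_mul, hn]
      have h5 : ‖f.1 y‖ ≤ r := (f.1.norm_coe_le_norm y).trans hr.ge
      rw [inv_mul_le_iff₀ hpos, mul_one]
      exact h5)
    rw [LinearMap.map_smul, norm_smul, hn, inv_mul_le_iff₀ hpos] at h1
    change ‖(Ψ x).1 (auxL hB f)‖ ≤ _
    rw [mul_comm]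
    exact h1
  choose C hC using hb
  let T : K → (auxE B →L[ℂ] ℂ) := fun x => ((Ψ x).1.comp (auxL hB)).mkContinuous (C x) (hC x)
  obtain ⟨M, hM⟩ := banach_steinhaus (g := T) (by
    intro f
    obtain ⟨c, hc⟩ := hK.exists_bound_of_continuousOn (hΨ (auxL hB f)).continuousOn
    exact ⟨c, fun i => hc i i.2⟩)
  refine ⟨max M 0, le_max_right _ _, fun x hx φ hφ δ hδ hb => ?_⟩
  let f : auxE B := ⟨BoundedContinuousFunction.ofNormedAddCommGroup φ φ.continuous δ hb, hφ⟩
  have hf : auxL hB f = φ := by ext y; rfl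
  have hfn : ‖f‖ ≤ δ := BoundedContinuousFunction.norm_ofNormedAddCommGroup_le _ hδ hb
  have h2 : ‖T ⟨x, hx⟩ f‖ ≤ max M 0 * δ :=
    ((T ⟨x, hx⟩).le_opNorm f).trans
      (mul_le_mul ((hM _).trans (le_max_left _ _)) hfn (norm_nonneg _) (le_max_right _ _))
  have h3 : T ⟨x, hx⟩ f = (Ψ x).1 (auxL hB f) := rfl
  rwa [h3, hf] at h2

lemma aux_net_s14 {W : Type*} [TopologicalSpace W] (C : Set C_c(W, ℂ))
    (hC : ∀ ε : ℝ, 0 < ε → ∃ F : Finset C_c(W, ℂ), ∀ φ ∈ C, ∃ ψ ∈ F, ∀ y, ‖φ y - ψ y‖ ≤ ε)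
    (δ : ℝ) (hδ : 0 < δ) :
    ∃ F : Set C_c(W, ℂ), F.Finite ∧ F ⊆ C ∧ ∀ φ ∈ C, ∃ ψ ∈ F, ∀ y, ‖φ y - ψ y‖ ≤ δ := by
  classical
  obtain ⟨F, hF⟩ := hC (δ / 2) (half_pos hδ)
  let P : C_c(W, ℂ) → C_c(W, ℂ) → Prop := fun ψ φ => φ ∈ C ∧ ∀ y, ‖φ y - ψ y‖ ≤ δ / 2
  let r : C_c(W, ℂ) → C_c(W, ℂ) := fun ψ => if h : ∃ φ, P ψ φ then h.choose else ψ
  refine ⟨(r '' (F : Set C_c(W, ℂ))) ∩ C, (F.finite_toSet.image r).inter_of_left _,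
    Set.inter_subset_right, fun φ hφ => ?_⟩
  obtain ⟨ψ, hψ, hd⟩ := hF φ hφ
  have h : ∃ φ, P ψ φ := ⟨φ, hφ, hd⟩
  have hr : P ψ (r ψ) := by
    simp only [r, dif_pos h]
    exact h.choose_spec
  refine ⟨r ψ, ⟨⟨ψ, hψ, rfl⟩, hr.1⟩, fun y => ?_⟩
  have h1 := hd y
  have h2 := hr.2 y
  have h3 : φ y - r ψ y = (φ y - ψ y) - (r ψ y - ψ y) := by ring
  rw [h3]
  exact (norm_sub_le _ _).trans (by linarith)

/-- For `Ψ ∈ C(X, M(Y))`, the orbit map `g ↦ π(g)Ψ` is continuous for the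
compact-to-compact topology: for every compact `K ⊆ X`, every set `C` of test functions
supported in a common compact set `A ⊆ Y` and relatively compact in `C_A(Y)`, and every
`ε > 0`, uniformly for `x ∈ K` and `φ ∈ C` the evaluations vary by at most `ε` on a
neighbourhood of any `g₀ ∈ G`. -/
theorem orbit_map_continuous_compact_to_compact
    (Ψ : X → RadonM Y) (hΨ : WeakStarContinuous Ψ) (g₀ : G)
    (K : Set X) (hK : IsCompact K) (A : Set Y) (hA : IsCompact A)
    (C : Set C_c(Y, ℂ)) (hCA : ∀ φ ∈ C, tsupport ⇑φ ⊆ A) (hC : SupNormTotallyBounded C) :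
    ∀ ε : ℝ, 0 < ε → ∃ V ∈ nhds g₀, ∀ g ∈ V, ∀ x ∈ K, ∀ φ ∈ C,
      ‖(piAct g Ψ x).1 φ - (piAct g₀ Ψ x).1 φ‖ ≤ ε := by
  intro ε hε
  obtain ⟨V₀, hV₀c, hV₀⟩ := exists_compact_mem_nhds g₀
  have hg₀ : g₀ ∈ V₀ := mem_of_mem_nhds hV₀
  set B : Set Y := (fun p : G × Y => p.1⁻¹ • p.2) '' (V₀ ×ˢ A) with hBdef
  have hB : IsCompact B := (hV₀c.prod hA).image (by fun_prop)
  set K' : Set X := (fun p : G × X => p.1⁻¹ • p.2) '' (V₀ ×ˢ K) with hKdef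
  have hK' : IsCompact K' := (hV₀c.prod hK).image (by fun_prop)
  have hKm : ∀ g ∈ V₀, ∀ x ∈ K, g⁻¹ • x ∈ K' := fun g hg x hx => ⟨(g, x), ⟨hg, hx⟩, rfl⟩
  obtain ⟨M, hM0, hM⟩ := aux_bdd_s14 Ψ hΨ K' hK' B hB
  have hS : ∀ (g : G) (φ : C_c(Y, ℂ)) (y : Y), smulCcL g⁻¹ φ y = φ (g • y) := by
    intro g φ y
    change φ (g⁻¹⁻¹ • y) = _
    rw [inv_inv]
  have hP : ∀ (g : G) (x : X) (φ : C_c(Y, ℂ)),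
      (piAct g Ψ x).1 φ = (Ψ (g⁻¹ • x)).1 (smulCcL g⁻¹ φ) := fun _ _ _ => rfl
  have hz : ∀ g ∈ V₀, ∀ φ ∈ C, ∀ y, y ∉ B → φ (g • y) = 0 := by
    intro g hg φ hφ y hy
    by_contra h
    exact hy ⟨(g, g • y), ⟨hg, hCA φ hφ (subset_tsupport _ h)⟩, by simp⟩
  set δ : ℝ := ε / (4 * (M + 1)) with hδdef
  have hδ : 0 < δ := by positivity
  have hMδ : M * δ ≤ ε / 4 := by
    have : (M + 1) * δ = ε / 4 := by rw [hδdef]; field_simp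
    nlinarith
  obtain ⟨F, hFfin, hFC, hF⟩ := aux_net_s14 C hC δ hδ
  have hev : ∀ ψ ∈ F, ∀ᶠ g in nhds g₀, ∀ x ∈ K,
      ‖(piAct g Ψ x).1 ψ - (piAct g₀ Ψ x).1 ψ‖ ≤ ε / 2 := by
    intro ψ hψ
    have e1 := aux_unif_s14 (fun (g : G) (y : Y) => ψ (g • y))
      (ψ.continuous.comp continuous_smul) g₀ B hB δ hδ
    have e2 := aux_unif_s14 (fun (g : G) (x : X) => (Ψ (g⁻¹ • x)).1 (smulCcL g₀⁻¹ ψ))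
      ((hΨ (smulCcL g₀⁻¹ ψ)).comp (by fun_prop : Continuous fun p : G × X => p.1⁻¹ • p.2))
      g₀ K hK (ε / 4) (by positivity)
    filter_upwards [e1, e2, hV₀] with g h1 h2 hg x hx
    have h3 := hM (g⁻¹ • x) (hKm g hg x hx) (smulCcL g⁻¹ ψ - smulCcL g₀⁻¹ ψ)
      (fun y hy => by
        rw [CompactlySupportedContinuousMap.sub_apply, hS, hS, hz g hg ψ (hFC hψ) y hy,
          hz g₀ hg₀ ψ (hFC hψ) y hy, sub_zero]) δ hδ.le (fun y => by
        rw [CompactlySupportedContinuousMap.sub_apply, hS, hS]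
        by_cases hy : y ∈ B
        · exact h1 y hy
        · rw [hz g hg ψ (hFC hψ) y hy, hz g₀ hg₀ ψ (hFC hψ) y hy]
          simpa using hδ.le)
    have h4 := h2 x hx
    rw [map_sub] at h3
    rw [hP, hP]
    refine (norm_sub_le_norm_sub_add_norm_sub _ ((Ψ (g⁻¹ • x)).1 (smulCcL g₀⁻¹ ψ)) _).trans ?_
    linarith
  refine ⟨_, Filter.inter_mem ((Filter.eventually_all_finite hFfin).2 hev) hV₀, ?_⟩
  rintro g ⟨hg1, hg⟩ x hx φ hφ
  obtain ⟨ψ, hψ, hd⟩ := hF φ hφ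
  have key : ∀ g ∈ V₀, ‖(piAct g Ψ x).1 φ - (piAct g Ψ x).1 ψ‖ ≤ ε / 4 := by
    intro g hg
    have h3 := hM (g⁻¹ • x) (hKm g hg x hx) (smulCcL g⁻¹ φ - smulCcL g⁻¹ ψ)
      (fun y hy => by
        rw [CompactlySupportedContinuousMap.sub_apply, hS, hS, hz g hg ψ (hFC hψ) y hy,
          hz g hg φ hφ y hy, sub_zero]) δ hδ.le (fun y => by
        rw [CompactlySupportedContinuousMap.sub_apply, hS, hS]
        exact hd _)
    rw [map_sub] at h3
    rw [hP, hP]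
    exact h3.trans hMδ
  have k1 := key g hg
  have k2 := key g₀ hg₀
  have k3 : ‖(piAct g Ψ x).1 ψ - (piAct g₀ Ψ x).1 ψ‖ ≤ ε / 2 := hg1 ψ hψ x hx
  rw [norm_sub_rev] at k2
  refine (norm_sub_le_norm_sub_add_norm_sub _ ((piAct g Ψ x).1 ψ) _).trans ?_
  have k4 := norm_sub_le_norm_sub_add_norm_sub ((piAct g Ψ x).1 ψ) ((piAct g₀ Ψ x).1 ψ)
    ((piAct g₀ Ψ x).1 φ)
  linarith

end
end

section
/- Let U ⊂ ℝⁿ be open, let V be a Hausdorff locally convex topological vector space, and let f : U → V be a map such that for every continuous linear functional λ on V the scalar function λ ∘ f : U → ℂ is continuously differentiable (i.e. f is weakly C¹). Then f is continuous (strongly continuous with respect to the topology of V). -/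
noncomputable section

universe u in
theorem exists_normed_of_seminorm {V : Type u} [AddCommGroup V] [Module ℂ V] (p : Seminorm ℂ V) :
    ∃ (W : Type u) (_ : NormedAddCommGroup W) (_ : NormedSpace ℂ W) (L : V →ₗ[ℂ] W),
      ∀ v, ‖L v‖ = p v := by
  letI := AddGroupSeminorm.toSeminormedAddCommGroup p.toAddGroupSeminorm
  letI : NormedSpace ℂ V := { norm_smul_le := fun a b => (map_smul_eq_mul p a b).le }
  refine ⟨SeparationQuotient V, inferInstance, inferInstance,
    (SeparationQuotient.mkCLM ℂ V).toLinearMap, fun v => ?_⟩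
  exact SeparationQuotient.norm_mk v

theorem normed_case {E W : Type*} [NormedAddCommGroup E] [NormedSpace ℝ E]
    [NormedAddCommGroup W] [NormedSpace ℂ W] (g : E → W) (x₀ : E)
    (h : ∀ φ : StrongDual ℂ W, DifferentiableAt ℝ (fun x => φ (g x)) x₀) :
    ContinuousAt g x₀ := by
  refine Filter.tendsto_of_seq_tendsto fun x hx => ?_
  obtain ⟨C, hC⟩ := banach_steinhaus
    (g := fun k => NormedSpace.inclusionInDoubleDualLi ℂ (E := W)
      (((‖x k - x₀‖⁻¹ : ℝ) : ℂ) • (g (x k) - g x₀))) (fun φ => by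
      have h1 := (h φ).isBigO_sub.comp_tendsto hx
      obtain ⟨c, hc⟩ := h1.bound
      have h2 : Filter.IsBoundedUnder (· ≤ ·) Filter.atTop
          (fun k => ‖φ (((‖x k - x₀‖⁻¹ : ℝ) : ℂ) • (g (x k) - g x₀))‖) := by
        refine ⟨|c|, ?_⟩
        rw [Filter.eventually_map]
        filter_upwards [hc] with k hk
        simp only [Function.comp] at hk
        rw [map_smul, norm_smul, map_sub, Complex.norm_real, norm_inv, norm_norm]
        rcases eq_or_lt_of_le (norm_nonneg (x k - x₀)) with h0 | h0
        · rw [← h0]; simp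
        · rw [inv_mul_le_iff₀ h0, mul_comm]
          exact hk.trans (by gcongr; exact le_abs_self c)
      obtain ⟨B, hB⟩ := h2.bddAbove_range
      exact ⟨B, fun k => hB ⟨k, rfl⟩⟩)
  have h3 : ∀ k, ‖g (x k) - g x₀‖ ≤ C * ‖x k - x₀‖ := by
    intro k
    have := hC k
    rw [LinearIsometry.norm_map, norm_smul, Complex.norm_real, norm_inv, norm_norm] at this
    rcases eq_or_lt_of_le (norm_nonneg (x k - x₀)) with h0 | h0
    · have : x k = x₀ := by rw [← sub_eq_zero, ← norm_eq_zero, h0]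
      simp [this]
    · rwa [inv_mul_le_iff₀ h0, mul_comm] at this
  rw [tendsto_iff_norm_sub_tendsto_zero]
  refine squeeze_zero (fun _ => norm_nonneg _) h3 ?_
  have := (tendsto_iff_norm_sub_tendsto_zero.1 hx).const_mul C
  simpa using this

/-- Let `U ⊆ ℝⁿ` be open and `V` a Hausdorff locally convex topological
vector space. If `f : U → V` is weakly `C¹`, i.e. `λ ∘ f` is continuously differentiable on
`U` for every continuous linear functional `λ` on `V`, then `f` is (strongly) continuous
on `U`. -/
theorem weaklyC1_implies_continuous {n : ℕ}
    (V : Type*) [AddCommGroup V] [Module ℂ V] [Module ℝ V] [IsScalarTower ℝ ℂ V]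
    [TopologicalSpace V] [IsTopologicalAddGroup V] [ContinuousSMul ℂ V] [ContinuousSMul ℝ V]
    [LocallyConvexSpace ℝ V] [T2Space V]
    (U : Set (EuclideanSpace ℝ (Fin n))) (hU : IsOpen U)
    (f : EuclideanSpace ℝ (Fin n) → V)
    (hf : ∀ lam : V →L[ℂ] ℂ, ContDiffOn ℝ 1 (fun x => lam (f x)) U) :
    ContinuousOn f U := by
  intro x₀ hx₀
  apply ContinuousAt.continuousWithinAt
  haveI : PolynormableSpace ℂ V := by
    open ComplexOrder in
    haveI : LocallyConvexSpace ℂ V := by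
      refine LocallyConvexSpace.ofBases ℂ V _ _ (fun x =>
        (LocallyConvexSpace.convex_basis (𝕜 := ℝ) x)) (fun x s hs => ?_)
      exact convex_of_nonneg_surjective_algebraMap _
        (fun z hz => (by
          obtain ⟨x, h1, h2⟩ := (RCLike.nonneg_iff_exists_ofReal (K := ℂ) (z := z)).mp hz
          exact ⟨x, h1, h2⟩)) hs.2
    infer_instance
  refine ((PolynormableSpace.withSeminorms ℂ V).tendsto_nhds f (f x₀)).2 fun p ε hε => ?_
  obtain ⟨W, _, _, L, hL⟩ := exists_normed_of_seminorm p.1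
  have hLc : Continuous L := by
    refine continuous_of_continuousAt_zero L ?_
    rw [ContinuousAt, map_zero, tendsto_zero_iff_norm_tendsto_zero]
    simp only [hL]
    simpa using p.2.tendsto 0
  have := normed_case (fun x => L (f x)) x₀ fun φ =>
    ((hf (φ.comp ⟨L, hLc⟩)).contDiffAt (hU.mem_nhds hx₀)).differentiableAt (by simp)
  rw [ContinuousAt, tendsto_iff_norm_sub_tendsto_zero] at this
  filter_upwards [this.eventually_lt_const hε] with x hx
  rwa [← map_sub, hL] at hx

end
end

section
/- Let d ≥ 0 and 0 ≤ k ≤ n. If n ≥ 3, or n = 2 and k ≠ 1, then the dimension of the space of SO(n)-invariant elements of V_{d,k} equals: 2 if d ≥ 2 is even and 1 ≤ k ≤ n−1; 1 if d ≥ 2 is even and k ∈ {0, n}; 1 if d = 0; and 0 if d is odd. For n = 2 and k = 1, this dimension equals 3 if d ≥ 2 is even, 1 if d = 0, and 0 if d is odd. -/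
noncomputable section

open Matrix

/-- The space `Sym²(ℝⁿ)` of real symmetric `n × n` matrices. -/
abbrev SymMatrix (n : ℕ) := {A : Matrix (Fin n) (Fin n) ℝ // A.IsSymm}

/-- `V_{d,k}`: the span of the polynomial functions `(v, A) ↦ Q(v) · (k-minor of A)` on
`ℝⁿ × Sym²(ℝⁿ)` with `Q` homogeneous of degree `d`; i.e. the complex polynomials in `(v, A)`
that are homogeneous of degree `d` in `v` and lie in `M(n,k)` (the span of the `k`-minors)
in `A` for every fixed `v`. -/
def Vdk (n d k : ℕ) : Submodule ℂ ((Fin n → ℝ) → SymMatrix n → ℂ) :=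
  Submodule.span ℂ
    {P | ∃ (Q : MvPolynomial (Fin n) ℂ) (σ τ : Fin k ↪ Fin n),
      Q.IsHomogeneous d ∧
      P = fun (v : Fin n → ℝ) (A : SymMatrix n) =>
        MvPolynomial.eval (fun i => (v i : ℂ)) Q * (((A.1.submatrix σ τ).det : ℝ) : ℂ)}

lemma conj_isSymm {n : ℕ} (g : Matrix (Fin n) (Fin n) ℝ) (A : SymMatrix n) :
    (g * A.1 * gᵀ).IsSymm := by
  show _ = _
  rw [Matrix.transpose_mul, Matrix.transpose_mul, Matrix.transpose_transpose, A.2,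
    Matrix.mul_assoc]

/-- The subspace of `SO(n)`-invariant functions: `P(gv, gAgᵀ) = P(v, A)` for all
`g ∈ SO(n)`. -/
def SOInvariant (n : ℕ) : Submodule ℂ ((Fin n → ℝ) → SymMatrix n → ℂ) where
  carrier := {P | ∀ g : Matrix (Fin n) (Fin n) ℝ,
    g ∈ Matrix.orthogonalGroup (Fin n) ℝ → g.det = 1 →
    ∀ (v : Fin n → ℝ) (A : SymMatrix n),
      P (g.mulVec v) ⟨g * A.1 * gᵀ, conj_isSymm g A⟩ = P v A}
  add_mem' := by
    intro P Q hP hQ g hg hdet v A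
    simp only [Pi.add_apply]
    rw [hP g hg hdet v A, hQ g hg hdet v A]
  zero_mem' := by intro g hg hdet v A; simp
  smul_mem' := by
    intro c P hP g hg hdet v A
    simp only [Pi.smul_apply]
    rw [hP g hg hdet v A]

def Mk (n k : ℕ) : Submodule ℂ (SymMatrix n → ℂ) :=
  Submodule.span ℂ {f | ∃ σ τ : Fin k ↪ Fin n,
    f = fun A : SymMatrix n => (((A.1.submatrix σ τ).det : ℝ) : ℂ)}

def cj {n : ℕ} (g : Matrix (Fin n) (Fin n) ℝ) (A : SymMatrix n) : SymMatrix n :=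
  ⟨g * A.1 * gᵀ, conj_isSymm g A⟩

def dS {n : ℕ} (D : Fin n → ℝ) : SymMatrix n := ⟨diagonal D, isSymm_diagonal D⟩

def ind {n : ℕ} (I : Finset (Fin n)) : Fin n → ℝ := fun i => if i ∈ I then 1 else 0

def IsO {n : ℕ} (g : Matrix (Fin n) (Fin n) ℝ) : Prop := g * gᵀ = 1

lemma IsO.mem {n : ℕ} {g : Matrix (Fin n) (Fin n) ℝ} (h : IsO g) :
    g ∈ Matrix.orthogonalGroup (Fin n) ℝ := by
  rw [Matrix.mem_orthogonalGroup_iff]; exact h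

lemma IsO.of_mem {n : ℕ} {g : Matrix (Fin n) (Fin n) ℝ}
    (h : g ∈ Matrix.orthogonalGroup (Fin n) ℝ) : IsO g := by
  rw [Matrix.mem_orthogonalGroup_iff] at h; exact h

lemma IsO.left {n : ℕ} {g : Matrix (Fin n) (Fin n) ℝ} (h : IsO g) : gᵀ * g = 1 :=
  mul_eq_one_comm.mp h

lemma IsO.mul {n : ℕ} {g h : Matrix (Fin n) (Fin n) ℝ} (hg : IsO g) (hh : IsO h) :
    IsO (g * h) := by
  unfold IsO at *
  rw [transpose_mul, Matrix.mul_assoc, ← Matrix.mul_assoc h, hh, Matrix.one_mul, hg]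

lemma IsO.det {n : ℕ} {g : Matrix (Fin n) (Fin n) ℝ} (h : IsO g) : g.det = 1 ∨ g.det = -1 := by
  have := congrArg Matrix.det h
  rw [det_mul, det_transpose, det_one] at this
  exact mul_self_eq_one_iff.mp this

lemma cj_mul {n : ℕ} (g h : Matrix (Fin n) (Fin n) ℝ) (A : SymMatrix n) :
    cj (g * h) A = cj g (cj h A) := by
  apply Subtype.ext
  simp [cj, transpose_mul, Matrix.mul_assoc]

lemma Vdk_mk {n d k : ℕ} {P : (Fin n → ℝ) → SymMatrix n → ℂ} (hP : P ∈ Vdk n d k)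
    (v : Fin n → ℝ) : P v ∈ Mk n k := by
  unfold Vdk at hP
  induction hP using Submodule.span_induction with
  | mem P h =>
    obtain ⟨Q, σ, τ, -, rfl⟩ := h
    exact (Mk n k).smul_mem (MvPolynomial.eval (fun i => (v i : ℂ)) Q)
      (Submodule.subset_span ⟨σ, τ, rfl⟩)
  | zero => exact (Mk n k).zero_mem
  | add P Q _ _ h1 h2 => exact (Mk n k).add_mem h1 h2
  | smul c P _ h => exact (Mk n k).smul_mem c h

lemma Vdk_hom {n d k : ℕ} {P : (Fin n → ℝ) → SymMatrix n → ℂ} (hP : P ∈ Vdk n d k)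
    (t : ℝ) (v : Fin n → ℝ) (A : SymMatrix n) : P (t • v) A = (t : ℂ) ^ d * P v A := by
  unfold Vdk at hP
  induction hP using Submodule.span_induction with
  | mem P h =>
    obtain ⟨Q, σ, τ, hQ, rfl⟩ := h
    have h2 : MvPolynomial.eval (fun i => (((t • v) i : ℝ) : ℂ)) Q
      = (t : ℂ) ^ d * MvPolynomial.eval (fun i => (v i : ℂ)) Q := by
      rw [MvPolynomial.eval_eq, MvPolynomial.eval_eq, Finset.mul_sum]
      refine Finset.sum_congr rfl fun m hm => ?_
      have hd := hQ (MvPolynomial.mem_support_iff.mp hm)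
      rw [Finsupp.weight_apply, Finsupp.sum] at hd
      simp only [Pi.smul_apply, smul_eq_mul, Complex.ofReal_mul, mul_pow, Finset.prod_mul_distrib,
        Finset.prod_pow_eq_pow_sum]
      simp only [Pi.one_apply, smul_eq_mul, mul_one] at hd
      rw [hd]; ring
    simp only [h2]; ring
  | zero => simp
  | add P Q _ _ h1 h2 => simp only [Pi.add_apply, h1, h2]; ring
  | smul c P _ h => simp only [Pi.smul_apply, h, smul_eq_mul]; ring

lemma det_diag {n k : ℕ} (D : Fin n → ℝ) (σ τ : Fin k → Fin n) :
    ((diagonal D).submatrix σ τ).det =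
      (∏ a, D (σ a)) * ((1 : Matrix (Fin n) (Fin n) ℝ).submatrix σ τ).det := by
  have : (diagonal D).submatrix σ τ =
      diagonal (D ∘ σ) * ((1 : Matrix (Fin n) (Fin n) ℝ).submatrix σ τ) := by
    ext i j
    simp [diagonal_mul, diagonal_apply, one_apply]
  rw [this, det_mul, det_diagonal]; rfl

lemma prod_ind {n k : ℕ} (σ : Fin k ↪ Fin n) (I : Finset (Fin n)) (hI : I.card = k) :
    (∏ a, ind I (σ a)) = if I = Finset.univ.map σ then 1 else 0 := by
  split_ifs with h
  · subst h; simp [ind]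
  · have : ∃ a, σ a ∉ I := by
      by_contra hc
      push Not at hc
      apply h
      symm
      apply Finset.eq_of_subset_of_card_le
      · intro x hx
        simp at hx
        obtain ⟨a, rfl⟩ := hx
        exact hc a
      · simp [hI]
    obtain ⟨a, ha⟩ := this
    exact Finset.prod_eq_zero (Finset.mem_univ a) (by simp [ind, ha])

lemma diag_exp {n k : ℕ} {f : SymMatrix n → ℂ} (hf : f ∈ Mk n k) (D : Fin n → ℝ) :
    f (dS D) = ∑ I ∈ Finset.powersetCard k Finset.univ,
      f (dS (ind I)) * ((∏ i ∈ I, D i : ℝ) : ℂ) := by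
  unfold Mk at hf
  induction hf using Submodule.span_induction with
  | mem f h =>
    obtain ⟨σ, τ, rfl⟩ := h
    simp only [dS, det_diag]
    rw [Finset.sum_eq_single (Finset.univ.map σ)]
    · rw [prod_ind σ _ (by simp)]
      simp [mul_comm]
    · intro I hI hne
      rw [prod_ind σ _ (by simpa using hI), if_neg hne]; simp
    · intro h; exact absurd (by simp) h
  | zero => simp
  | add f g _ _ h1 h2 => simp only [Pi.add_apply, h1, h2, ← Finset.sum_add_distrib, add_mul]
  | smul c f _ h => simp only [Pi.smul_apply, h, smul_eq_mul, Finset.mul_sum, mul_assoc]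

def sg {n : ℕ} (ε : Fin n → ℤˣ) : Fin n → ℝ := fun i => ((ε i : ℤ) : ℝ)

lemma sg_mul {n : ℕ} (ε δ : Fin n → ℤˣ) (i) : sg (ε * δ) i = sg ε i * sg δ i := by
  simp [sg]

lemma sg_sq {n : ℕ} (ε : Fin n → ℤˣ) (i) : sg ε i * sg ε i = 1 := by
  rw [← sg_mul]
  have : (ε * ε) i = 1 := by simp [Int.units_mul_self]
  simp [sg, Int.units_mul_self]

lemma det_sg {n k : ℕ} (D : Fin n → ℝ) (A : SymMatrix n) (σ τ : Fin k → Fin n) :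
    ((cj (diagonal D) A).1.submatrix σ τ).det =
      (∏ a, D (σ a)) * (∏ a, D (τ a)) * (A.1.submatrix σ τ).det := by
  have : (cj (diagonal D) A).1.submatrix σ τ =
      diagonal (D ∘ σ) * (A.1.submatrix σ τ) * diagonal (D ∘ τ) := by
    ext i j
    simp [cj, diagonal_mul, mul_diagonal]
  rw [this, det_mul, det_mul, det_diagonal, det_diagonal]; simp; ring

def pm {n : ℕ} (I : Finset (Fin n)) (A : SymMatrix n) : ℝ :=
  (A.1.submatrix (fun i : I => (i : Fin n)) (fun i : I => (i : Fin n))).det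

lemma pm_map {n k : ℕ} (σ : Fin k ↪ Fin n) (A : SymMatrix n) :
    pm (Finset.univ.map σ) A = (A.1.submatrix σ σ).det := by
  let e : Fin k ≃ (Finset.univ.map σ : Finset (Fin n)) :=
    Equiv.ofBijective (fun a => ⟨σ a, by simp⟩) ⟨fun a b h => σ.injective (by simpa using h),
      fun ⟨x, hx⟩ => by simpa using hx⟩
  unfold pm
  rw [← det_submatrix_equiv_self e]
  rfl

lemma minor_same {n k : ℕ} (σ τ : Fin k ↪ Fin n) (h : Finset.univ.map σ = Finset.univ.map τ)
    (A : SymMatrix n) :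
    (A.1.submatrix σ τ).det =
      ((1 : Matrix (Fin n) (Fin n) ℝ).submatrix σ τ).det * (A.1.submatrix σ σ).det := by
  have hx : ∀ a, ∃ b, σ b = τ a := by
    intro a
    have : τ a ∈ Finset.univ.map σ := by rw [h]; simp
    simpa using this
  choose p hp using hx
  have hpi : Function.Injective p := fun a b hab => τ.injective (by rw [← hp, ← hp, hab])
  let e : Equiv.Perm (Fin k) := Equiv.ofBijective p (Finite.injective_iff_bijective.mp hpi)
  have key : ∀ B : Matrix (Fin n) (Fin n) ℝ,
      (B.submatrix σ τ).det = (Equiv.Perm.sign e : ℤ) * (B.submatrix σ σ).det := by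
    intro B
    rw [← det_permute']
    congr 1
    ext i j
    simp [e, hp]
  rw [key A.1, key 1]
  rw [submatrix_one σ σ.injective]
  simp

lemma minor_one_diff {n k : ℕ} (σ τ : Fin k ↪ Fin n) (h : Finset.univ.map σ ≠ Finset.univ.map τ) :
    ∃ a, ∀ b, σ a ≠ τ b := by
  by_contra hc
  push Not at hc
  apply h
  apply Finset.eq_of_subset_of_card_le
  · intro x hx
    simp at hx
    obtain ⟨a, rfl⟩ := hx
    obtain ⟨b, hb⟩ := hc a
    simp [hb]
  · simp

lemma sign_avg {n k : ℕ} {f : SymMatrix n → ℂ} (hf : f ∈ Mk n k) (A : SymMatrix n) :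
    ∑ ε : Fin n → ℤˣ, f (cj (diagonal (sg ε)) A) =
      (Fintype.card (Fin n → ℤˣ) : ℂ) * ∑ I ∈ Finset.powersetCard k Finset.univ,
        f (dS (ind I)) * ((pm I A : ℝ) : ℂ) := by
  unfold Mk at hf
  induction hf using Submodule.span_induction with
  | mem f h =>
    obtain ⟨σ, τ, rfl⟩ := h
    have hR : ∑ I ∈ Finset.powersetCard k Finset.univ,
        ((((dS (ind I)).1.submatrix σ τ).det : ℝ) : ℂ) * ((pm I A : ℝ) : ℂ) =
        (((((1 : Matrix (Fin n) (Fin n) ℝ).submatrix σ τ).det * (A.1.submatrix σ σ).det : ℝ)) : ℂ) := by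
      simp only [dS, det_diag]
      rw [Finset.sum_eq_single (Finset.univ.map σ)]
      · rw [prod_ind σ _ (by simp), pm_map]
        simp
      · intro I hI hne
        rw [prod_ind σ _ (by simpa using hI), if_neg hne]; simp
      · intro h; exact absurd (by simp) h
    simp only
    rw [hR]
    by_cases h : Finset.univ.map σ = Finset.univ.map τ
    · rw [← minor_same σ τ h]
      have : ∀ ε : Fin n → ℤˣ, ((cj (diagonal (sg ε)) A).1.submatrix σ τ).det =
          (A.1.submatrix σ τ).det := by
        intro ε
        rw [det_sg]
        have h1 : ∏ a, sg ε (σ a) = ∏ a, sg ε (τ a) := by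
          rw [← Finset.prod_map Finset.univ σ (sg ε), h, Finset.prod_map]
        rw [h1, ← Finset.prod_mul_distrib]
        simp [sg_sq]
      simp [this]
    · obtain ⟨a, ha⟩ := minor_one_diff σ τ h
      have hz : ((1 : Matrix (Fin n) (Fin n) ℝ).submatrix σ τ).det = 0 :=
        det_eq_zero_of_row_eq_zero a (fun b => by simp [one_apply, ha b])
      rw [hz]
      simp only [det_sg]
      have : ∑ ε : Fin n → ℤˣ, ((∏ a, sg ε (σ a)) * ∏ a, sg ε (τ a)) = 0 := by
        set S := ∑ ε : Fin n → ℤˣ, ((∏ a, sg ε (σ a)) * ∏ a, sg ε (τ a)) with hS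
        have h2 : S = -S := by
          conv_lhs => rw [hS, ← Equiv.sum_comp (Equiv.mulLeft (Pi.mulSingle (σ a) (-1) : Fin n → ℤˣ))]
          rw [hS, ← Finset.sum_neg_distrib]
          refine Finset.sum_congr rfl fun ε _ => ?_
          simp only [Equiv.coe_mulLeft, sg_mul, Finset.prod_mul_distrib]
          have e1 : ∏ x, sg (Pi.mulSingle (σ a) (-1) : Fin n → ℤˣ) (σ x) = -1 := by
            rw [Finset.prod_eq_single a]
            · simp [sg]
            · intro b _ hb; simp [sg, Pi.mulSingle_apply, hb]
            · simp
          have e2 : ∏ x, sg (Pi.mulSingle (σ a) (-1) : Fin n → ℤˣ) (τ x) = 1 := by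
            apply Finset.prod_eq_one
            intro b _
            simp [sg, Pi.mulSingle_apply, (ha b).symm]
          rw [e1, e2]; ring
        linarith
      have h3 := congrArg (fun x : ℝ => ((x * (A.1.submatrix σ τ).det : ℝ) : ℂ)) this
      rw [Finset.sum_mul] at h3
      push_cast at h3 ⊢
      simpa using h3
  | zero => simp
  | add f g _ _ h1 h2 =>
    simp only [Pi.add_apply, Finset.sum_add_distrib, h1, h2, add_mul]; ring
  | smul c f _ h =>
    simp only [Pi.smul_apply, smul_eq_mul, ← Finset.mul_sum, h, mul_assoc]; ring

def HH {n : ℕ} (u : Fin n → ℝ) : Matrix (Fin n) (Fin n) ℝ :=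
  1 - (2 / (u ⬝ᵥ u)) • vecMulVec u u

lemma dot_pos {n : ℕ} {u : Fin n → ℝ} (hu : u ≠ 0) : u ⬝ᵥ u ≠ 0 := by
  simpa [dotProduct_self_eq_zero] using hu

lemma HH_mulVec {n : ℕ} (u x : Fin n → ℝ) :
    HH u *ᵥ x = x - (2 / (u ⬝ᵥ u) * (u ⬝ᵥ x)) • u := by
  unfold HH
  rw [sub_mulVec, one_mulVec, smul_mulVec, vecMulVec_mulVec]
  ext i
  simp; ring

lemma HH_symm {n : ℕ} (u : Fin n → ℝ) : (HH u)ᵀ = HH u := by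
  ext i j
  simp [HH, vecMulVec_apply, one_apply, mul_comm, eq_comm]

lemma HH_O {n : ℕ} {u : Fin n → ℝ} (hu : u ≠ 0) : IsO (HH u) := by
  unfold IsO
  rw [HH_symm]
  apply Matrix.ext_of_mulVec_single
  intro i
  rw [← mulVec_mulVec, HH_mulVec, HH_mulVec, one_mulVec]
  have := dot_pos hu
  ext j
  simp
  field_simp
  ring

lemma HH_det {n : ℕ} {u : Fin n → ℝ} (hu : u ≠ 0) : (HH u).det = -1 := by
  have := dot_pos hu
  have h : HH u = 1 + replicateCol Unit (-(2 / (u ⬝ᵥ u)) • u) * replicateRow Unit u := by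
    rw [← vecMulVec_eq]
    ext i j
    simp [HH, vecMulVec_apply]; ring
  rw [h, det_one_add_replicateCol_mul_replicateRow]
  simp
  field_simp
  norm_num

lemma HH_comm {n : ℕ} (u D : Fin n → ℝ) (c : ℝ) (h : ∀ a, u a ≠ 0 → D a = c) :
    HH u * diagonal D = diagonal D * HH u := by
  ext a b
  rw [mul_diagonal, diagonal_mul]
  by_cases hab : a = b
  · subst hab; ring
  · by_cases ha : u a = 0
    · simp [HH, vecMulVec_apply, hab, ha]
    · by_cases hb : u b = 0
      · simp [HH, vecMulVec_apply, hab, hb]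
      · rw [h a ha, h b hb]; ring

lemma cj_comm {n : ℕ} {s : Matrix (Fin n) (Fin n) ℝ} (hs : IsO s) (A : SymMatrix n)
    (h : s * A.1 = A.1 * s) : cj s A = A := by
  apply Subtype.ext
  unfold IsO at hs
  simp [cj, h, Matrix.mul_assoc, hs]

lemma diag_O {n : ℕ} (D : Fin n → ℝ) (h : ∀ i, D i * D i = 1) : IsO (diagonal D) := by
  unfold IsO
  rw [diagonal_transpose, diagonal_mul_diagonal]
  simp [h]

lemma cj_diag_dS {n : ℕ} (E D : Fin n → ℝ) (h : ∀ i, E i * E i = 1) :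
    cj (diagonal E) (dS D) = dS D := by
  apply cj_comm (diag_O E h)
  simp [dS, mul_comm]

def r0 (m : ℕ) : Fin (m + 1) → ℝ := fun i => if i = 0 then -1 else 1

lemma r0_sq (m : ℕ) (i) : r0 m i * r0 m i = 1 := by unfold r0; split_ifs <;> norm_num

lemma r0_det (m : ℕ) : (diagonal (r0 m)).det = -1 := by
  rw [det_diagonal]
  simp [r0]

lemma spec {m : ℕ} (A : SymMatrix (m + 1)) :
    ∃ g D, IsO g ∧ g.det = 1 ∧ A = cj g (dS D) := by
  have hA : A.1.IsHermitian := by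
    have := A.2
    unfold Matrix.IsHermitian
    rw [conjTranspose_eq_transpose_of_trivial]
    exact this
  have h1 := hA.spectral_theorem
  set U := hA.eigenvectorUnitary
  set D : Fin (m + 1) → ℝ := hA.eigenvalues
  have hU : IsO (U : Matrix (Fin (m + 1)) (Fin (m + 1)) ℝ) := IsO.of_mem U.2
  have h2 : A = cj (U : Matrix (Fin (m + 1)) (Fin (m + 1)) ℝ) (dS D) := by
    apply Subtype.ext
    rw [h1]
    simp [cj, dS, Unitary.conjStarAlgAut_apply, star_eq_conjTranspose]
  rcases hU.det with hd | hd
  · exact ⟨_, D, hU, hd, h2⟩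
  · refine ⟨U * diagonal (r0 m), D, hU.mul (diag_O _ (r0_sq m)), ?_, ?_⟩
    · rw [det_mul, hd, r0_det]; norm_num
    · rw [cj_mul, cj_diag_dS _ _ (r0_sq m), ← h2]

def pM {n : ℕ} (π : Equiv.Perm (Fin n)) : Matrix (Fin n) (Fin n) ℝ :=
  (1 : Matrix (Fin n) (Fin n) ℝ).submatrix π id

lemma pM_apply {n : ℕ} (π : Equiv.Perm (Fin n)) (i j) : pM π i j = if π i = j then 1 else 0 := by
  simp [pM, one_apply]

lemma pM_mulVec {n : ℕ} (π : Equiv.Perm (Fin n)) (v) : pM π *ᵥ v = v ∘ π := by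
  ext i
  simp [mulVec, dotProduct, pM_apply]

lemma pM_O {n : ℕ} (π : Equiv.Perm (Fin n)) : IsO (pM π) := by
  ext i j
  simp [mul_apply, pM_apply, one_apply, eq_comm]

lemma pM_det {n : ℕ} (π : Equiv.Perm (Fin n)) : (pM π).det = (Equiv.Perm.sign π : ℤ) := by
  unfold pM
  rw [det_permute]; simp

lemma pM_dS {n : ℕ} (π : Equiv.Perm (Fin n)) (D) : cj (pM π) (dS D) = dS (D ∘ π) := by
  apply Subtype.ext
  ext i j
  simp [cj, dS, mul_apply, pM_apply, diagonal_apply]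
  split_ifs with h
  · rw [h]
  · rfl

lemma SOinv {n : ℕ} {P : (Fin n → ℝ) → SymMatrix n → ℂ} (hP : P ∈ SOInvariant n)
    {g} (hg : IsO g) (hd : g.det = 1) (v A) : P (g *ᵥ v) (cj g A) = P v A :=
  hP g hg.mem hd v A

lemma exists_pair {m k : ℕ} (h : 3 ≤ m + 2 ∨ k ≠ 1) (I : Finset (Fin (m + 2))) (hI : I.card = k) :
    ∃ i j, i ≠ j ∧ (i ∈ I ↔ j ∈ I) := by
  classical
  rcases Nat.eq_zero_or_pos m with rfl | hm
  · have hk : k ≠ 1 := by omega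
    subst hI
    refine ⟨0, 1, by simp, ?_⟩
    revert I
    decide
  · obtain ⟨i, j, hij, he⟩ := Fintype.exists_ne_map_eq_of_card_lt
      (fun i : Fin (m + 2) => (decide (i ∈ I) : Bool)) (by simp; omega)
    exact ⟨i, j, hij, by simpa using he⟩

lemma exists_refl {m k : ℕ} (h : 3 ≤ m + 2 ∨ k ≠ 1) (I : Finset (Fin (m + 2))) (hI : I.card = k)
    (v : Fin (m + 2) → ℝ) :
    ∃ s, IsO s ∧ s.det = -1 ∧ s *ᵥ v = v ∧ cj s (dS (ind I)) = dS (ind I) := by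
  obtain ⟨i, j, hij, he⟩ := exists_pair h I hI
  have : ∃ u : Fin (m + 2) → ℝ, u ≠ 0 ∧ u ⬝ᵥ v = 0 ∧ ∀ a, u a ≠ 0 → a = i ∨ a = j := by
    by_cases hv : v j = 0
    · refine ⟨Pi.single j 1, by simp, by simp [hv], fun a ha => ?_⟩
      right
      by_contra hc
      simp [hc] at ha
    · refine ⟨Pi.single i (v j) - Pi.single j (v i), ?_, ?_, fun a ha => ?_⟩
      · intro h0
        have := congrFun h0 i
        simp [hij, hv] at this
      · simp [sub_dotProduct]; ring
      · by_contra hc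
        push Not at hc
        simp [hc.1, hc.2] at ha
  obtain ⟨u, hu, huv, hs⟩ := this
  refine ⟨HH u, HH_O hu, HH_det hu, ?_, ?_⟩
  · rw [HH_mulVec, huv]; simp
  · apply cj_comm (HH_O hu)
    apply HH_comm u _ (ind I i)
    intro a ha
    rcases hs a ha with rfl | rfl
    · rfl
    · simp [ind, he]

lemma fullO {m d k : ℕ} (h : 3 ≤ m + 2 ∨ k ≠ 1) {P : (Fin (m + 2) → ℝ) → SymMatrix (m + 2) → ℂ}
    (hV : P ∈ Vdk (m + 2) d k) (hS : P ∈ SOInvariant (m + 2)) {g} (hg : IsO g) (v A) :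
    P (g *ᵥ v) (cj g A) = P v A := by
  rcases hg.det with hd | hd
  · exact SOinv hS hg hd v A
  set r := diagonal (r0 (m + 1)) with hr
  have hrO : IsO r := diag_O _ (r0_sq _)
  have hrd : r.det = -1 := r0_det _
  have hrD : ∀ D, cj r (dS D) = dS D := fun D => cj_diag_dS _ _ (r0_sq _)
  have hrr : r * r = 1 := by
    have := hrO
    unfold IsO at this
    rwa [hr, diagonal_transpose] at this
  have ha : ∀ v D, P (r *ᵥ v) (dS D) = P v (dS D) := by
    intro v D
    rw [diag_exp (Vdk_mk hV _), diag_exp (Vdk_mk hV _)]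
    refine Finset.sum_congr rfl fun I hI => ?_
    congr 1
    obtain ⟨s, hs, hsd, hsv, hsI⟩ := exists_refl h I (by simpa using hI) v
    have := SOinv hS (hrO.mul hs) (by rw [det_mul, hrd, hsd]; norm_num) v (dS (ind I))
    rwa [cj_mul, hsI, hrD, ← mulVec_mulVec, hsv] at this
  obtain ⟨q, D, hq, hqd, rfl⟩ := spec A
  have e1 := SOinv hS ((hg.mul hq).mul hrO) (by rw [det_mul, det_mul, hrd, hd, hqd]; norm_num)
    (r *ᵥ (qᵀ *ᵥ v)) (dS D)
  rw [cj_mul, hrD, cj_mul, ha] at e1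
  have e2 := SOinv hS hq hqd (qᵀ *ᵥ v) (dS D)
  rw [mulVec_mulVec, hq, one_mulVec] at e2
  rw [e2, ← e1]
  congr 1
  rw [mulVec_mulVec _ r, mulVec_mulVec]
  have : g * q * r * (r * qᵀ) = g := by
    calc g * q * r * (r * qᵀ) = g * (q * (r * r) * qᵀ) := by simp only [Matrix.mul_assoc]
      _ = g := by rw [hrr, Matrix.mul_one, hq, Matrix.mul_one]
  rw [this]

lemma trans_SO {m : ℕ} (v : Fin (m + 2) → ℝ) :
    ∃ g : Matrix (Fin (m + 2)) (Fin (m + 2)) ℝ, ∃ t : ℝ, IsO g ∧ g.det = 1 ∧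
      g *ᵥ v = t • (Pi.single 0 1 : Fin (m + 2) → ℝ) ∧ (v ≠ 0 → t ≠ 0) := by
  set e : Fin (m + 2) → ℝ := Pi.single 0 1
  set t := Real.sqrt (v ⬝ᵥ v)
  have hnn : 0 ≤ v ⬝ᵥ v := by
    simp only [dotProduct]; exact Finset.sum_nonneg fun i _ => mul_self_nonneg _
  have ht : t * t = v ⬝ᵥ v := Real.mul_self_sqrt hnn
  have htz : v ≠ 0 → t ≠ 0 := by
    intro hv h0
    rw [h0] at ht
    exact dot_pos hv (by rw [← ht]; simp)
  by_cases hu : v - t • e = 0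
  · exact ⟨1, t, by simp [IsO], by simp, by rw [one_mulVec]; exact sub_eq_zero.mp hu, htz⟩
  · set w : Fin (m + 2) → ℝ := Pi.single 1 1
    have hw : w ≠ 0 := by simp [w]
    refine ⟨HH w * HH (v - t • e), t, (HH_O hw).mul (HH_O hu), ?_, ?_, htz⟩
    · rw [det_mul, HH_det hw, HH_det hu]; norm_num
    · have h1 : HH (v - t • e) *ᵥ v = t • e := by
        rw [HH_mulVec]
        have h3 : 2 * ((v - t • e) ⬝ᵥ v) = (v - t • e) ⬝ᵥ (v - t • e) := by
          have : e ⬝ᵥ e = 1 := by simp [e]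
          simp only [sub_dotProduct, dotProduct_sub, smul_dotProduct, dotProduct_smul, this,
            smul_eq_mul, dotProduct_comm v e]
          linarith
        have h4 := dot_pos hu
        have h5 : 2 / ((v - t • e) ⬝ᵥ (v - t • e)) * ((v - t • e) ⬝ᵥ v) = 1 := by
          rw [div_mul_eq_mul_div, h3, div_self h4]
        rw [h5]; simp
      rw [← mulVec_mulVec, h1, HH_mulVec]
      have : w ⬝ᵥ (t • e) = 0 := by simp [w, e]
      rw [this]; simp

lemma exists_perm {n : ℕ} (I J : Finset (Fin n)) (h : I.card = J.card) :
    ∃ π : Equiv.Perm (Fin n), ∀ x, x ∈ I ↔ π x ∈ J := by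
  classical
  have e : {x // x ∈ I} ≃ {x // x ∈ J} := Fintype.equivOfCardEq (by simpa using h)
  refine ⟨e.extendSubtype, fun x => ⟨fun hx => e.extendSubtype_mem x hx, fun hx => ?_⟩⟩
  by_contra hc
  exact e.extendSubtype_not_mem x hc hx

lemma exists_perm0 {m : ℕ} (I J : Finset (Fin (m + 1))) (h : I.card = J.card)
    (h0 : 0 ∈ I ↔ 0 ∈ J) :
    ∃ π : Equiv.Perm (Fin (m + 1)), π 0 = 0 ∧ ∀ x, x ∈ I ↔ π x ∈ J := by
  obtain ⟨π, hπ⟩ := exists_perm I J h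
  refine ⟨π.trans (Equiv.swap (π 0) 0), by simp, fun x => ?_⟩
  have h1 : π 0 ∈ J ↔ 0 ∈ J := by rw [← hπ, h0]
  rw [hπ]
  simp only [Equiv.trans_apply]
  by_cases ha : π x = π 0
  · rw [ha]; simp [h1]
  · by_cases hb : π x = 0
    · rw [hb]; simp [h1]
    · rw [Equiv.swap_apply_of_ne_of_ne ha hb]

lemma ind_perm {n : ℕ} {I J : Finset (Fin n)} {π : Equiv.Perm (Fin n)}
    (h : ∀ x, x ∈ I ↔ π x ∈ J) : ind J ∘ π = ind I := by
  ext x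
  simp [ind, h]

abbrev e0 (m : ℕ) : Fin (m + 2) → ℝ := Pi.single 0 1

lemma zero_of_e0 {m d k : ℕ} {P : (Fin (m + 2) → ℝ) → SymMatrix (m + 2) → ℂ}
    (hV : P ∈ Vdk (m + 2) d k) (hS : P ∈ SOInvariant (m + 2)) (h0 : ∀ A, P (e0 m) A = 0) :
    P = 0 := by
  funext v A
  obtain ⟨g, t, hg, hgd, hgv, -⟩ := trans_SO v
  rw [← SOinv hS hg hgd, hgv, Vdk_hom hV, h0]; simp

lemma zero_even {m d k : ℕ} (h : 3 ≤ m + 2 ∨ k ≠ 1) (hd : d ≠ 0) (he : Even d)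
    {P : (Fin (m + 2) → ℝ) → SymMatrix (m + 2) → ℂ}
    (hV : P ∈ Vdk (m + 2) d k) (hS : P ∈ SOInvariant (m + 2))
    (h0 : ∀ I : Finset (Fin (m + 2)), I.card = k → P (e0 m) (dS (ind I)) = 0) : P = 0 := by
  apply zero_of_e0 hV hS
  intro A
  have key : ∀ ε : Fin (m + 2) → ℤˣ, P (e0 m) (cj (diagonal (sg ε)) A) = P (e0 m) A := by
    intro ε
    have h1 := fullO h hV hS (diag_O (sg ε) (sg_sq ε)) (e0 m) A
    have h2 : diagonal (sg ε) *ᵥ e0 m = sg ε 0 • e0 m := by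
      ext i
      rw [mulVec_diagonal]
      by_cases hi : i = 0
      · subst hi; simp
      · simp [hi]
    rw [h2, Vdk_hom hV] at h1
    obtain ⟨c, rfl⟩ := he
    have h3 : ((sg ε 0 : ℝ) : ℂ) ^ (c + c) = 1 := by
      rw [← two_mul, pow_mul, sq, ← Complex.ofReal_mul, sg_sq]; simp
    rw [h3, one_mul] at h1
    exact h1
  have h4 := sign_avg (Vdk_mk hV (e0 m)) A
  rw [Finset.sum_eq_zero (s := Finset.powersetCard k Finset.univ)
    (fun I hI => by rw [h0 I (by simpa using hI), zero_mul])] at h4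
  simp only [key] at h4
  simpa using h4

lemma same_type {m d k : ℕ} (h : 3 ≤ m + 2 ∨ k ≠ 1)
    {P : (Fin (m + 2) → ℝ) → SymMatrix (m + 2) → ℂ}
    (hV : P ∈ Vdk (m + 2) d k) (hS : P ∈ SOInvariant (m + 2)) (I J : Finset (Fin (m + 2)))
    (hc : I.card = J.card) (h0 : 0 ∈ I ↔ 0 ∈ J) :
    P (e0 m) (dS (ind I)) = P (e0 m) (dS (ind J)) := by
  obtain ⟨π, hπ0, hπ⟩ := exists_perm0 I J hc h0
  have h1 := fullO h hV hS (pM_O π) (e0 m) (dS (ind J))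
  rw [pM_dS, ind_perm hπ, pM_mulVec] at h1
  rw [← h1]
  congr 1
  ext x
  by_cases hx : x = 0
  · subst hx; simp [hπ0]
  · have : π x ≠ 0 := by rw [← hπ0]; simpa using hx
    simp [hx, this]

lemma zero_d0 {m k : ℕ} {P : (Fin (m + 2) → ℝ) → SymMatrix (m + 2) → ℂ}
    (hV : P ∈ Vdk (m + 2) 0 k) (hS : P ∈ SOInvariant (m + 2)) (J : Finset (Fin (m + 2)))
    (hJ : J.card = k) (h0 : P (e0 m) (dS (ind J)) = 0) : P = 0 := by
  have hc : ∀ v w A, P v A = P w A := by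
    intro v w A
    have h1 := Vdk_hom hV 0 v A
    have h2 := Vdk_hom hV 0 w A
    simp at h1 h2
    rw [← h1, ← h2]
  have hI : ∀ I : Finset (Fin (m + 2)), I.card = k → ∀ v, P v (dS (ind I)) = 0 := by
    intro I hI v
    obtain ⟨π, hπ⟩ := exists_perm I J (by rw [hI, hJ])
    have hr := diag_O (r0 (m + 1)) (r0_sq _)
    rcases (pM_O π).det with hd | hd
    · have h1 := SOinv hS (pM_O π) hd (e0 m) (dS (ind J))
      rw [pM_dS, ind_perm hπ, h0] at h1
      rw [← h1]; exact hc _ _ _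
    · have h1 := SOinv hS (hr.mul (pM_O π)) (by rw [det_mul, hd, r0_det]; norm_num)
        (e0 m) (dS (ind J))
      rw [cj_mul, pM_dS, ind_perm hπ, cj_diag_dS _ _ (r0_sq _), h0] at h1
      rw [← h1]; exact hc _ _ _
  funext v A
  obtain ⟨g, D, hg, hgd, rfl⟩ := spec A
  rw [hc v (g *ᵥ v), SOinv hS hg hgd, diag_exp (Vdk_mk hV v)]
  exact Finset.sum_eq_zero fun I h => by rw [hI I (by simpa using h), zero_mul]

lemma zero_odd {m d k : ℕ} (hd : Odd d)
    {P : (Fin (m + 2) → ℝ) → SymMatrix (m + 2) → ℂ}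
    (hV : P ∈ Vdk (m + 2) d k) (hS : P ∈ SOInvariant (m + 2)) : P = 0 := by
  have hO : IsO (-1 : Matrix (Fin (m + 2)) (Fin (m + 2)) ℝ) := by simp [IsO]
  have key : ∀ v A, P ((-1 : Matrix (Fin (m + 2)) (Fin (m + 2)) ℝ) *ᵥ v) (cj (-1) A) = P v A := by
    intro v A
    rcases Nat.eq_zero_or_pos m with rfl | hm
    · apply SOinv hS hO
      rw [det_neg]; simp
    · exact fullO (by left; omega) hV hS hO v A
  funext v A
  have h1 := key v A
  have h2 : cj (-1) A = A := by apply Subtype.ext; simp [cj]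
  have h3 : (-1 : Matrix (Fin (m + 2)) (Fin (m + 2)) ℝ) *ᵥ v = (-1 : ℝ) • v := by
    rw [neg_mulVec]; simp
  rw [h2, h3, Vdk_hom hV] at h1
  have h4 : ((-1 : ℝ) : ℂ) ^ d = -1 := by push_cast; exact hd.neg_one_pow
  rw [h4] at h1
  have : (2 : ℂ) * P v A = 0 := by linear_combination -h1
  simpa using this

def Ph {n k : ℕ} (M : Fin k → Matrix (Fin n) (Fin n) ℝ) (A : Matrix (Fin n) (Fin n) ℝ) : ℝ :=
  ∑ σ : Fin k → Fin n, ∑ τ : Fin k → Fin n, (∏ i, M i (σ i) (τ i)) * (A.submatrix σ τ).det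

lemma det_exp {n k : ℕ} (N B : Matrix (Fin n) (Fin n) ℝ) (σ τ : Fin k → Fin n) :
    ((N * B).submatrix σ τ).det =
      ∑ ρ : Fin k → Fin n, (∏ i, N (σ i) (ρ i)) * (B.submatrix ρ τ).det := by
  have h1 : ((N * B).submatrix σ τ) = fun i => ∑ j, N (σ i) j • (fun b => B j (τ b)) := by
    ext i b
    simp [mul_apply]
  rw [h1]
  change (detRowAlternating (R := ℝ) (n := Fin k)).toMultilinearMap _ = _
  rw [MultilinearMap.map_sum]
  refine Finset.sum_congr rfl fun ρ _ => ?_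
  rw [MultilinearMap.map_smul_univ]
  rfl

lemma Ph_left {n k : ℕ} (M : Fin k → Matrix (Fin n) (Fin n) ℝ) (N B : Matrix (Fin n) (Fin n) ℝ) :
    Ph M (N * B) = Ph (fun i => Nᵀ * M i) B := by
  unfold Ph
  simp only [det_exp, mul_apply, transpose_apply, Finset.prod_univ_sum, Finset.mul_sum,
    Finset.sum_mul, Fintype.piFinset_univ]
  rw [Finset.sum_comm]
  conv_rhs => rw [Finset.sum_comm]
  refine Finset.sum_congr rfl fun τ _ => ?_
  rw [Finset.sum_comm]
  refine Finset.sum_congr rfl fun ρ _ => ?_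
  refine Finset.sum_congr rfl fun σ _ => ?_
  rw [Finset.prod_mul_distrib]; ring

lemma Ph_transpose {n k : ℕ} (M : Fin k → Matrix (Fin n) (Fin n) ℝ)
    (A : Matrix (Fin n) (Fin n) ℝ) : Ph M Aᵀ = Ph (fun i => (M i)ᵀ) A := by
  unfold Ph
  rw [Finset.sum_comm]
  refine Finset.sum_congr rfl fun τ _ => ?_
  refine Finset.sum_congr rfl fun ρ _ => ?_
  rw [← transpose_submatrix, det_transpose]; rfl

lemma Ph_right {n k : ℕ} (M : Fin k → Matrix (Fin n) (Fin n) ℝ) (N B : Matrix (Fin n) (Fin n) ℝ) :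
    Ph M (B * N) = Ph (fun i => M i * Nᵀ) B := by
  have : B * N = (Nᵀ * Bᵀ)ᵀ := by simp [transpose_mul]
  rw [this, Ph_transpose, Ph_left, Ph_transpose]
  simp [transpose_mul]

def Mv {n k : ℕ} (J : Matrix (Fin n) (Fin n) ℝ) (S : Finset (Fin k)) (v : Fin n → ℝ) (i : Fin k) :
    Matrix (Fin n) (Fin n) ℝ := if i ∈ S then vecMulVec v (J *ᵥ v) else 1

def PP {n k : ℕ} (J : Matrix (Fin n) (Fin n) ℝ) (S : Finset (Fin k)) (e : ℕ) (v : Fin n → ℝ)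
    (A : SymMatrix n) : ℂ := (((v ⬝ᵥ v) ^ e * Ph (Mv J S v) A.1 : ℝ) : ℂ)

lemma PP_inv {n k : ℕ} (J : Matrix (Fin n) (Fin n) ℝ) (S : Finset (Fin k)) (e : ℕ)
    (hJ : ∀ g : Matrix (Fin n) (Fin n) ℝ, IsO g → g.det = 1 → g * J = J * g) :
    PP J S e ∈ SOInvariant n := by
  intro g hg hd v A
  have hO := IsO.of_mem hg
  unfold PP
  congr 2
  · congr 1
    rw [dotProduct_mulVec, ← mulVec_transpose, mulVec_mulVec, hO.left, one_mulVec]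
  · simp only
    rw [Ph_right, Ph_left]
    congr 1
    funext i
    unfold Mv
    split_ifs
    · rw [transpose_transpose, mulVec_mulVec, ← hJ g hO hd, ← mulVec_mulVec, vecMulVec_mul,
        mul_vecMulVec, mulVec_mulVec, hO.left, one_mulVec, ← mulVec_transpose, mulVec_mulVec,
        hO.left, one_mulVec]
    · rw [transpose_transpose, Matrix.one_mul, hO.left]

lemma PP_mem {n k : ℕ} (J : Matrix (Fin n) (Fin n) ℝ) (S : Finset (Fin k)) (e : ℕ) :
    PP J S e ∈ Vdk n (2 * e + 2 * S.card) k := by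
  classical
  let Q (σ τ : Fin k → Fin n) : MvPolynomial (Fin n) ℂ :=
    (∑ i, MvPolynomial.X i * MvPolynomial.X i) ^ e *
      ∏ i, (if i ∈ S then MvPolynomial.X (σ i) * ∑ j, MvPolynomial.C ((J (τ i) j : ℝ) : ℂ) *
          MvPolynomial.X j
        else MvPolynomial.C (((1 : Matrix (Fin n) (Fin n) ℝ) (σ i) (τ i) : ℝ) : ℂ))
  have hQ : ∀ σ τ, (Q σ τ).IsHomogeneous (2 * e + 2 * S.card) := by
    intro σ τ
    apply MvPolynomial.IsHomogeneous.mul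
    · apply MvPolynomial.IsHomogeneous.pow
      apply MvPolynomial.IsHomogeneous.sum
      intro i _
      exact (MvPolynomial.isHomogeneous_X _ _).mul (MvPolynomial.isHomogeneous_X _ _)
    · have : 2 * S.card = ∑ i : Fin k, if i ∈ S then 2 else 0 := by
        simp [mul_comm]
      rw [this]
      apply MvPolynomial.IsHomogeneous.prod
      intro i _
      split_ifs
      · refine (MvPolynomial.isHomogeneous_X _ _).mul (n := 1) ?_
        apply MvPolynomial.IsHomogeneous.sum
        intro j _
        simpa using (MvPolynomial.isHomogeneous_C (Fin n) _).mul (MvPolynomial.isHomogeneous_X ℂ j)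
      · exact MvPolynomial.isHomogeneous_C _ _
  have hev : PP J S e = ∑ σ : Fin k → Fin n, ∑ τ : Fin k → Fin n,
      fun (v : Fin n → ℝ) (A : SymMatrix n) =>
        MvPolynomial.eval (fun i => (v i : ℂ)) (Q σ τ) * (((A.1.submatrix σ τ).det : ℝ) : ℂ) := by
    funext v A
    simp only [Finset.sum_apply, PP, Ph, Q]
    push_cast
    rw [Finset.mul_sum]
    refine Finset.sum_congr rfl fun σ _ => ?_
    rw [Finset.mul_sum]
    refine Finset.sum_congr rfl fun τ _ => ?_
    rw [← mul_assoc]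
    congr 1
    simp only [map_mul, map_pow, map_sum, map_prod, MvPolynomial.eval_X]
    congr 1
    · simp [dotProduct]
    · refine Finset.prod_congr rfl fun i _ => ?_
      unfold Mv
      split_ifs
      · simp [vecMulVec_apply, mulVec, dotProduct]
      · simp
  rw [hev]
  refine Submodule.sum_mem _ fun σ _ => Submodule.sum_mem _ fun τ _ => ?_
  by_cases hσ : Function.Injective σ
  · by_cases hτ : Function.Injective τ
    · exact Submodule.subset_span ⟨Q σ τ, ⟨σ, hσ⟩, ⟨τ, hτ⟩, hQ σ τ, rfl⟩
    · convert (Vdk n (2 * e + 2 * S.card) k).zero_mem using 1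
      funext v A
      rw [Function.not_injective_iff] at hτ
      obtain ⟨a, b, hab, hne⟩ := hτ
      rw [det_zero_of_column_eq hne (fun i => by simp [hab])]; simp
  · convert (Vdk n (2 * e + 2 * S.card) k).zero_mem using 1
    funext v A
    rw [Function.not_injective_iff] at hσ
    obtain ⟨a, b, hab, hne⟩ := hσ
    rw [det_zero_of_row_eq hne (by ext i; simp [hab])]; simp

lemma PP_e0 {m k : ℕ} (S : Finset (Fin k)) (e : ℕ) (I : Finset (Fin (m + 2))) :
    PP 1 S e (e0 m) (dS (ind I)) = ((∑ σ : Fin k → Fin (m + 2),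
      (if ∀ i ∈ S, σ i = 0 then 1 else 0) * ((diagonal (ind I)).submatrix σ σ).det : ℝ) : ℂ) := by
  unfold PP Ph
  congr 1
  have : e0 m ⬝ᵥ e0 m = 1 := by simp
  rw [this, one_pow, one_mul]
  refine Finset.sum_congr rfl fun σ _ => ?_
  rw [Finset.sum_eq_single σ]
  · simp only [dS]
    congr 1
    have h1 : ∀ i, Mv 1 S (e0 m) i (σ i) (σ i) = if i ∈ S → σ i = 0 then (1 : ℝ) else 0 := by
      intro i
      unfold Mv
      by_cases hi : i ∈ S
      · by_cases h0 : σ i = 0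
        · simp [hi, vecMulVec_apply, h0]
        · simp [hi, vecMulVec_apply, h0]
      · simp [hi]
    simp only [h1]
    rw [Finset.prod_ite_zero]
    simp
  · intro τ _ hne
    obtain ⟨i, hi⟩ := Function.ne_iff.mp hne
    rw [Finset.prod_eq_zero (Finset.mem_univ i), zero_mul]
    unfold Mv
    split_ifs
    · by_cases h0 : σ i = 0
      · have : τ i ≠ 0 := fun h => hi (by rw [h, h0])
        simp [vecMulVec_apply, this]
      · simp [vecMulVec_apply, h0]
    · simp [one_apply, Ne.symm hi]
  · simp

lemma PP_zero {m k : ℕ} (i : Fin k) (e : ℕ) (I : Finset (Fin (m + 2))) (hI : 0 ∉ I) :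
    PP 1 {i} e (e0 m) (dS (ind I)) = 0 := by
  rw [PP_e0, Finset.sum_eq_zero]
  · simp
  · intro σ _
    by_cases h : σ i = 0
    · rw [det_diag, Finset.prod_eq_zero (Finset.mem_univ i)]
      · simp
      · simp [ind, h, hI]
    · simp [h]

lemma PP_ne {m k : ℕ} (S : Finset (Fin k)) (e : ℕ) (I : Finset (Fin (m + 2)))
    (σ : Fin k ↪ Fin (m + 2)) (h1 : ∀ a, σ a ∈ I) (h2 : ∀ i ∈ S, σ i = 0) :
    PP 1 S e (e0 m) (dS (ind I)) ≠ 0 := by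
  rw [PP_e0]
  rw [Complex.ofReal_ne_zero]
  apply ne_of_gt
  apply Finset.sum_pos'
  · intro τ _
    apply mul_nonneg
    · split_ifs <;> norm_num
    · have : (diagonal (ind I)).PosSemidef := PosSemidef.diagonal (fun i => by
        simp only [ind, Pi.zero_apply]; split_ifs <;> norm_num)
      exact (this.submatrix τ).det_nonneg
  · refine ⟨σ, Finset.mem_univ _, ?_⟩
    rw [if_pos h2, det_diag, submatrix_one _ σ.injective]
    simp [ind, h1]

lemma finrank_eq {X Y : Type} (W : Submodule ℂ (X → Y → ℂ)) (r : ℕ) (x : Fin r → X)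
    (y : Fin r → Y) (inj : ∀ P ∈ W, (∀ i, P (x i) (y i) = 0) → P = 0)
    (surj : ∀ c : Fin r → ℂ, ∃ P ∈ W, ∀ i, P (x i) (y i) = c i) : Module.finrank ℂ W = r := by
  let ev : W →ₗ[ℂ] (Fin r → ℂ) :=
    { toFun := fun P i => P.1 (x i) (y i)
      map_add' := fun _ _ => rfl
      map_smul' := fun _ _ => rfl }
  have hb : Function.Bijective ev := by
    constructor
    · rw [injective_iff_map_eq_zero]
      intro P hP
      exact Subtype.ext (inj P.1 P.2 fun i => congrFun hP i)
    · intro c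
      obtain ⟨P, hP, h⟩ := surj c
      exact ⟨⟨P, hP⟩, funext h⟩
  rw [(LinearEquiv.ofBijective ev hb).finrank_eq]
  simp

lemma exists_emb {m k : ℕ} (I : Finset (Fin (m + 2))) (hI : I.card = k) :
    ∃ σ : Fin k ↪ Fin (m + 2), ∀ a, σ a ∈ I :=
  ⟨(I.orderEmbOfFin hI).toEmbedding, fun a => I.orderEmbOfFin_mem hI a⟩

lemma exists_emb0 {m k : ℕ} (I : Finset (Fin (m + 2))) (hI : I.card = k) (i : Fin k) (h0 : 0 ∈ I) :
    ∃ σ : Fin k ↪ Fin (m + 2), (∀ a, σ a ∈ I) ∧ σ i = 0 := by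
  obtain ⟨σ, hσ⟩ := exists_emb I hI
  have : Finset.univ.map σ = I := by
    apply Finset.eq_of_subset_of_card_le
    · intro x hx
      simp at hx
      obtain ⟨a, rfl⟩ := hx
      exact hσ a
    · simp [hI]
  rw [← this] at h0
  simp at h0
  obtain ⟨b, hb⟩ := h0
  exact ⟨(Equiv.swap i b).toEmbedding.trans σ, fun a => hσ _, by simp [hb]⟩

lemma PP1_mem {n k d : ℕ} (hd : Even d) : PP 1 (∅ : Finset (Fin k)) (d / 2) ∈
    Vdk n d k ⊓ SOInvariant n := by
  refine ⟨?_, PP_inv _ _ _ (by simp)⟩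
  have := PP_mem (n := n) 1 (∅ : Finset (Fin k)) (d / 2)
  have h2 : 2 * (d / 2) + 2 * (∅ : Finset (Fin k)).card = d := by
    obtain ⟨c, rfl⟩ := hd; simp; omega
  rwa [h2] at this

lemma PP2_mem {n k d : ℕ} (hd : Even d) (h0 : d ≠ 0) (i : Fin k) (J)
    (hJ : ∀ g : Matrix (Fin n) (Fin n) ℝ, IsO g → g.det = 1 → g * J = J * g) :
    PP J ({i} : Finset (Fin k)) (d / 2 - 1) ∈ Vdk n d k ⊓ SOInvariant n := by
  refine ⟨?_, PP_inv _ _ _ hJ⟩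
  have := PP_mem (n := n) J ({i} : Finset (Fin k)) (d / 2 - 1)
  have h2 : 2 * (d / 2 - 1) + 2 * ({i} : Finset (Fin k)).card = d := by
    obtain ⟨c, rfl⟩ := hd; simp; omega
  rwa [h2] at this

lemma rank_odd {m d k : ℕ} (hd : Odd d) :
    Module.finrank ℂ ↥(Vdk (m + 2) d k ⊓ SOInvariant (m + 2)) = 0 := by
  apply finrank_eq _ 0 Fin.elim0 Fin.elim0
  · intro P hP _
    exact zero_odd hd hP.1 hP.2
  · intro c
    exact ⟨0, Submodule.zero_mem _, fun i => i.elim0⟩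

lemma surj1 {m d k : ℕ} (hd : Even d) (I : Finset (Fin (m + 2))) (hI : I.card = k)
    (c : Fin 1 → ℂ) : ∃ P ∈ Vdk (m + 2) d k ⊓ SOInvariant (m + 2),
      ∀ i : Fin 1, P (e0 m) (dS (ind I)) = c i := by
  obtain ⟨σ, hσ⟩ := exists_emb I hI
  have hne := PP_ne ∅ (d / 2) I σ hσ (by simp)
  refine ⟨(c 0 / PP 1 (∅ : Finset (Fin k)) (d / 2) (e0 m) (dS (ind I))) •
    PP 1 (∅ : Finset (Fin k)) (d / 2), Submodule.smul_mem _ _ (PP1_mem hd), ?_⟩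
  intro i
  rw [Subsingleton.elim i 0]
  simp only [Pi.smul_apply, smul_eq_mul]
  exact div_mul_cancel₀ _ hne

lemma exists_set {m k : ℕ} (hk : k ≤ m + 2) : ∃ I : Finset (Fin (m + 2)), I.card = k := by
  obtain ⟨I, -, h⟩ := Finset.exists_subset_card_eq
    (s := (Finset.univ : Finset (Fin (m + 2)))) (n := k) (by simpa using hk)
  exact ⟨I, h⟩

lemma rank_d0 {m k : ℕ} (hk : k ≤ m + 2) :
    Module.finrank ℂ ↥(Vdk (m + 2) 0 k ⊓ SOInvariant (m + 2)) = 1 := by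
  obtain ⟨I, hI⟩ := exists_set hk
  apply finrank_eq _ 1 (fun _ => e0 m) (fun _ => dS (ind I))
  · intro P hP h
    exact zero_d0 hP.1 hP.2 I hI (h 0)
  · exact surj1 (by simp) I hI

lemma rank_ext {m d k : ℕ} (h : 3 ≤ m + 2 ∨ k ≠ 1) (hk : k = 0 ∨ k = m + 2)
    (hd : Even d) (h0 : d ≠ 0) :
    Module.finrank ℂ ↥(Vdk (m + 2) d k ⊓ SOInvariant (m + 2)) = 1 := by
  obtain ⟨I, hI⟩ := exists_set (m := m) (k := k) (by omega)
  apply finrank_eq _ 1 (fun _ => e0 m) (fun _ => dS (ind I))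
  · intro P hP hz
    apply zero_even h h0 hd hP.1 hP.2
    intro I' hI'
    have : I' = I := by
      rcases hk with rfl | rfl
      · rw [Finset.card_eq_zero] at hI hI'
        rw [hI, hI']
      · have e1 := (Finset.card_eq_iff_eq_univ I).mp (by simpa using hI)
        have e2 := (Finset.card_eq_iff_eq_univ I').mp (by simpa using hI')
        rw [e1, e2]
    rw [this]; exact hz 0
  · exact surj1 hd I hI

lemma rank_mid {m d k : ℕ} (h : 3 ≤ m + 2 ∨ k ≠ 1) (hk1 : 1 ≤ k) (hk2 : k ≤ m + 1)
    (hd : Even d) (h0 : d ≠ 0) :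
    Module.finrank ℂ ↥(Vdk (m + 2) d k ⊓ SOInvariant (m + 2)) = 2 := by
  obtain ⟨I, hIs, hI⟩ := Finset.exists_subset_card_eq
    (s := (Finset.univ : Finset (Fin (m + 2))).erase 0) (n := k) (by simpa using hk2)
  obtain ⟨J', hJs, hJ'⟩ := Finset.exists_subset_card_eq
    (s := (Finset.univ : Finset (Fin (m + 2))).erase 0) (n := k - 1) (by simp; omega)
  have hI0 : 0 ∉ I := fun hh => by simpa using hIs hh
  have hJ0' : 0 ∉ J' := fun hh => by simpa using hJs hh
  set J := insert 0 J' with hJdef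
  have hJ : J.card = k := by rw [hJdef, Finset.card_insert_of_notMem hJ0', hJ']; omega
  have hJ0 : 0 ∈ J := by simp [hJdef]
  apply finrank_eq _ 2 (fun _ => e0 m) ![dS (ind I), dS (ind J)]
  · intro P hP hz
    have z0 := hz 0
    have z1 := hz 1
    simp only [Matrix.cons_val_zero, Matrix.cons_val_one] at z0 z1
    apply zero_even h h0 hd hP.1 hP.2
    intro K hK
    by_cases hK0 : 0 ∈ K
    · rw [same_type h hP.1 hP.2 K J (by rw [hK, hJ]) (by simp [hK0, hJ0]), z1]
    · rw [same_type h hP.1 hP.2 K I (by rw [hK, hI]) (by simp [hK0, hI0]), z0]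
  · intro c
    let i : Fin k := ⟨0, hk1⟩
    obtain ⟨σ, hσ⟩ := exists_emb I hI
    have n1 := PP_ne ∅ (d / 2) I σ hσ (by simp)
    obtain ⟨τ, hτ, hτ0⟩ := exists_emb0 J hJ i hJ0
    have n2 := PP_ne {i} (d / 2 - 1) J τ hτ (by simpa using hτ0)
    have z2 := PP_zero i (d / 2 - 1) I hI0
    set P1 : (Fin (m + 2) → ℝ) → SymMatrix (m + 2) → ℂ :=
      PP 1 (∅ : Finset (Fin k)) (d / 2) with hP1
    set P2 : (Fin (m + 2) → ℝ) → SymMatrix (m + 2) → ℂ := PP 1 {i} (d / 2 - 1) with hP2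
    set a := c 0 / P1 (e0 m) (dS (ind I)) with ha
    refine ⟨a • P1 + ((c 1 - a * P1 (e0 m) (dS (ind J))) / P2 (e0 m) (dS (ind J))) • P2,
      Submodule.add_mem _ (Submodule.smul_mem _ _ (PP1_mem hd))
        (Submodule.smul_mem _ _ (PP2_mem hd h0 i 1 (by simp))), ?_⟩
    intro j
    fin_cases j
    · simp only [Fin.zero_eta, Matrix.cons_val_zero, Pi.add_apply, Pi.smul_apply, smul_eq_mul, z2]
      rw [ha, div_mul_cancel₀ _ n1]; simp
    · simp only [Fin.mk_one, Matrix.cons_val_one, Matrix.cons_val_zero, Pi.add_apply, Pi.smul_apply, smul_eq_mul]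
      rw [div_mul_cancel₀ _ n2]; ring

def F2 : SymMatrix 2 := ⟨!![0, 1; 1, 0], by ext i j; fin_cases i <;> fin_cases j <;> rfl⟩

lemma Mk21 {f : SymMatrix 2 → ℂ} (hf : f ∈ Mk 2 1) (A : SymMatrix 2) :
    f A = (A.1 0 0 : ℂ) * f (dS (ind {0})) + (A.1 1 1 : ℂ) * f (dS (ind {1}))
      + (A.1 0 1 : ℂ) * f F2 := by
  unfold Mk at hf
  induction hf using Submodule.span_induction with
  | mem f h =>
    obtain ⟨σ, τ, rfl⟩ := h
    have hs : A.1 1 0 = A.1 0 1 := A.2.apply 0 1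
    simp only [det_unique, submatrix_apply, dS, F2]
    generalize σ default = a
    generalize τ default = b
    fin_cases a <;> fin_cases b <;> simp [ind, hs]
  | zero => simp
  | add f g _ _ h1 h2 => simp only [Pi.add_apply, h1, h2]; ring
  | smul c f _ h => simp only [Pi.smul_apply, h, smul_eq_mul]; ring

lemma sum_fin1 (F : (Fin 1 → Fin 2) → ℝ) :
    ∑ σ : Fin 1 → Fin 2, F σ = F (fun _ => 0) + F (fun _ => 1) := by
  rw [← (Equiv.funUnique (Fin 1) (Fin 2)).symm.sum_comp, Fin.sum_univ_two]
  rfl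

lemma PP21_a (e : ℕ) (A : SymMatrix 2) :
    PP 1 (∅ : Finset (Fin 1)) e (e0 0) A = ((A.1 0 0 + A.1 1 1 : ℝ) : ℂ) := by
  unfold PP Ph
  have : e0 0 ⬝ᵥ e0 0 = 1 := by simp
  rw [this]
  simp [sum_fin1, Mv, one_apply]

lemma PP21_b (J : Matrix (Fin 2) (Fin 2) ℝ) (e : ℕ) (A : SymMatrix 2) :
    PP J ({0} : Finset (Fin 1)) e (e0 0) A = ((J 0 0 * A.1 0 0 + J 1 0 * A.1 0 1 : ℝ) : ℂ) := by
  unfold PP Ph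
  have : e0 0 ⬝ᵥ e0 0 = 1 := by simp
  rw [this]
  simp [sum_fin1, Mv, vecMulVec_apply]

lemma J_comm (g : Matrix (Fin 2) (Fin 2) ℝ) (hg : IsO g) (hd : g.det = 1) :
    g * !![0, -1; 1, 0] = !![0, -1; 1, 0] * g := by
  have h1 : gᵀ = g.adjugate := by
    have h2 : g * g.adjugate = 1 := by rw [mul_adjugate, hd, one_smul]
    calc gᵀ = gᵀ * (g * g.adjugate) := by rw [h2, Matrix.mul_one]
      _ = g.adjugate := by rw [← Matrix.mul_assoc, hg.left, Matrix.one_mul]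
  rw [adjugate_fin_two] at h1
  have a1 := congrFun (congrFun h1 0) 0
  have a2 := congrFun (congrFun h1 0) 1
  simp at a1 a2
  ext i j
  fin_cases i <;> fin_cases j <;> simp [mul_apply, Fin.sum_univ_two] <;> linarith

lemma rank_21 {d : ℕ} (hd : Even d) (h0 : d ≠ 0) :
    Module.finrank ℂ ↥(Vdk 2 d 1 ⊓ SOInvariant 2) = 3 := by
  apply finrank_eq _ 3 (fun _ => e0 0) ![dS (ind {0}), dS (ind {1}), F2]
  · intro P hP hz
    have z0 := hz 0
    have z1 := hz 1
    have z2 := hz 2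
    simp only [Matrix.cons_val] at z0 z1 z2
    apply zero_of_e0 (m := 0) hP.1 hP.2
    intro A
    rw [Mk21 (Vdk_mk hP.1 _) A, z0, z1, z2]; simp
  · intro c
    refine ⟨c 1 • PP 1 (∅ : Finset (Fin 1)) (d / 2) + (c 0 - c 1) • PP 1 {0} (d / 2 - 1)
      + c 2 • PP !![0, -1; 1, 0] {0} (d / 2 - 1),
      Submodule.add_mem _ (Submodule.add_mem _ (Submodule.smul_mem _ _ (PP1_mem hd))
        (Submodule.smul_mem _ _ (PP2_mem hd h0 0 1 (by simp))))
        (Submodule.smul_mem _ _ (PP2_mem hd h0 0 _ J_comm)), ?_⟩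
    intro j
    simp only [Pi.add_apply, Pi.smul_apply, smul_eq_mul, PP21_a, PP21_b]
    fin_cases j <;> simp [dS, ind, F2]


open Classical in
/-- The dimension of the space of `SO(n)`-invariant elements of `V_{d,k}`
(`0 ≤ k ≤ n`): for `n ≥ 3`, or `n = 2` and `k ≠ 1`, it is `2` if `d ≥ 2` is even and
`1 ≤ k ≤ n−1`; `1` if `d ≥ 2` is even and `k ∈ {0, n}`; `1` if `d = 0`; and `0` if `d` is
odd. For `n = 2`, `k = 1`, it is `3` if `d ≥ 2` is even, `1` if `d = 0`, `0` if `d` is odd. -/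
theorem dimension_SO_invariants (n d k : ℕ) (hk : k ≤ n) :
    ((3 ≤ n ∨ (n = 2 ∧ k ≠ 1)) →
      Module.finrank ℂ ↥(Vdk n d k ⊓ SOInvariant n) =
        if Odd d then 0 else if d = 0 then 1 else if 1 ≤ k ∧ k ≤ n - 1 then 2 else 1) ∧
    ((n = 2 ∧ k = 1) →
      Module.finrank ℂ ↥(Vdk n d k ⊓ SOInvariant n) =
        if Odd d then 0 else if d = 0 then 1 else 3) := by
  constructor
  · intro h
    obtain ⟨m, rfl⟩ : ∃ m, n = m + 2 := ⟨n - 2, by omega⟩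
    have h' : 3 ≤ m + 2 ∨ k ≠ 1 := by omega
    split_ifs with h1 h2 h3
    · exact rank_odd h1
    · subst h2; exact rank_d0 hk
    · exact rank_mid h' h3.1 (by omega) (Nat.not_odd_iff_even.mp h1) h2
    · exact rank_ext h' (by omega) (Nat.not_odd_iff_even.mp h1) h2
  · rintro ⟨rfl, rfl⟩
    split_ifs with h1 h2
    · exact rank_odd (m := 0) h1
    · subst h2; exact rank_d0 (m := 0) hk
    · exact rank_21 (Nat.not_odd_iff_even.mp h1) h2

end
end

section
/- Fix n ≥ 2. In the space of complex-valued polynomials on ℝ × ℝⁿ × Sym²(ℝⁿ), the family consisting of the polynomials E^{a,i}_k(s,v,A) = s^a |v|^{2i} D(A[k], Id[n−k]) for 0 ≤ k ≤ n and integers a ≥ 0, i ≥ 0, together with the polynomials F^{b,j}_l(s,v,A) = s^b |v|^{2(j−1)} D(A[l], vvᵀ[1], Id[n−l−1]) for 1 ≤ l ≤ n−1 and integers b ≥ 0, j ≥ 1, is linearly independent. -/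
noncomputable section

open Matrix

/-- The mixed discriminant `D(A₁, …, Aₙ) = (1/n!) ∂ⁿ/∂λ₁⋯∂λₙ det(λ₁A₁ + ⋯ + λₙAₙ)` of `n`
matrices, via its standard expansion over permutations. -/
def mixedDisc {n : ℕ} (A : Fin n → Matrix (Fin n) (Fin n) ℝ) : ℝ :=
  ((n.factorial : ℝ))⁻¹ * ∑ σ : Equiv.Perm (Fin n), (Matrix.of fun i j => A (σ i) i j).det

/-- `E^{a,i}_k(s, v, A) = s^a |v|^{2i} D(A[k], Id[n−k])` as a function on
`ℝ × ℝⁿ × Sym²(ℝⁿ)` (with values in `ℂ`). -/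
def Epoly (n : ℕ) (a i k : ℕ) : ℝ × (Fin n → ℝ) × SymMatrix n → ℂ := fun q =>
  (((q.1 ^ a * (∑ t, q.2.1 t ^ 2) ^ i *
    mixedDisc (fun t : Fin n => if (t : ℕ) < k then q.2.2.1 else 1)) : ℝ) : ℂ)

/-- `F^{b,j}_l(s, v, A) = s^b |v|^{2(j−1)} D(A[l], vvᵀ[1], Id[n−l−1])` as a function on
`ℝ × ℝⁿ × Sym²(ℝⁿ)` (with values in `ℂ`). -/
def Fpoly (n : ℕ) (b j l : ℕ) : ℝ × (Fin n → ℝ) × SymMatrix n → ℂ := fun q =>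
  (((q.1 ^ b * (∑ t, q.2.1 t ^ 2) ^ (j - 1) *
    mixedDisc (fun t : Fin n =>
      if (t : ℕ) < l then q.2.2.1
      else if (t : ℕ) < l + 1 then Matrix.vecMulVec q.2.1 q.2.1
      else 1)) : ℝ) : ℂ)

theorem aux_mixedDisc {m : ℕ} (D : Fin (m+1) → Matrix (Fin (m+1)) (Fin (m+1)) ℝ)
    (f g : Fin (m+1) → ℝ)
    (hD : ∀ t, D t = Matrix.diagonal (Fin.cons (f t) (fun _ => g t))) :
    mixedDisc D = ((m:ℝ)+1)⁻¹ * ∑ t, f t * ∏ u ∈ Finset.univ.erase t, g u := by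
  unfold mixedDisc
  have h1 : ∀ σ : Equiv.Perm (Fin (m+1)), (Matrix.of fun i j => D (σ i) i j).det
      = f (σ 0) * ∏ u ∈ Finset.univ.erase (σ 0), g u := by
    intro σ
    have : (Matrix.of fun i j => D (σ i) i j)
        = Matrix.diagonal (fun i => (Fin.cons (f (σ i)) (fun _ => g (σ i)) : Fin (m+1) → ℝ) i) := by
      ext i j
      simp only [Matrix.of_apply, hD, Matrix.diagonal_apply]
    rw [this, Matrix.det_diagonal, ← Finset.mul_prod_erase _ _ (Finset.mem_univ 0)]
    congr 1
    refine Finset.prod_bij (fun i _ => σ i) ?_ ?_ ?_ ?_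
    · intro i hi; simpa using hi
    · intro i _ j _ h; simpa using h
    · intro u hu
      refine ⟨σ.symm u, ?_, by simp⟩
      simp only [Finset.mem_erase, Finset.mem_univ, and_true] at hu ⊢
      intro h; apply hu; rw [← h]; simp
    · intro i hi
      simp only [Finset.mem_erase, Finset.mem_univ, and_true] at hi
      obtain ⟨j, rfl⟩ := Fin.exists_succ_eq.mpr hi
      simp
  simp_rw [h1]
  rw [← Equiv.sum_comp (Equiv.Perm.decomposeFin.symm), Fintype.sum_prod_type]
  simp only [Equiv.Perm.decomposeFin_symm_apply_zero, Finset.sum_const, Finset.card_univ,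
    Fintype.card_perm, Fintype.card_fin, nsmul_eq_mul]
  rw [← Finset.mul_sum, Nat.factorial_succ, ← mul_assoc]
  congr 1
  have := Nat.factorial_pos m
  push_cast
  field_simp

theorem aux_card {m k : ℕ} (hk : k ≤ m + 1) :
    (Finset.univ.filter (fun u : Fin (m+1) => (u:ℕ) < k)).card = k := by
  rw [Fin.card_filter_val_lt]; simpa using hk

theorem aux_E {m k : ℕ} (hk : k ≤ m + 1) (x y : ℝ) :
    mixedDisc (fun t : Fin (m+1) => if (t : ℕ) < k then
      Matrix.diagonal (Fin.cons x (fun _ => y) : Fin (m+1) → ℝ) else 1)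
    = ((m:ℝ)+1)⁻¹ * (((m:ℝ)+1-k) * y^k + k * (x * y^(k-1))) := by
  rw [aux_mixedDisc _ (fun t => if (t:ℕ) < k then x else 1) (fun t => if (t:ℕ) < k then y else 1)]
  · congr 1
    have : ∀ t : Fin (m+1), ((if (t:ℕ) < k then x else 1) *
        ∏ u ∈ Finset.univ.erase t, (if (u:ℕ) < k then y else 1))
        = if (t:ℕ) < k then x * y^(k-1) else y^k := by
      intro t
      rw [Finset.prod_ite, Finset.prod_const, Finset.prod_const_one, Finset.filter_erase]
      split_ifs with h
      · rw [Finset.card_erase_of_mem (by simpa using h), aux_card hk]; simp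
      · rw [Finset.erase_eq_of_notMem (by simpa using h), aux_card hk]; simp
    simp_rw [this]
    rw [Finset.sum_ite, Finset.sum_const, Finset.sum_const, aux_card hk]
    have h2 : (Finset.univ.filter (fun u : Fin (m+1) => ¬ (u:ℕ) < k)).card = m + 1 - k := by
      have := Finset.card_filter_add_card_filter_not (s := (Finset.univ : Finset (Fin (m+1))))
        (fun u : Fin (m+1) => (u:ℕ) < k)
      rw [aux_card hk] at this
      simp at this
      simp
      omega
    rw [h2]
    simp only [nsmul_eq_mul]
    rw [Nat.cast_sub hk]
    push_cast
    ring
  · intro t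
    by_cases h : (t:ℕ) < k
    · simp [h]
    · simp only [h, if_false]
      rw [← Matrix.diagonal_one]
      congr 1
      ext i
      refine Fin.cases ?_ (fun j => ?_) i <;> simp

theorem aux_F {m l : ℕ} (hl : l ≤ m) (r x y : ℝ) :
    mixedDisc (fun t : Fin (m+1) => if (t : ℕ) < l then
      Matrix.diagonal (Fin.cons x (fun _ => y) : Fin (m+1) → ℝ) else
      if (t:ℕ) < l + 1 then Matrix.vecMulVec (Fin.cons r (fun _ => 0) : Fin (m+1) → ℝ)
        (Fin.cons r (fun _ => 0) : Fin (m+1) → ℝ) else 1)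
    = ((m:ℝ)+1)⁻¹ * (r^2 * y^l) := by
  rw [aux_mixedDisc _ (fun t => if (t:ℕ) < l then x else if (t:ℕ) < l+1 then r^2 else 1)
    (fun t => if (t:ℕ) < l then y else if (t:ℕ) < l+1 then 0 else 1)]
  · congr 1
    rw [Finset.sum_eq_single (⟨l, by omega⟩ : Fin (m+1))]
    · simp only [lt_irrefl, if_false, Nat.lt_succ_self, if_true]
      congr 1
      have : ∀ u ∈ Finset.univ.erase (⟨l, by omega⟩ : Fin (m+1)),
         (if (u:ℕ) < l then y else if (u:ℕ) < l+1 then 0 else 1) = if (u:ℕ) < l then y else 1 := by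
        intro u hu
        have : (u:ℕ) ≠ l := by
          intro h
          simp [Fin.ext_iff, h] at hu
        have h3 : (u:ℕ) < l + 1 ↔ (u:ℕ) < l := by omega
        simp only [h3]
        split_ifs <;> rfl
      rw [Finset.prod_congr rfl this, Finset.prod_ite, Finset.prod_const, Finset.prod_const_one,
        Finset.filter_erase, Finset.erase_eq_of_notMem (by simp), aux_card (by omega)]
      simp
    · intro t _ ht
      rw [Finset.prod_eq_zero (i := (⟨l, by omega⟩ : Fin (m+1)))]
      · simp
      · simpa using ht.symm
      · simp
    · simp
  · intro t
    by_cases h : (t:ℕ) < l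
    · simp [h]
    · simp only [h, if_false]
      by_cases h' : (t:ℕ) < l + 1
      · simp only [h', if_true]
        ext i j
        rw [Matrix.vecMulVec_apply, Matrix.diagonal_apply]
        refine Fin.cases ?_ (fun i => ?_) i <;> refine Fin.cases ?_ (fun j => ?_) j <;>
          simp [pow_two, Fin.succ_ne_zero, (Fin.succ_ne_zero _).symm]
      · simp only [h', if_false]
        rw [← Matrix.diagonal_one]
        congr 1
        ext i
        refine Fin.cases ?_ (fun j => ?_) i <;> simp

/-- exponent vector -/
def auxExp (a i e k : ℕ) : Fin 4 →₀ ℕ := Finsupp.equivFunOnFinite.symm ![a, i, e, k]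

theorem auxExp_inj {a i e k a' i' e' k' : ℕ} :
    auxExp a i e k = auxExp a' i' e' k' ↔ a = a' ∧ i = i' ∧ e = e' ∧ k = k' := by
  unfold auxExp
  rw [Equiv.apply_eq_iff_eq]
  constructor
  · intro h
    exact ⟨congrFun h 0, congrFun h 1, congrFun h 2, congrFun h 3⟩
  · rintro ⟨rfl, rfl, rfl, rfl⟩; rfl

theorem aux_eval (a i e k : ℕ) (c : ℂ) (z : Fin 4 → ℂ) :
    MvPolynomial.eval z (MvPolynomial.monomial (auxExp a i e k) c)
      = c * (z 0 ^ a * z 1 ^ i * z 2 ^ e * z 3 ^ k) := by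
  rw [MvPolynomial.eval_monomial, Finsupp.prod_fintype _ _ (by simp)]
  simp [Fin.prod_univ_four, auxExp]

abbrev auxIdx (n : ℕ) :=
  (ℕ × ℕ × {k : ℕ // k ≤ n}) ⊕ (ℕ × {j : ℕ // 1 ≤ j} × {l : ℕ // 1 ≤ l ∧ l ≤ n - 1})

/-- polynomial family -/
def auxP (n : ℕ) : auxIdx n → MvPolynomial (Fin 4) ℂ
  | Sum.inl (a, i, k) => MvPolynomial.monomial (auxExp a (2*i) 0 k.1) ((n:ℂ)⁻¹ * ((n:ℂ) - k.1)) +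
      MvPolynomial.monomial (auxExp a (2*i) 1 (k.1-1)) ((n:ℂ)⁻¹ * (k.1 : ℂ))
  | Sum.inr (b, j, l) => MvPolynomial.monomial (auxExp b (2*j.1) 0 l.1) ((n:ℂ)⁻¹)

/-- dual family -/
def auxPhi (n : ℕ) : auxIdx n → Module.Dual ℂ (MvPolynomial (Fin 4) ℂ)
  | Sum.inl (a, i, k) => if k.1 = 0 then MvPolynomial.lcoeff ℂ (auxExp a (2*i) 0 0) else
      ((n:ℂ) / k.1) • MvPolynomial.lcoeff ℂ (auxExp a (2*i) 1 (k.1-1))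
  | Sum.inr (b, j, l) => (n:ℂ) • (MvPolynomial.lcoeff ℂ (auxExp b (2*j.1) 0 l.1) -
      (((n:ℂ) - l.1) / l.1) • MvPolynomial.lcoeff ℂ (auxExp b (2*j.1) 1 (l.1-1)))

theorem auxP_li (n : ℕ) (hn : 2 ≤ n) : LinearIndependent ℂ (auxP n) := by
  have hn0 : (n:ℂ) ≠ 0 := by norm_cast; omega
  refine LinearIndependent.of_pairwise_dual_eq_zero_one (auxP n) (auxPhi n) ?_ ?_
  · rintro (⟨a, i, k, hk⟩ | ⟨b, ⟨j, hj⟩, l, hl⟩) (⟨a', i', k', hk'⟩ | ⟨b', ⟨j', hj'⟩, l', hl'⟩) hne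
    · simp only [auxPhi, auxP]
      simp only [ne_eq, Sum.inl.injEq, Prod.mk.injEq, Subtype.mk.injEq] at hne
      by_cases h0 : k = 0
      · simp [h0, MvPolynomial.coeff_monomial, auxExp_inj]
        intros; omega
      · simp [h0, MvPolynomial.coeff_monomial, auxExp_inj]
        intros
        by_cases hk0 : k' = 0
        · right; exact hk0
        · omega
    · simp only [auxPhi, auxP]
      by_cases h0 : k = 0
      · simp [h0, MvPolynomial.coeff_monomial, auxExp_inj]
        intros; omega
      · simp [h0, MvPolynomial.coeff_monomial, auxExp_inj]
    · have hl0 : (l:ℂ) ≠ 0 := by norm_cast; omega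
      simp only [auxPhi, auxP]
      by_cases hk0 : k' = 0
      · subst hk0
        simp [MvPolynomial.coeff_monomial, auxExp_inj]
        intros; omega
      · have e : (k' - 1 = l - 1) ↔ k' = l := by omega
        simp [MvPolynomial.coeff_monomial, auxExp_inj, e]
        right
        split_ifs with h
        · obtain ⟨_, _, rfl⟩ := h
          field_simp
          ring
        · simp
    · simp only [auxPhi, auxP]
      simp only [ne_eq, Sum.inr.injEq, Prod.mk.injEq, Subtype.mk.injEq] at hne
      simp [MvPolynomial.coeff_monomial, auxExp_inj]
      intros; omega
  · rintro (⟨a, i, k, hk⟩ | ⟨b, ⟨j, hj⟩, l, hl⟩)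
    · simp only [auxPhi, auxP]
      by_cases h0 : k = 0
      · simp [h0, MvPolynomial.coeff_monomial, auxExp_inj, hn0]
      · have hk0 : (k:ℂ) ≠ 0 := by exact_mod_cast h0
        simp [h0, MvPolynomial.coeff_monomial, auxExp_inj]
        field_simp
    · simp [auxPhi, auxP, MvPolynomial.coeff_monomial, auxExp_inj, hn0]

/-- evaluation at real points -/
def auxEv : MvPolynomial (Fin 4) ℂ →ₗ[ℂ] ((Fin 4 → ℝ) → ℂ) where
  toFun P := fun z => MvPolynomial.eval (fun i => ((z i : ℝ) : ℂ)) P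
  map_add' := by intros; ext; simp
  map_smul' := by intros; ext; simp

theorem auxEv_inj : LinearMap.ker auxEv = ⊥ := by
  rw [LinearMap.ker_eq_bot']
  intro P hP
  refine MvPolynomial.funext_set (fun _ => Set.range (fun x : ℝ => (x:ℂ)))
    (fun _ => Set.infinite_range_of_injective Complex.ofReal_injective) ?_
  intro z hz
  have : ∀ i, ∃ x : ℝ, (x:ℂ) = z i := fun i => hz i (Set.mem_univ i)
  choose x hx using this
  have h := congrFun hP x
  simp only [auxEv, LinearMap.coe_mk, AddHom.coe_mk, hx] at h
  simpa using h

/-- test points -/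
def auxPt (m : ℕ) (z : Fin 4 → ℝ) : ℝ × (Fin (m+1) → ℝ) × SymMatrix (m+1) :=
  (z 0, Fin.cons (z 1) (fun _ => 0), ⟨Matrix.diagonal (Fin.cons (z 2) (fun _ => z 3)),
    Matrix.isSymm_diagonal _⟩)

/-- For `n ≥ 2`, the family of polynomial functions `E^{a,i}_k`
(`0 ≤ k ≤ n`, `a, i ≥ 0`) together with `F^{b,j}_l` (`1 ≤ l ≤ n−1`, `b ≥ 0`, `j ≥ 1`) is
linearly independent in the space of complex-valued polynomial functions on
`ℝ × ℝⁿ × Sym²(ℝⁿ)`. -/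
theorem E_F_linearly_independent (n : ℕ) (hn : 2 ≤ n) :
    LinearIndependent ℂ
      (fun p : (ℕ × ℕ × {k : ℕ // k ≤ n}) ⊕ (ℕ × {j : ℕ // 1 ≤ j} × {l : ℕ // 1 ≤ l ∧ l ≤ n - 1}) =>
        match p with
        | Sum.inl (a, i, k) => Epoly n a i k.1
        | Sum.inr (b, j, l) => Fpoly n b j.1 l.1) := by
  obtain ⟨m, rfl⟩ : ∃ m, n = m + 1 := ⟨n - 1, by omega⟩
  refine LinearIndependent.of_comp (LinearMap.funLeft ℂ ℂ (auxPt m)) ?_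
  have h := (auxP_li (m+1) hn).map' auxEv auxEv_inj
  have key : ∀ (u w : auxIdx (m+1) → (Fin 4 → ℝ) → ℂ), LinearIndependent ℂ w → u = w →
      LinearIndependent ℂ u := fun u w h e => e ▸ h
  refine key _ _ h ?_
  ext p z
  rcases p with ⟨a, i, k, hk⟩ | ⟨b, ⟨j, hj⟩, l, hl⟩
  · simp only [Function.comp, LinearMap.funLeft_apply, Epoly, auxPt, aux_E hk, auxEv, auxP,
      LinearMap.coe_mk, AddHom.coe_mk, map_add, aux_eval, Fin.sum_univ_succ]
    simp [← pow_mul]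
    ring
  · obtain ⟨j, rfl⟩ : ∃ j', j = j' + 1 := ⟨j - 1, by omega⟩
    simp only [Function.comp, LinearMap.funLeft_apply, Fpoly, auxPt,
      aux_F (show l ≤ m by omega), auxEv, auxP,
      LinearMap.coe_mk, AddHom.coe_mk, aux_eval, Fin.sum_univ_succ]
    simp [← pow_mul]
    ring

end
end
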